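/- arXiv:1901.06342 — 8 statements merged into one kernel-verified Lean document; each statement's English description precedes it below -/
import Mathlib

section
/- Let A be a unital associative ℂ-algebra and φ : A → ℂ a linear functional, and let (κ*_n) be the associated family of multilinear functionals. Then for every n ≥ 1, every k with 1 ≤ k ≤ n, and all a_1, …, a_{n+1} ∈ A, one has κ*_{n+1}(a_1, …, a_k, a_{k+1}, …, a_{n+1}) = κ*_n(a_1, …, a_k·a_{k+1}, …, a_{n+1}) − κ*_k(a_1, …, a_k) · κ*_{n+1−k}(a_{k+1}, …, a_{n+1}). -/
/-- The multilinear functionals `κ*ₙ` associated with a linear functional `φ`,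
encoded on lists: `kappaL φ [a₁, …, aₙ] = κ*ₙ(a₁, …, aₙ)` (with value `1` on the
empty list, by convention). They satisfy `κ*₁(a) = φ(a)` and
`κ*_{n+1}(a₁, a₂, …, a_{n+1}) = κ*ₙ(a₁·a₂, a₃, …) − φ(a₁)·κ*ₙ(a₂, a₃, …)`. -/
noncomputable def kappaL {A : Type*} [Ring A] (φ : A → ℂ) : List A → ℂ
  | [] => 1
  | [a] => φ a
  | a :: b :: l => kappaL φ ((a * b) :: l) - φ a * kappaL φ (b :: l)
termination_by l => l.length

/-- Proposition 3 (first part): for `1 ≤ k ≤ n`,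
`κ*_{n+1}(a₁, …, a_{n+1}) = κ*ₙ(a₁, …, a_k·a_{k+1}, …, a_{n+1})
  − κ*_k(a₁, …, a_k)·κ*_{n+1−k}(a_{k+1}, …, a_{n+1})`.
Here `l₁ = [a₁, …, a_{k−1}]`, `a = a_k`, `b = a_{k+1}`, `l₂ = [a_{k+2}, …, a_{n+1}]`. -/
theorem kappaStar_mul_split {A : Type*} [Ring A] [Algebra ℂ A] (φ : A →ₗ[ℂ] ℂ)
    (l₁ l₂ : List A) (a b : A) :
    kappaL (⇑φ) (l₁ ++ a :: b :: l₂) =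
      kappaL (⇑φ) (l₁ ++ (a * b) :: l₂) -
        kappaL (⇑φ) (l₁ ++ [a]) * kappaL (⇑φ) (b :: l₂) := by
  induction hn : l₁.length generalizing l₁ with
  | zero =>
    obtain rfl := List.length_eq_zero_iff.mp hn
    simp [kappaL]
  | succ n ih =>
    match l₁, hn with
    | [c], _ =>
      simp only [List.cons_append, List.nil_append, kappaL, mul_assoc]
      ring
    | c :: d :: l, hn =>
      have h1 := ih ((c * d) :: l) (by simpa using hn)
      have h2 := ih (d :: l) (by simpa using hn)
      simp only [List.cons_append] at h1 h2 ⊢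
      rw [kappaL.eq_3, kappaL.eq_3, kappaL.eq_3, h1, h2]
      ring
end

section
/- Assume the family (A_i)_{i∈I} is V-monotonically independent with respect to φ. Let (i_1, …, i_n) ∈ I^n with i_k ≠ i_{k+1} for all k, and let r ∈ {1, …, n} be such that (i_1, …, i_r) ∈ I_r and either r = n or (i_1, …, i_{r+1}) ∉ I_{r+1}. Let a_k ∈ A_{i_k} for k = 1, …, n and set a_k^0 = a_k − φ(a_k)·1_{i_k}. Then φ(a_1 ⋯ a_n) = Σ_{k=1}^{r} φ(a_k) · φ(a_1^0 ⋯ a_{k−1}^0 · a_{k+1} ⋯ a_n), where the k = 1 summand is φ(a_1)·φ(a_2 a_3 ⋯ a_n). -/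
open scoped BigOperators

/-- `IsVTuple i` says that the tuple `(i 0, …, i (n-1))` is "V-shaped", i.e. it belongs to
`Iₙ = ⋃_{m=1}^n I_{n,m}` where
`I_{n,m} = {(i₁, …, iₙ) : i₁ > … > iₘ < … < iₙ}`. -/
def IsVTuple {I : Type*} [LT I] {n : ℕ} (i : Fin n → I) : Prop :=
  ∃ m : Fin n,
    (∀ j : ℕ, ∀ h : j + 1 ≤ m.1,
      i ⟨j + 1, h.trans_lt m.2⟩ < i ⟨j, Nat.lt_of_succ_lt (h.trans_lt m.2)⟩) ∧
    (∀ j : ℕ, m.1 ≤ j → ∀ h : j + 1 < n, i ⟨j, Nat.lt_of_succ_lt h⟩ < i ⟨j + 1, h⟩)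

/-- A tuple of indices has pairwise distinct neighboring entries. -/
def AdjDistinct {I : Type*} {n : ℕ} (idx : Fin n → I) : Prop :=
  ∀ j : ℕ, ∀ h : j + 1 < n, idx ⟨j, Nat.lt_of_succ_lt h⟩ ≠ idx ⟨j + 1, h⟩

/-- V-monotone independence of a family of (non-unital) subalgebras `Asub i`, each with a
distinguished inner unit `unit i`, with respect to a linear functional `φ`:
`φ(unit i) = 1` for all `i`, together with conditions (i) (freeness condition) and
(ii) of Definition 4 of the paper. -/
structure VMonotoneIndep {I : Type*} [LinearOrder I] {A : Type*} [Ring A] [Algebra ℂ A]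
    (Asub : I → NonUnitalSubalgebra ℂ A) (unit : I → A) (φ : A →ₗ[ℂ] ℂ) : Prop where
  unit_state : ∀ i, φ (unit i) = 1
  free : ∀ {n : ℕ}, 1 ≤ n → ∀ idx : Fin n → I, AdjDistinct idx →
    ∀ a : Fin n → A, (∀ k, a k ∈ Asub (idx k)) → (∀ k, φ (a k) = 0) →
    φ (List.ofFn a).prod = 0
  unit_cond : ∀ {n : ℕ} (idx : Fin n → I), AdjDistinct idx →
    ∀ a : Fin n → A, (∀ k, a k ∈ Asub (idx k)) →
    ∀ r : ℕ, 1 ≤ r → ∀ hr : r ≤ n,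
      IsVTuple (fun k : Fin r => idx ⟨k.1, k.2.trans_le hr⟩) →
      (∀ h : r + 1 ≤ n, ¬ IsVTuple (fun k : Fin (r + 1) => idx ⟨k.1, k.2.trans_le h⟩)) →
      ∀ j : Fin n, (∀ k : Fin n, k.1 < j.1 → φ (a k) = 0) →
        φ (List.ofFn (Function.update a j (unit (idx j)))).prod =
          if j.1 < r then φ ((List.ofFn a).eraseIdx j.1).prod else 0

/-- Proposition 1: the recursive formula for mixed moments of V-monotonically independent
subalgebras. Here `r` is such that `(i₁, …, i_r) ∈ I_r` and either `r = n` or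
`(i₁, …, i_{r+1}) ∉ I_{r+1}`, and `a_k⁰ = a_k − φ(a_k)·1_{i_k}`. -/
theorem vMonotone_recursive_moment_formula
    {I : Type*} [LinearOrder I] {A : Type*} [Ring A] [Algebra ℂ A]
    (Asub : I → NonUnitalSubalgebra ℂ A) (unit : I → A) (φ : A →ₗ[ℂ] ℂ)
    (hφ1 : φ 1 = 1)
    (h_mem : ∀ i, unit i ∈ Asub i)
    (h_unit : ∀ i, ∀ a ∈ Asub i, unit i * a = a ∧ a * unit i = a)
    (hind : VMonotoneIndep Asub unit φ)
    {n : ℕ} (idx : Fin n → I) (hadj : AdjDistinct idx)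
    (r : ℕ) (hr1 : 1 ≤ r) (hrn : r ≤ n)
    (hV : IsVTuple (fun k : Fin r => idx ⟨k.1, k.2.trans_le hrn⟩))
    (hmax : ∀ h : r + 1 ≤ n, ¬ IsVTuple (fun k : Fin (r + 1) => idx ⟨k.1, k.2.trans_le h⟩))
    (a : Fin n → A) (ha : ∀ k, a k ∈ Asub (idx k)) :
    φ (List.ofFn a).prod =
      ∑ k ∈ Finset.univ.filter (fun k : Fin n => k.1 < r),
        φ (a k) *
          φ (((List.ofFn (fun l : Fin n =>
              if l.1 < k.1 then a l - φ (a l) • unit (idx l) else a l)).eraseIdx k.1).prod) := by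
  set b : ℕ → Fin n → A := fun m l =>
    if l.1 < m then a l - φ (a l) • unit (idx l) else a l with hb
  have hbmem : ∀ m l, b m l ∈ Asub (idx l) := by
    intro m l
    simp only [hb]
    split_ifs
    · exact sub_mem (ha l) (SMulMemClass.smul_mem _ (h_mem _))
    · exact ha l
  have hbz : ∀ m l, l.1 < m → φ (b m l) = 0 := by
    intro m l h
    simp [hb, h, hind.unit_state]
  have hstep : ∀ k : Fin n, φ (List.ofFn (b k.1)).prod - φ (List.ofFn (b (k.1 + 1))).prod =
      if k.1 < r then φ (a k) * φ ((List.ofFn (b k.1)).eraseIdx k.1).prod else 0 := by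
    intro k
    have h1 : b (k.1 + 1) = Function.update (b k.1) k (a k - φ (a k) • unit (idx k)) := by
      funext l
      by_cases hl : l = k
      · subst hl; simp [hb]
      · have : l.1 ≠ k.1 := fun h => hl (Fin.ext h)
        have h2 : l.1 < k.1 + 1 ↔ l.1 < k.1 := by omega
        simp only [hb, Function.update_of_ne hl, h2]
    have h0 : Function.update (b k.1) k (a k) = b k.1 := by
      rw [Function.update_eq_self_iff]
      simp [hb]
    have h3 := hind.unit_cond idx hadj (b k.1) (hbmem _) r hr1 hrn hV hmax k
      (fun l hl => hbz _ l hl)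
    have h4 : (List.ofFn (b (k.1 + 1))).prod = (List.ofFn (b k.1)).prod -
        φ (a k) • (List.ofFn (Function.update (b k.1) k (unit (idx k)))).prod := by
      have := (MultilinearMap.mkPiAlgebraFin ℂ n A).map_update_sub (b k.1) k (a k)
        (φ (a k) • unit (idx k))
      rw [MultilinearMap.map_update_smul, ← h1, h0] at this
      simpa only [MultilinearMap.mkPiAlgebraFin_apply] using this
    rw [h4, map_sub, map_smul, h3]
    split_ifs <;> simp
  have hlast : φ (List.ofFn (b n)).prod = 0 :=
    hind.free (hr1.trans hrn) idx hadj (b n) (hbmem n) (fun k => hbz n k k.2)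
  have hfirst : b 0 = a := by
    funext l; simp [hb]
  have htel := Fin.sum_univ_eq_sum_range
    (fun k => φ (List.ofFn (b k)).prod - φ (List.ofFn (b (k + 1))).prod) n
  rw [Finset.sum_range_sub' (fun k => φ (List.ofFn (b k)).prod), hlast, hfirst, sub_zero] at htel
  rw [← htel, Finset.sum_filter]
  exact Finset.sum_congr rfl fun k _ => hstep k
end

section
/- Assume the family (A_i)_{i∈I} is V-monotonically independent with respect to φ and fix (i_1, …, i_n) ∈ I^n with i_k ≠ i_{k+1} for all k. Then there exists a polynomial w with complex coefficients in the variables {x_B : B ∈ 𝓘(i_1, …, i_n)}, where 𝓘(i_1, …, i_n) = {B ⊆ {1, …, n} : i_k = i_l for all k, l ∈ B}, such that for all a_1 ∈ A_{i_1}, …, a_n ∈ A_{i_n}: φ(a_1 ⋯ a_n) equals w evaluated at x_B := φ(a_B), where a_B = a_{p_1} ⋯ a_{p_q} for B = {p_1 < … < p_q}. -/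
open scoped BigOperators

namespace VMon

open List

/-- maximal V-shaped prefix -/
lemma exists_r {I : Type*} [LinearOrder I] {n : ℕ} (hn : 1 ≤ n) (idx : Fin n → I) :
    ∃ r : ℕ, 1 ≤ r ∧ ∃ hr : r ≤ n,
      IsVTuple (fun k : Fin r => idx ⟨k.1, k.2.trans_le hr⟩) ∧
      (∀ h : r + 1 ≤ n, ¬ IsVTuple (fun k : Fin (r + 1) => idx ⟨k.1, k.2.trans_le h⟩)) := by
  classical
  let p : ℕ → Prop := fun r => 1 ≤ r ∧ ∃ hr : r ≤ n,
    IsVTuple (fun k : Fin r => idx ⟨k.1, k.2.trans_le hr⟩)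
  have h1 : p 1 := by
    refine ⟨le_refl _, hn, ⟨0, by omega⟩, ?_, ?_⟩
    · intro j h
      exact absurd h (by simp)
    · intro j _ h
      omega
  have hs : p (Nat.findGreatest p n) := Nat.findGreatest_spec hn h1
  obtain ⟨a1, a2, a3⟩ := hs
  refine ⟨_, a1, a2, a3, ?_⟩
  intro h hv
  exact Nat.findGreatest_is_greatest (P := p) (Nat.lt_succ_self _) h ⟨by omega, h, hv⟩

section
variable {I : Type*} [LinearOrder I] {A : Type*} [Ring A] [Algebra ℂ A]
  {Asub : I → NonUnitalSubalgebra ℂ A} {unit : I → A} {φ : A →ₗ[ℂ] ℂ}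

lemma adj_of_chain (l : List I) (h : l.IsChain (· ≠ ·)) :
    AdjDistinct (fun k : Fin l.length => l[k.1]) := by
  intro j hj
  exact List.isChain_iff_getElem.1 h j hj

lemma free_list (hind : VMonotoneIndep Asub unit φ) (w : List (I × A)) (hne : w ≠ [])
    (hc : (w.map Prod.fst).IsChain (· ≠ ·)) (hm : ∀ p ∈ w, p.2 ∈ Asub p.1)
    (h0 : ∀ p ∈ w, φ p.2 = 0) : φ (w.map Prod.snd).prod = 0 := by
  have h := hind.free (n := w.length) (List.length_pos_iff.2 hne) (fun k => w[k.1].1)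
    (by
      intro j hj
      have := List.isChain_iff_getElem.1 hc j (by simpa using hj)
      simpa using this)
    (fun k => w[k.1].2) (fun k => hm _ (List.getElem_mem _)) (fun k => h0 _ (List.getElem_mem _))
  have e : List.ofFn (fun k : Fin w.length => w[k.1].2) = w.map Prod.snd := by
    apply List.ext_getElem <;> simp
  rwa [e] at h

lemma unit_list (hind : VMonotoneIndep Asub unit φ) (h_mem : ∀ i, unit i ∈ Asub i)
    (l : List I) (hc : l.IsChain (· ≠ ·)) (j : ℕ) :
    ∃ c : ℂ, ∀ (u v : List (I × A)) (i : I), u.map Prod.fst ++ i :: v.map Prod.fst = l →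
      u.length = j → (∀ p ∈ u, p.2 ∈ Asub p.1) → (∀ p ∈ v, p.2 ∈ Asub p.1) →
      (∀ p ∈ u, φ p.2 = 0) →
      φ (u.map Prod.snd ++ unit i :: v.map Prod.snd).prod
        = c * φ (u.map Prod.snd ++ v.map Prod.snd).prod := by
  by_cases hl : l = []
  · subst hl
    exact ⟨0, fun u v i h => by simp at h⟩
  obtain ⟨r, hr1, hrn, hv, hnv⟩ := exists_r (List.length_pos_iff.2 hl)
    (fun k : Fin l.length => l[k.1])
  refine ⟨if j < r then 1 else 0, ?_⟩
  intro u v i hl' hj hu hv' h0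
  subst hj
  have hlen : l.length = u.length + (v.length + 1) := by rw [← hl']; simp
  set w : List (I × A) := u ++ (i, unit i) :: v with hw
  have hwl : w.length = l.length := by rw [hlen, hw]; simp
  have hwf : w.map Prod.fst = l := by rw [← hl', hw]; simp
  have hwm : ∀ p ∈ w, p.2 ∈ Asub p.1 := by
    intro p hp
    simp only [hw, List.mem_append, List.mem_cons] at hp
    rcases hp with hp | rfl | hp
    · exact hu _ hp
    · exact h_mem _
    · exact hv' _ hp
  let a : Fin l.length → A := fun k => (w[k.1]'(by rw [hwl]; exact k.2)).2
  have hfst : ∀ k : Fin l.length, l[k.1] = (w[k.1]'(by rw [hwl]; exact k.2)).1 := by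
    intro k
    simp [← hwf]
  have key := hind.unit_cond (fun k : Fin l.length => l[k.1]) (adj_of_chain l hc) a
    (by
      intro k
      simp only [a]
      rw [hfst k]
      exact hwm _ (List.getElem_mem _)) r hr1 hrn hv hnv ⟨u.length, by omega⟩
    (by
      intro k hk
      simp only [a, hw]
      simp only at hk
      rw [List.getElem_append_left hk]
      exact h0 _ (List.getElem_mem _))
  have e1 : Function.update a ⟨u.length, by omega⟩ (unit (l[u.length]'(by omega))) = a := by
    rw [Function.update_eq_self_iff]
    have : l[u.length]'(by omega) = i := by
      simp [← hl']
    simp [a, hw, this]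
  have e2 : List.ofFn a = u.map Prod.snd ++ unit i :: v.map Prod.snd := by
    have : u.map Prod.snd ++ unit i :: v.map Prod.snd = w.map Prod.snd := by simp [hw]
    rw [this]
    apply List.ext_getElem <;> simp [hwl, a]
  have e3 : (u.map Prod.snd ++ unit i :: v.map Prod.snd).eraseIdx u.length
      = u.map Prod.snd ++ v.map Prod.snd := by
    rw [List.eraseIdx_append_of_length_le (by simp)]
    simp
  simp only at key
  rw [e1, e2, e3] at key
  rw [key]
  split_ifs <;> simp

end

section
variable {I : Type*} [LinearOrder I] {A : Type*} [Ring A] [Algebra ℂ A]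
  (Asub : I → NonUnitalSubalgebra ℂ A) (unit : I → A) (φ : A →ₗ[ℂ] ℂ) {n : ℕ} (idx : Fin n → I)

/-- admissible tuples -/
abbrev X := {a : Fin n → A // ∀ k, a k ∈ Asub (idx k)}

/-- polynomial functions of the marginal moments -/
def P (p : X Asub idx → ℂ) : Prop :=
  ∃ w : MvPolynomial {B : Finset (Fin n) // ∀ k ∈ B, ∀ l ∈ B, idx k = idx l} ℂ,
    ∀ a, p a = MvPolynomial.eval (fun B => φ ((B.1.sort (· ≤ ·)).map a.1).prod) w

/-- letters: combinations of ordered products with polynomial coefficients -/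
inductive G (i : I) (L : List (Fin n)) : (X Asub idx → A) → Prop
  | unit : G i L (fun _ => unit i)
  | mon (l : List (Fin n)) (hl : l <+ L) (hne : l ≠ []) (hi : ∀ k ∈ l, idx k = i) :
      G i L (fun x => (l.map x.1).prod)
  | add (f g : X Asub idx → A) : G i L f → G i L g → G i L (fun x => f x + g x)
  | smul (p : X Asub idx → ℂ) (f : X Asub idx → A) : P Asub φ idx p → G i L f →
      G i L (fun x => p x • f x)

variable {Asub unit φ idx}

lemma P.const (c : ℂ) : P Asub φ idx (fun _ => c) := ⟨MvPolynomial.C c, by simp⟩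

lemma P.add {p q : X Asub idx → ℂ} (hp : P Asub φ idx p) (hq : P Asub φ idx q) :
    P Asub φ idx (fun x => p x + q x) := by
  obtain ⟨w, hw⟩ := hp
  obtain ⟨v, hv⟩ := hq
  exact ⟨w + v, fun a => by simp [hw, hv]⟩

lemma P.mul {p q : X Asub idx → ℂ} (hp : P Asub φ idx p) (hq : P Asub φ idx q) :
    P Asub φ idx (fun x => p x * q x) := by
  obtain ⟨w, hw⟩ := hp
  obtain ⟨v, hv⟩ := hq
  exact ⟨w * v, fun a => by simp [hw, hv]⟩

lemma G.mono {i : I} {L L' : List (Fin n)} (h : L <+ L') {f : X Asub idx → A}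
    (hf : G Asub unit φ idx i L f) : G Asub unit φ idx i L' f := by
  induction hf with
  | unit => exact .unit
  | mon l hl hne hi => exact .mon l (hl.trans h) hne hi
  | add f g _ _ h1 h2 => exact .add f g h1 h2
  | smul p f hp _ h1 => exact .smul p f hp h1

lemma prod_mem (i : I) (x : X Asub idx) (l : List (Fin n)) (hne : l ≠ [])
    (hi : ∀ k ∈ l, idx k = i) : (l.map x.1).prod ∈ Asub i := by
  induction l with
  | nil => exact absurd rfl hne
  | cons k l ih =>
    have hk : x.1 k ∈ Asub i := by
      have := x.2 k
      rwa [hi k (by simp)] at this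
    by_cases hl : l = []
    · subst hl
      simpa using hk
    · rw [List.map_cons, List.prod_cons]
      exact mul_mem hk (ih hl (fun k' hk' => hi k' (by simp [hk'])))

lemma G.mem (h_mem : ∀ i, unit i ∈ Asub i) {i : I} {L : List (Fin n)} {f : X Asub idx → A}
    (hf : G Asub unit φ idx i L f) (x : X Asub idx) : f x ∈ Asub i := by
  induction hf with
  | unit => exact h_mem i
  | mon l hl hne hi => exact prod_mem i x l hne hi
  | add f g _ _ h1 h2 => exact add_mem h1 h2
  | smul p f hp _ h1 => exact SMulMemClass.smul_mem _ h1

lemma G.mul (h_mem : ∀ i, unit i ∈ Asub i)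
    (h_unit : ∀ i, ∀ a ∈ Asub i, unit i * a = a ∧ a * unit i = a)
    {i : I} {L L' : List (Fin n)} {f g : X Asub idx → A}
    (hf : G Asub unit φ idx i L f) (hg : G Asub unit φ idx i L' g) :
    G Asub unit φ idx i (L ++ L') (fun x => f x * g x) := by
  induction hf with
  | unit =>
    have : (fun x => unit i * g x) = g := by
      funext x
      exact (h_unit i _ (hg.mem h_mem x)).1
    rw [this]
    exact hg.mono (List.sublist_append_right _ _)
  | add f1 f2 _ _ h1 h2 =>
    simp only [add_mul]
    exact .add _ _ h1 h2
  | smul p f hp _ h1 =>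
    simp only [smul_mul_assoc]
    exact .smul _ _ hp h1
  | mon l hl hne hi =>
    induction hg with
    | unit =>
      have : (fun x : X Asub idx => (l.map x.1).prod * unit i) = fun x => (l.map x.1).prod := by
        funext x
        exact (h_unit i _ (prod_mem i x l hne hi)).2
      rw [this]
      exact .mon l (hl.trans (List.sublist_append_left _ _)) hne hi
    | add f1 f2 _ _ h1 h2 =>
      simp only [mul_add]
      exact .add _ _ h1 h2
    | smul p f hp _ h1 =>
      simp only [mul_smul_comm]
      exact .smul _ _ hp h1
    | mon l' hl' hne' hi' =>
      simp only [← List.prod_append, ← List.map_append]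
      refine .mon (l ++ l') (hl.append hl') (by simp [hne]) ?_
      intro k hk
      rcases List.mem_append.1 hk with h | h
      · exact hi k h
      · exact hi' k h

lemma G.phi (hu : ∀ i, φ (unit i) = 1) {i : I} {L : List (Fin n)} (hL : L <+ List.finRange n)
    {f : X Asub idx → A} (hf : G Asub unit φ idx i L f) : P Asub φ idx (fun x => φ (f x)) := by
  induction hf with
  | unit => simpa [hu] using P.const 1
  | add f1 f2 _ _ h1 h2 => simpa using h1.add h2
  | smul p f hp _ h1 => simpa using hp.mul h1
  | mon l hl hne hi =>
    have hs : l.Pairwise (· < ·) := (List.sortedLT_finRange n).pairwise.sublist (hl.trans hL)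
    have e : l.toFinset.sort (· ≤ ·) = l :=
      (List.toFinset_sort (· ≤ ·) (hs.imp ne_of_lt)).2 (hs.imp le_of_lt)
    refine ⟨MvPolynomial.X ⟨l.toFinset, ?_⟩, ?_⟩
    · intro k hk k' hk'
      rw [hi k (by simpa using hk), hi k' (by simpa using hk')]
    · intro a
      simp [e]

variable (Asub idx) in
/-- letters with colour and support -/
abbrev T := I × List (Fin n) × (X Asub idx → A)

variable (Asub unit φ idx) in
/-- valid words -/
structure Valid (w : List (T Asub idx)) : Prop where
  good : ∀ t ∈ w, G Asub unit φ idx t.1 t.2.1 t.2.2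
  chain : (w.map (fun t => t.1)).IsChain (· ≠ ·)
  sub : (w.map (fun t => t.2.1)).flatten <+ List.finRange n

/-- moment of a word -/
def mom (φ : A →ₗ[ℂ] ℂ) (w : List (T Asub idx)) (x : X Asub idx) : ℂ :=
  φ (w.map (fun t => t.2.2 x)).prod

lemma erase_aux (h_mem : ∀ i, unit i ∈ Asub i)
    (h_unit : ∀ i, ∀ a ∈ Asub i, unit i * a = a ∧ a * unit i = a)
    (u v : List (T Asub idx)) (t : T Asub idx)
    (hv : Valid Asub unit φ idx (u ++ t :: v)) :
    ∃ w, Valid Asub unit φ idx w ∧ w.length < (u ++ t :: v).length ∧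
      ∀ x, mom φ (u ++ v) x = mom φ w x := by
  obtain ⟨hg, hc, hs⟩ := hv
  have hsub : (u ++ v) <+ (u ++ t :: v) := by simp
  by_cases hch : ((u ++ v).map (fun t => t.1)).IsChain (· ≠ ·)
  · refine ⟨u ++ v, ⟨fun s hs => hg s (hsub.subset hs), hch, ?_⟩, by simp, fun x => rfl⟩
    exact ((hsub.map _).flatten).trans hs
  · rw [List.map_append, List.map_cons] at hc
    rw [List.map_append] at hch
    have hcu := hc.left_of_append
    have hcv := (hc.right_of_append).tail
    simp only [List.tail_cons] at hcv
    rw [List.isChain_append] at hch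
    simp only [hcu, hcv, true_and] at hch
    push Not at hch
    obtain ⟨i, hi, i', hi', rfl⟩ := hch
    rcases List.eq_nil_or_concat u with rfl | ⟨u', p, rfl⟩
    · simp at hi
    rcases v with _ | ⟨q, v'⟩
    · simp at hi'
    simp at hi hi'
    subst hi
    refine ⟨u' ++ (p.1, p.2.1 ++ q.2.1, fun x => p.2.2 x * q.2.2 x) :: v', ⟨?_, ?_, ?_⟩, ?_, ?_⟩
    · intro s hs
      simp only [List.mem_append, List.mem_cons] at hs
      rcases hs with hs | rfl | hs
      · exact hg s (by simp [hs])
      · refine G.mul h_mem h_unit (hg p (by simp)) ?_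
        rw [← hi']
        exact hg q (by simp)
      · exact hg s (by simp [hs])
    · simp only [List.map_append, List.map_cons, List.map_nil, List.concat_eq_append] at hcu hcv ⊢
      rw [hi'] at hcv
      rw [List.isChain_split]
      exact ⟨hcu, hcv⟩
    · refine List.Sublist.trans ?_ hs
      simp
    · simp
    · intro x
      simp [mom, mul_assoc]

lemma main_aux (hφ1 : φ 1 = 1) (h_mem : ∀ i, unit i ∈ Asub i)
    (h_unit : ∀ i, ∀ a ∈ Asub i, unit i * a = a ∧ a * unit i = a)
    (hind : VMonotoneIndep Asub unit φ) (N : ℕ) :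
    ∀ w : List (T Asub idx), w.length = N → Valid Asub unit φ idx w →
      P Asub φ idx (mom φ w) := by
  induction N using Nat.strong_induction_on with
  | _ N IH =>
  suffices H : ∀ v u : List (T Asub idx), (u ++ v).length = N → Valid Asub unit φ idx (u ++ v) →
      (∀ t ∈ u, ∀ x, φ (t.2.2 x) = 0) → P Asub φ idx (mom φ (u ++ v)) by
    intro w hw hv
    exact H w [] hw hv (by simp)
  intro v
  induction v with
  | nil =>
    intro u hN hv h0
    rw [List.append_nil] at *
    by_cases hu : u = []
    · subst hu
      have e : mom φ ([] : List (T Asub idx)) = fun _ => 1 := by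
        funext x
        simp [mom, hφ1]
      rw [e]
      exact P.const 1
    · have : mom φ u = fun _ => 0 := by
        funext x
        have := free_list hind (u.map (fun t => (t.1, t.2.2 x))) (by simpa using hu)
          (by simpa [Function.comp_def] using hv.chain)
          (by
            intro p hp
            obtain ⟨t, ht, rfl⟩ := List.mem_map.1 hp
            exact (hv.good t ht).mem h_mem x)
          (by
            intro p hp
            obtain ⟨t, ht, rfl⟩ := List.mem_map.1 hp
            exact h0 t ht x)
        simpa [mom, Function.comp_def] using this
      rw [this]
      exact P.const 0
  | cons t v ih =>
    intro u hN hv h0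
    obtain ⟨i, L, f⟩ := t
    have hf : G Asub unit φ idx i L f := hv.good (i, L, f) (by simp)
    have hL : L <+ List.finRange n := by
      refine List.Sublist.trans ?_ hv.sub
      simp only [List.map_append, List.map_cons, List.flatten_append, List.flatten_cons]
      exact (List.sublist_append_left _ _).trans (List.sublist_append_right _ _)
    have hp : P Asub φ idx (fun x => φ (f x)) := hf.phi hind.unit_state hL
    let f0 : X Asub idx → A := fun x => f x + ((-1) * φ (f x)) • unit i
    have hf0 : G Asub unit φ idx i L f0 :=
      .add _ _ hf (.smul _ _ ((P.const (-1)).mul hp) .unit)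
    have hf00 : ∀ x, φ (f0 x) = 0 := by
      intro x
      simp [f0, hind.unit_state]
    have hv1 : Valid Asub unit φ idx ((u ++ [(i, L, f0)]) ++ v) := by
      refine ⟨?_, ?_, ?_⟩
      · intro s hs
        simp only [List.mem_append, List.mem_cons, List.not_mem_nil, or_false] at hs
        rcases hs with (hs | rfl) | hs
        · exact hv.good s (by simp [hs])
        · exact hf0
        · exact hv.good s (by simp [hs])
      · simpa using hv.chain
      · simpa using hv.sub
    have t1 := ih (u ++ [(i, L, f0)]) (by simpa using hN) hv1 (by
      intro s hs
      simp only [List.mem_append, List.mem_cons, List.not_mem_nil, or_false] at hs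
      rcases hs with hs | rfl
      · exact h0 s hs
      · exact hf00)
    obtain ⟨w, hwv, hwl, hw⟩ := erase_aux h_mem h_unit u v (i, L, f) hv
    have t2 := IH w.length (by omega) w rfl hwv
    obtain ⟨c, hc⟩ := unit_list hind h_mem _ hv.chain u.length
    have : mom φ (u ++ (i, L, f) :: v) = fun x => mom φ ((u ++ [(i, L, f0)]) ++ v) x
        + φ (f x) * (c * mom φ w x) := by
      funext x
      have h := hc (u.map (fun t => (t.1, t.2.2 x))) (v.map (fun t => (t.1, t.2.2 x))) i
        (by simp [Function.comp_def]) (by simp)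
        (by
          intro p hp
          obtain ⟨t, ht, rfl⟩ := List.mem_map.1 hp
          exact (hv.good t (by simp [ht])).mem h_mem x)
        (by
          intro p hp
          obtain ⟨t, ht, rfl⟩ := List.mem_map.1 hp
          exact (hv.good t (by simp [ht])).mem h_mem x)
        (by
          intro p hp
          obtain ⟨t, ht, rfl⟩ := List.mem_map.1 hp
          exact h0 t ht x)
      rw [← hw x]
      simp only [List.map_map, Function.comp_def] at h
      simp only [mom, List.map_append, List.map_cons, List.map_nil]
      rw [← h]
      simp only [List.prod_append, List.prod_cons, List.prod_nil, mul_one, f0, mul_add, add_mul,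
        map_add, smul_mul_assoc, mul_smul_comm, map_smul, smul_eq_mul, mul_assoc]
      ring
    rw [this]
    exact t1.add (hp.mul ((P.const c).mul t2))

end

end VMon

/-- Corollary 1: there is a universal polynomial `w` in the variables `x_B`,
`B ∈ 𝓘(i₁, …, iₙ) = {B ⊆ [n] : i_k = i_l for all k, l ∈ B}`, expressing the mixed moment
`φ(a₁ ⋯ aₙ)` in terms of the marginal moments `φ(a_B)`, `a_B = a_{p₁} ⋯ a_{p_q}` for
`B = {p₁ < … < p_q}`. -/
theorem vMonotone_universal_polynomial
    {I : Type*} [LinearOrder I] {A : Type*} [Ring A] [Algebra ℂ A]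
    (Asub : I → NonUnitalSubalgebra ℂ A) (unit : I → A) (φ : A →ₗ[ℂ] ℂ)
    (hφ1 : φ 1 = 1)
    (h_mem : ∀ i, unit i ∈ Asub i)
    (h_unit : ∀ i, ∀ a ∈ Asub i, unit i * a = a ∧ a * unit i = a)
    (hind : VMonotoneIndep Asub unit φ)
    {n : ℕ} (idx : Fin n → I) (hadj : AdjDistinct idx) :
    ∃ w : MvPolynomial {B : Finset (Fin n) // ∀ k ∈ B, ∀ l ∈ B, idx k = idx l} ℂ,
      ∀ a : Fin n → A, (∀ k, a k ∈ Asub (idx k)) →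
        φ (List.ofFn a).prod =
          MvPolynomial.eval (fun B => φ ((B.1.sort (· ≤ ·)).map a).prod) w := by
  have h := VMon.main_aux (idx := idx) hφ1 h_mem h_unit hind n
    ((List.finRange n).map (fun k => (idx k, [k], fun x => x.1 k))) (by simp) (by
      refine ⟨?_, ?_, ?_⟩
      · intro t ht
        obtain ⟨k, _, rfl⟩ := List.mem_map.1 ht
        have := VMon.G.mon (Asub := Asub) (unit := unit) (φ := φ) (idx := idx) (i := idx k)
          (L := [k]) [k] (List.Sublist.refl _) (by simp) (by simp)
        simpa using this
      · rw [List.isChain_iff_getElem]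
        intro j hj
        simpa using hadj j (by simpa using hj)
      · simp [Function.comp_def, ← List.flatMap_def])
  obtain ⟨w, hw⟩ := h
  refine ⟨w, fun a ha => ?_⟩
  rw [← hw ⟨a, ha⟩]
  simp [VMon.mom, Function.comp_def, List.ofFn_eq_map]
end

section
/- Let A be a unital C*-algebra with a state φ, let (a_i)_{i≥1} and (1_i)_{i≥1} be elements of A with 1_i·a_i = a_i·1_i = a_i, and let A_i be the subalgebra generated by a_i and 1_i (with inner unit 1_i). Assume the family (A_i)_{i≥1}, indexed by ℕ₊ with its natural order, is V-monotonically independent with respect to φ, and that the a_i are identically distributed (φ(a_i^m) = φ(a_1^m) for all m ≥ 1) with φ(a_i) = 0 and φ(a_i²) = 1. Set S_N = N^{−1/2}·(a_1 + … + a_N). Then for every n ∈ ℕ: if n = 2k is even, lim_{N→∞} φ(S_N^n) = |OV²(2k)| / k!, and if n is odd, lim_{N→∞} φ(S_N^n) = 0. -/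
/-- A list of indices is "V-shaped" (belongs to `Iₙ`). -/
def IsVList {I : Type*} [LT I] (l : List I) : Prop :=
  ∃ m : Fin l.length,
    (∀ j : ℕ, ∀ h : j + 1 ≤ m.1,
      l.get ⟨j + 1, h.trans_lt m.2⟩ < l.get ⟨j, Nat.lt_of_succ_lt (h.trans_lt m.2)⟩) ∧
    (∀ j : ℕ, m.1 ≤ j → ∀ h : j + 1 < l.length,
      l.get ⟨j, Nat.lt_of_succ_lt h⟩ < l.get ⟨j + 1, h⟩)

/-- `P` is (the set of blocks of) a partition of `{0, …, n−1}`: blocks are nonempty and every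
point lies in exactly one block. -/
def IsPartitionOn {n : ℕ} (P : Finset (Finset (Fin n))) : Prop :=
  (∀ B ∈ P, B.Nonempty) ∧ ∀ k : Fin n, ∃! B : Finset (Fin n), B ∈ P ∧ k ∈ B

/-- The partition with block set `P` is non-crossing. -/
def NonCrossing {n : ℕ} (P : Finset (Finset (Fin n))) : Prop :=
  ∀ B ∈ P, ∀ B' ∈ P, B ≠ B' →
    ¬ ∃ p₁ ∈ B, ∃ p₂ ∈ B, ∃ q₁ ∈ B', ∃ q₂ ∈ B', p₁ < q₁ ∧ q₁ < p₂ ∧ p₂ < q₂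

/-- `BlockInner B' B` means `B' < B`: all elements of `B` lie strictly between two
consecutive elements of `B'` (so `B` is inner with respect to `B'`). -/
def BlockInner {n : ℕ} (B' B : Finset (Fin n)) : Prop :=
  ∃ x ∈ B', ∃ y ∈ B', x < y ∧ (∀ z ∈ B', ¬(x < z ∧ z < y)) ∧ ∀ k ∈ B, x < k ∧ k < y

/-- `NearestOuter P B' B`: `B'` is the nearest outer block of `B` in the partition `P`. -/
def NearestOuter {n : ℕ} (P : Finset (Finset (Fin n))) (B' B : Finset (Fin n)) : Prop :=
  B' ∈ P ∧ B ∈ P ∧ BlockInner B' B ∧ ¬ ∃ B'' ∈ P, BlockInner B' B'' ∧ BlockInner B'' B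

/-- The labeling `ℓ` of the partition `P` is V-monotone: along every (nonempty) chain of
blocks `B₁, …, B_r` in which `B_j` is the nearest outer block of `B_{j+1}`, the tuple of
labels `(ℓ B₁, …, ℓ B_r)` is V-shaped. -/
def VLabeled {n : ℕ} {I : Type*} [LinearOrder I] (P : Finset (Finset (Fin n)))
    (ℓ : Finset (Fin n) → I) : Prop :=
  ∀ c : List (Finset (Fin n)), (∀ B ∈ c, B ∈ P) → c.Chain' (NearestOuter P) → c ≠ [] →
    IsVList (c.map ℓ)

/-- `κ*_π(a₁, …, aₙ) = ∏_{B ∈ π, B = {p₁ < … < p_q}} κ*_q(a_{p₁}, …, a_{p_q})`. -/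
noncomputable def kappaPart {n : ℕ} {A : Type*} [Ring A] (φ : A → ℂ)
    (P : Finset (Finset (Fin n))) (a : Fin n → A) : ℂ :=
  ∏ B ∈ P, kappaL φ ((B.sort (· ≤ ·)).map a)
/-- The defining conditions for an element of `OV²(2k)`: `P` is a non-crossing pair
partition of `{1, …, 2k}` and `ℓ` is a bijective labeling of its blocks by `{1, …, k}`
which is V-monotone (normalized by `ℓ B = 0` off the blocks, so that each labeled
partition is represented exactly once). -/
def OV2cond (k : ℕ) (P : Finset (Finset (Fin (2 * k)))) (ℓ : Finset (Fin (2 * k)) → ℕ) :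
    Prop :=
  IsPartitionOn P ∧ (∀ B ∈ P, B.card = 2) ∧ NonCrossing P ∧
    Set.BijOn ℓ ↑P (Set.Icc 1 P.card) ∧ VLabeled P ℓ ∧ ∀ B ∉ P, ℓ B = 0

/-- The cardinality `|OV²(2k)|` of the set of V-monotonically labeled ordered
non-crossing pair partitions of `{1, …, 2k}`. -/
noncomputable def cardOV2 (k : ℕ) : ℕ :=
  Nat.card {x : Finset (Finset (Fin (2 * k))) × (Finset (Fin (2 * k)) → ℕ) //
    OV2cond k x.1 x.2}

namespace VM
open Polynomial

/-- V-shapedness of a list, in a form closed under sublists. -/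
def IsV (l : List ℕ) : Prop :=
  l.IsChain (· ≠ ·) ∧ ∀ x y z, [x, y, z].Sublist l → ¬ (x ≤ y ∧ z ≤ y)

theorem IsV.sublist {l l' : List ℕ} (h : IsV l) (hl : l'.Sublist l) (hn : l.Nodup) : IsV l' :=
  ⟨(hn.sublist hl).isChain, fun x y z hx => h.2 x y z (hx.trans hl)⟩

theorem IsV.infix {l l' : List ℕ} (h : IsV l) (hl : l' <:+: l) : IsV l' :=
  ⟨h.1.infix hl, fun x y z hx => h.2 x y z (hx.trans hl.sublist)⟩

theorem isV_reverse {l : List ℕ} : IsV l.reverse ↔ IsV l := by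
  have key : ∀ l : List ℕ, IsV l → IsV l.reverse := by
    intro l h
    refine ⟨List.isChain_reverse.2 (h.1.imp fun _ _ => Ne.symm), fun x y z hx => ?_⟩
    have := h.2 z y x (by simpa using hx.reverse)
    tauto
  exact ⟨fun h => by simpa using key _ h, key l⟩

theorem isV_map {σ : ℕ → ℕ} (hσ : StrictMono σ) {l : List ℕ} : IsV (l.map σ) ↔ IsV l := by
  unfold IsV
  rw [List.isChain_map]
  simp only [ne_eq, hσ.injective.eq_iff]
  refine and_congr_right fun _ => ⟨fun h x y z hx => ?_, fun h x y z hx => ?_⟩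
  · have := h (σ x) (σ y) (σ z) (by simpa using hx.map σ)
    simpa [hσ.le_iff_le] using this
  · obtain ⟨l', hl', he⟩ := List.sublist_map_iff.1 hx
    match l', he with
    | [a, b, c], he =>
      simp at he
      obtain ⟨rfl, rfl, rfl⟩ := he
      have := h a b c hl'
      simpa [hσ.le_iff_le] using this

theorem isVTuple_iff {n : ℕ} (f : Fin n → ℕ) : IsVTuple f ↔
    0 < n ∧ AdjDistinct f ∧ ∀ a b c : Fin n, a < b → b < c → ¬ (f a ≤ f b ∧ f c ≤ f b) := by
  constructor
  · rintro ⟨m, h1, h2⟩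
    have dec : ∀ d i : ℕ, ∀ h : i + (d + 1) ≤ m.1, f ⟨i + (d + 1), by omega⟩ < f ⟨i, by omega⟩ := by
      intro d
      induction d with
      | zero => intro i h; exact h1 i h
      | succ d ih => intro i h; exact (h1 (i + (d + 1)) h).trans (ih i (by omega))
    have inc : ∀ d i : ℕ, m.1 ≤ i → ∀ h : i + (d + 1) < n, f ⟨i, by omega⟩ < f ⟨i + (d + 1), h⟩ := by
      intro d
      induction d with
      | zero => intro i hi h; exact h2 i hi h
      | succ d ih =>
        intro i hi h
        exact (ih i hi (by omega)).trans (h2 (i + (d + 1)) (by omega) h)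
    have dec' : ∀ a b : Fin n, a < b → b ≤ m → f b < f a := by
      intro a b hab hb
      have hab' : a.1 < b.1 := hab
      have hb' : b.1 ≤ m.1 := hb
      have := dec (b.1 - a.1 - 1) a.1 (by omega)
      have e : a.1 + (b.1 - a.1 - 1 + 1) = b.1 := by omega
      simpa [e] using this
    have inc' : ∀ a b : Fin n, a < b → m ≤ a → f a < f b := by
      intro a b hab hb
      have hab' : a.1 < b.1 := hab
      have hb' : m.1 ≤ a.1 := hb
      have := inc (b.1 - a.1 - 1) a.1 hb (by omega)
      have e : a.1 + (b.1 - a.1 - 1 + 1) = b.1 := by omega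
      simpa [e] using this
    refine ⟨m.pos, fun j hj => ?_, fun a b c hab hbc hh => ?_⟩
    · rcases Nat.lt_or_ge j m.1 with h | h
      · exact (h1 j h).ne'
      · exact (h2 j h hj).ne
    · rcases le_or_gt b m with h | h
      · have := dec' a b hab h; omega
      · have := inc' b c hbc h.le; omega
  · rintro ⟨hn, hi, h⟩
    have : Nonempty (Fin n) := ⟨⟨0, hn⟩⟩
    obtain ⟨m, hm⟩ := Finite.exists_min f
    refine ⟨m, fun j hj => ?_, fun j hj hjn => ?_⟩
    · by_contra hc
      have hne : f ⟨j, by omega⟩ ≠ f ⟨j + 1, by omega⟩ := hi j (by omega)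
      have hlt : f ⟨j, by omega⟩ < f ⟨j + 1, by omega⟩ := by omega
      rcases hj.eq_or_lt with e | e
      · have := hm ⟨j, by omega⟩
        have e' : (⟨j + 1, by omega⟩ : Fin n) = m := Fin.ext e
        rw [e'] at hlt; omega
      · have := h ⟨j, by omega⟩ ⟨j + 1, by omega⟩ m (by simp [Fin.lt_def]) (by simpa [Fin.lt_def] using e)
        have h3 := hm ⟨j, by omega⟩
        omega
    · by_contra hc
      have hne : f ⟨j, by omega⟩ ≠ f ⟨j + 1, by omega⟩ := hi j (by omega)
      have hlt : f ⟨j + 1, by omega⟩ < f ⟨j, by omega⟩ := by omega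
      rcases hj.eq_or_lt with e | e
      · have := hm ⟨j + 1, by omega⟩
        have e' : (⟨j, by omega⟩ : Fin n) = m := Fin.ext e.symm
        rw [e'] at hlt; omega
      · have := h m ⟨j, by omega⟩ ⟨j + 1, by omega⟩ (by simpa [Fin.lt_def] using e) (by simp [Fin.lt_def])
        have h3 := hm ⟨j + 1, by omega⟩
        omega

theorem isV_iff_get (l : List ℕ) : IsV l ↔ AdjDistinct l.get ∧
    ∀ a b c : Fin l.length, a < b → b < c → ¬ (l.get a ≤ l.get b ∧ l.get c ≤ l.get b) := by
  unfold IsV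
  rw [List.isChain_iff_getElem]
  refine and_congr_right fun _ => ⟨fun h a b c hab hbc => ?_, fun h x y z hx => ?_⟩
  · apply h
    rw [List.sublist_iff_exists_fin_orderEmbedding_get_eq]
    refine ⟨OrderEmbedding.ofStrictMono ![a, b, c] ?_, ?_⟩
    · intro i j hij
      fin_cases i <;> fin_cases j <;> simp_all
      exact hab.trans hbc
    · intro i
      fin_cases i <;> rfl
  · obtain ⟨g, hg⟩ := List.sublist_iff_exists_fin_orderEmbedding_get_eq.1 hx
    have := h (g ⟨0, by simp⟩) (g ⟨1, by simp⟩) (g ⟨2, by simp⟩) (by simp) (by simp [Fin.lt_def])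
    rw [← hg, ← hg, ← hg] at this
    exact this

theorem isVList_iff (l : List ℕ) : IsVList l ↔ l ≠ [] ∧ IsV l := by
  have : IsVList l ↔ IsVTuple l.get := Iff.rfl
  rw [this, isVTuple_iff, isV_iff_get, List.length_pos_iff]

theorem isVTuple_ofFn {n : ℕ} (f : Fin n → ℕ) : IsVTuple f ↔ 0 < n ∧ IsV (List.ofFn f) := by
  have : IsVTuple f ↔ IsVList (List.ofFn f) := by
    have key : ∀ (m : ℕ) (g : Fin m → ℕ) (e : n = m), (∀ i : Fin n, f i = g (i.cast e)) →
        (IsVTuple f ↔ IsVTuple g) := by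
      rintro m g rfl h
      rw [show f = g from funext h]
    exact key _ _ (by simp) (fun i => by simp)
  rw [this, isVList_iff]
  simp [Nat.pos_iff_ne_zero]

/-- The stack algorithm deciding whether a word contributes. -/
def G : List ℕ → List ℕ → Prop
  | s, [] => s = []
  | s, i :: w => (s.head? = some i ∧ IsV s ∧ G s.tail w) ∨ (s.head? ≠ some i ∧ G (i :: s) w)

end VM
namespace VM
open Polynomial

variable {A : Type*} [Ring A] [Algebra ℂ A]

/-- All the data and hypotheses of the central limit theorem. -/
structure Ctx (φ : A →ₗ[ℂ] ℂ) (a unit : ℕ → A) : Prop where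
  hφ1 : φ 1 = 1
  hu1 : ∀ i, unit i * a i = a i
  hu2 : ∀ i, a i * unit i = a i
  hu3 : ∀ i, unit i * unit i = unit i
  hind : VMonotoneIndep (fun i : ℕ => NonUnitalAlgebra.adjoin ℂ {a i, unit i}) unit φ
  hid : ∀ i : ℕ, ∀ m : ℕ, 1 ≤ m → φ (a i ^ m) = φ (a 0 ^ m)
  hmean : ∀ i, φ (a i) = 0
  hvar : ∀ i, φ (a i ^ 2) = 1

/-- Evaluation of a polynomial in the `i`-th algebra, `1` being sent to the inner unit. -/
noncomputable def ev (a unit : ℕ → A) (i : ℕ) (p : ℂ[X]) : A := unit i * aeval (a i) p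

/-- Evaluation of a word. -/
noncomputable def W (a unit : ℕ → A) (w : List (ℕ × ℂ[X])) : A :=
  (w.map fun x => ev a unit x.1 x.2).prod

/-- The moment functional. -/
noncomputable def mom (φ : A →ₗ[ℂ] ℂ) (a unit : ℕ → A) (p : ℂ[X]) : ℂ := φ (ev a unit 0 p)

variable {φ : A →ₗ[ℂ] ℂ} {a unit : ℕ → A}

theorem ev_one (i : ℕ) : ev a unit i 1 = unit i := by simp [ev]

theorem ev_sub (i : ℕ) (p q : ℂ[X]) : ev a unit i (p - q) = ev a unit i p - ev a unit i q := by
  simp [ev, mul_sub]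

theorem ev_add (i : ℕ) (p q : ℂ[X]) : ev a unit i (p + q) = ev a unit i p + ev a unit i q := by
  simp [ev, mul_add]

theorem ev_C (i : ℕ) (c : ℂ) : ev a unit i (C c) = c • unit i := by
  simp [ev, Algebra.algebraMap_eq_smul_one]

theorem W_append (u v : List (ℕ × ℂ[X])) : W a unit (u ++ v) = W a unit u * W a unit v := by
  simp [W]

theorem W_cons (x : ℕ × ℂ[X]) (v : List (ℕ × ℂ[X])) :
    W a unit (x :: v) = ev a unit x.1 x.2 * W a unit v := by
  simp [W]

theorem W_nil : W a unit [] = 1 := by simp [W]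

namespace Ctx
variable (hc : Ctx φ a unit)
include hc

theorem comm (i : ℕ) (p : ℂ[X]) : Commute (unit i) (aeval (a i) p) := by
  have h : Commute (unit i) (a i) := by
    unfold Commute SemiconjBy; rw [hc.hu1, hc.hu2]
  induction p using Polynomial.induction_on' with
  | add p q hp hq => simpa using hp.add_right hq
  | monomial n c =>
    rw [aeval_monomial]
    exact Commute.mul_right (Algebra.commutes c (unit i)).symm (h.pow_right n)

theorem ev_mul (i : ℕ) (p q : ℂ[X]) :
    ev a unit i (p * q) = ev a unit i p * ev a unit i q := by
  unfold ev
  rw [map_mul, mul_assoc, ← mul_assoc (aeval (a i) p) (unit i), ← (hc.comm i p).eq,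
    ← mul_assoc (unit i), ← mul_assoc (unit i), ← mul_assoc (unit i) (unit i), hc.hu3, mul_assoc]

theorem ev_pow (i m : ℕ) (hm : 1 ≤ m) : ev a unit i (X ^ m) = a i ^ m := by
  obtain ⟨m, rfl⟩ := Nat.exists_eq_add_of_le' hm
  simp only [ev, map_pow, aeval_X]
  rw [pow_succ', ← mul_assoc, hc.hu1]

theorem ev_X (i : ℕ) : ev a unit i X = a i := by
  simpa using hc.ev_pow i 1 le_rfl

theorem ev_mem (i : ℕ) (p : ℂ[X]) :
    ev a unit i p ∈ NonUnitalAlgebra.adjoin ℂ {a i, unit i} := by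
  have hu : unit i ∈ NonUnitalAlgebra.adjoin ℂ {a i, unit i} :=
    NonUnitalAlgebra.subset_adjoin ℂ (by simp)
  have ha : a i ∈ NonUnitalAlgebra.adjoin ℂ {a i, unit i} :=
    NonUnitalAlgebra.subset_adjoin ℂ (by simp)
  induction p using Polynomial.induction_on with
  | C c => rw [ev_C]; exact SMulMemClass.smul_mem c hu
  | add p q hp hq => rw [ev_add]; exact add_mem hp hq
  | monomial n c h =>
    rw [pow_succ, ← mul_assoc, hc.ev_mul, hc.ev_X]
    exact mul_mem h ha

theorem phi_ev (i : ℕ) (p : ℂ[X]) : φ (ev a unit i p) = mom φ a unit p := by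
  unfold mom
  induction p using Polynomial.induction_on' with
  | add p q hp hq => rw [ev_add, ev_add, map_add, map_add, hp, hq]
  | monomial n c =>
    rw [← C_mul_X_pow_eq_monomial, hc.ev_mul, hc.ev_mul, ev_C, ev_C, smul_mul_assoc, smul_mul_assoc,
      map_smul, map_smul]
    congr 1
    rcases Nat.eq_zero_or_pos n with rfl | hn
    · simp [ev_one, hc.hu3, hc.hind.unit_state]
    · have : ∀ i, unit i * ev a unit i (X ^ n) = ev a unit i (X ^ n) := by
        intro i; unfold ev; rw [← mul_assoc, hc.hu3]
      rw [this, this, hc.ev_pow i n hn, hc.ev_pow 0 n hn, hc.hid i n hn]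

theorem mom_sub (p : ℂ[X]) : mom φ a unit (p - C (mom φ a unit p)) = 0 := by
  unfold mom
  rw [ev_sub, ev_C, map_sub, map_smul, hc.hind.unit_state]
  simp

theorem mom_X : mom φ a unit X = 0 := by
  unfold mom; rw [hc.ev_X, hc.hmean]

theorem mom_XX : mom φ a unit (X * X) = 1 := by
  unfold mom; rw [← pow_two, hc.ev_pow 0 2 (by norm_num), hc.hvar]

theorem merge (u v : List (ℕ × ℂ[X])) (i : ℕ) (p q : ℂ[X]) :
    W a unit (u ++ (i, p) :: (i, q) :: v) = W a unit (u ++ (i, p * q) :: v) := by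
  simp only [W_append, W_cons, hc.ev_mul, mul_assoc]

omit hc in
theorem ofFn_ev (L : List (ℕ × ℂ[X])) :
    List.ofFn (fun k : Fin L.length => ev a unit (L.get k).1 (L.get k).2) =
      L.map fun x => ev a unit x.1 x.2 := by
  apply List.ext_getElem <;> simp

theorem free (s : List (ℕ × ℂ[X])) (hs : s ≠ []) (hch : (s.map Prod.fst).IsChain (· ≠ ·))
    (hcen : ∀ x ∈ s, mom φ a unit x.2 = 0) : φ (W a unit s) = 0 := by
  have := hc.hind.free (n := s.length) (List.length_pos_iff.2 hs) (fun k => (s.get k).1) ?_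
    (fun k => ev a unit (s.get k).1 (s.get k).2) (fun k => hc.ev_mem _ _) ?_
  · rwa [ofFn_ev] at this
  · intro j h
    have := List.isChain_iff_getElem.1 hch j (by simpa using h)
    simpa using this
  · intro k
    rw [hc.phi_ev]
    exact hcen _ (List.get_mem _ _)

open Classical in
theorem unit_alt (u v : List (ℕ × ℂ[X])) (i : ℕ)
    (hch : ((u ++ (i, 1) :: v).map Prod.fst).IsChain (· ≠ ·))
    (hcen : ∀ x ∈ u, mom φ a unit x.2 = 0) :
    φ (W a unit (u ++ (i, 1) :: v)) =
      if IsV (u.map Prod.fst ++ [i]) then φ (W a unit (u ++ v)) else 0 := by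
  set L := u ++ (i, (1 : ℂ[X])) :: v with hL
  have hlen : L.length = u.length + (v.length + 1) := by simp [hL]
  have htake : ∀ r (hr : r ≤ L.length),
      List.ofFn (fun k : Fin r => (L.get ⟨k.1, k.2.trans_le hr⟩).1) = (L.map Prod.fst).take r := by
    intro r hr
    apply List.ext_getElem
    · simp [hr]
    · simp
  set r := Nat.findGreatest (fun r => IsV ((L.map Prod.fst).take r)) L.length with hr
  have hrle : r ≤ L.length := Nat.findGreatest_le _
  have h1 : IsV ((L.map Prod.fst).take 1) := by
    have : ∃ x, (L.map Prod.fst).take 1 = [x] := by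
      rcases hm : L.map Prod.fst with _ | ⟨x, l⟩
      · have := congrArg List.length hm; simp at this; simp [this] at hlen
      · exact ⟨x, by simp⟩
    obtain ⟨x, hx⟩ := this
    rw [hx]
    refine ⟨by simp, fun x y z h => ?_⟩
    have := h.length_le
    simp at this
  have hr1 : 1 ≤ r := Nat.le_findGreatest (by omega) h1
  have hrV : IsV ((L.map Prod.fst).take r) :=
    Nat.findGreatest_spec (P := fun r => IsV ((L.map Prod.fst).take r)) (m := 1) (by omega) h1
  have hj : u.length < L.length := by omega
  have key := hc.hind.unit_cond (n := L.length) (fun k => (L.get k).1) ?_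
    (fun k => ev a unit (L.get k).1 (L.get k).2) (fun k => hc.ev_mem _ _) r hr1 hrle ?_ ?_
    ⟨u.length, hj⟩ ?_
  · have hgj : L.get ⟨u.length, hj⟩ = (i, 1) := by simp [hL]
    have hup : Function.update (fun k => ev a unit (L.get k).1 (L.get k).2) ⟨u.length, hj⟩
        (unit (L.get ⟨u.length, hj⟩).1) = (fun k => ev a unit (L.get k).1 (L.get k).2) := by
      rw [Function.update_eq_self_iff, hgj]
      exact (ev_one i).symm
    rw [hup, ofFn_ev] at key
    have her : (L.map fun x => ev a unit x.1 x.2).eraseIdx u.length =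
        (u ++ v).map fun x => ev a unit x.1 x.2 := by
      rw [List.eraseIdx_map, hL, List.eraseIdx_append_of_length_le le_rfl]
      simp
    simp only [her] at key
    have hiff : u.length < r ↔ IsV (u.map Prod.fst ++ [i]) := by
      have ht : (L.map Prod.fst).take (u.length + 1) = u.map Prod.fst ++ [i] := by
        rw [hL, List.map_append, List.take_append]
        simp
      rw [← ht]
      constructor
      · intro h
        refine hrV.infix (List.IsPrefix.isInfix ?_)
        exact List.take_prefix_take_left h
      · intro h
        exact Nat.le_findGreatest (by omega) h
    simp only [hiff] at key
    exact key
  · intro j h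
    have := List.isChain_iff_getElem.1 hch j (by simpa using h)
    simpa using this
  · rw [isVTuple_ofFn, htake r hrle]
    exact ⟨hr1, hrV⟩
  · intro h
    rw [isVTuple_ofFn, htake (r + 1) h]
    rintro ⟨_, h'⟩
    have := Nat.le_findGreatest (P := fun r => IsV ((L.map Prod.fst).take r)) h h'
    omega
  · intro k hk
    rw [hc.phi_ev]
    apply hcen
    have hk' : k.1 < u.length := hk
    simp [hL, List.getElem_append_left hk']

theorem normalize (v : List (ℕ × ℂ[X])) : ∃ v' : List (ℕ × ℂ[X]),
    (v'.map Prod.fst).IsChain (· ≠ ·) ∧ W a unit v' = W a unit v ∧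
    (v'.map Prod.fst).head? = (v.map Prod.fst).head? := by
  induction v with
  | nil => exact ⟨[], by simp⟩
  | cons x v ih =>
    obtain ⟨v', h1, h2, h3⟩ := ih
    rcases v' with _ | ⟨y, v'⟩
    · refine ⟨[x], by simp, ?_, by simp⟩
      rw [W_cons, W_cons, h2]
    · by_cases hxy : x.1 = y.1
      · refine ⟨(x.1, x.2 * y.2) :: v', ?_, ?_, by simp⟩
        · simpa [hxy] using h1
        · rw [W_cons, W_cons x, ← h2, W_cons, hc.ev_mul, ← mul_assoc, hxy]
      · refine ⟨x :: y :: v', ?_, ?_, by simp⟩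
        · simp only [List.map_cons, List.isChain_cons_cons] at h1 ⊢
          exact ⟨hxy, h1⟩
        · rw [W_cons, W_cons, W_cons x, ← h2, W_cons]

open Classical in
theorem split (s v : List (ℕ × ℂ[X])) (i : ℕ) (p : ℂ[X])
    (hch : ((s.map Prod.fst) ++ [i]).IsChain (· ≠ ·))
    (hcen : ∀ x ∈ s, mom φ a unit x.2 = 0) (hv : (v.map Prod.fst).head? ≠ some i) :
    φ (W a unit (s ++ (i, p) :: v)) =
      φ (W a unit (s ++ (i, p - C (mom φ a unit p)) :: v)) + mom φ a unit p *
      (if IsV (s.map Prod.fst ++ [i]) then φ (W a unit (s ++ v)) else 0) := by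
  obtain ⟨v', h1, h2, h3⟩ := hc.normalize v
  have e1 : φ (W a unit (s ++ (i, p) :: v)) =
      φ (W a unit (s ++ (i, p - C (mom φ a unit p)) :: v)) +
        mom φ a unit p * φ (W a unit (s ++ (i, 1) :: v)) := by
    simp only [W_append, W_cons, ev_sub, ev_C, ev_one, sub_mul, mul_sub, map_sub, smul_mul_assoc,
      mul_smul_comm, map_smul, smul_eq_mul]
    ring
  rw [e1]
  congr 2
  have e2 : W a unit (s ++ (i, 1) :: v) = W a unit (s ++ (i, 1) :: v') := by
    simp only [W_append, W_cons, h2]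
  rw [e2, hc.unit_alt s v' i ?_ hcen, W_append, W_append, h2]
  rw [List.map_append, List.map_cons, List.isChain_split]
  refine ⟨hch, ?_⟩
  rw [List.isChain_cons]
  refine ⟨fun y hy => ?_, h1⟩
  rintro rfl
  rw [h3] at hy
  exact hv hy

end Ctx
end VM
namespace VM
open Polynomial

variable {A : Type*} [Ring A] [Algebra ℂ A] {φ : A →ₗ[ℂ] ℂ} {a unit : ℕ → A}

/-- Induction principle: read a word from left to right, keeping a centered alternating prefix. -/
theorem word_induction (φ : A →ₗ[ℂ] ℂ) (a unit : ℕ → A)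
    (P : List (ℕ × ℂ[X]) → List (ℕ × ℂ[X]) → Prop)
    (hnil : ∀ s, (s.map Prod.fst).IsChain (· ≠ ·) → (∀ x ∈ s, mom φ a unit x.2 = 0) → P s [])
    (hleft : ∀ s i p q v, P s ((i, p * q) :: v) → P (s ++ [(i, p)]) ((i, q) :: v))
    (hright : ∀ s i p q v, P s ((i, p * q) :: v) → P s ((i, p) :: (i, q) :: v))
    (hsplit : ∀ s i p v, ((s.map Prod.fst) ++ [i]).IsChain (· ≠ ·) →
      (∀ x ∈ s, mom φ a unit x.2 = 0) → (v.map Prod.fst).head? ≠ some i →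
      P (s ++ [(i, p - C (mom φ a unit p))]) v → P s v → P s ((i, p) :: v))
    (hmom : ∀ p, mom φ a unit (p - C (mom φ a unit p)) = 0)
    (s w : List (ℕ × ℂ[X])) (h1 : (s.map Prod.fst).IsChain (· ≠ ·))
    (h2 : ∀ x ∈ s, mom φ a unit x.2 = 0) : P s w := by
  induction hm : 2 * w.length + s.length using Nat.strong_induction_on generalizing s w with
  | _ m ih =>
  rcases w with _ | ⟨⟨i, p⟩, v⟩
  · exact hnil s h1 h2
  · by_cases hl : (s.map Prod.fst).getLast? = some i
    · rcases s.eq_nil_or_concat with rfl | ⟨s', ⟨j, q⟩, rfl⟩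
      · simp at hl
      · simp at hl
        subst hl
        rw [List.concat_eq_append] at *
        apply hleft
        refine ih _ ?_ _ _ ?_ ?_ rfl
        · simp at hm ⊢; omega
        · rw [List.map_append] at h1
          exact h1.left_of_append
        · intro x hx; exact h2 x (by simp [hx])
    · by_cases hv : (v.map Prod.fst).head? = some i
      · rcases v with _ | ⟨⟨j, q⟩, v⟩
        · simp at hv
        · simp at hv
          subst hv
          apply hright
          refine ih _ ?_ _ _ h1 h2 rfl
          simp at hm ⊢; omega
      · have hch : ((s.map Prod.fst) ++ [i]).IsChain (· ≠ ·) := by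
          rw [List.isChain_append]
          refine ⟨h1, by simp, fun x hx y hy => ?_⟩
          simp at hy
          subst hy
          rintro rfl
          exact hl hx
        refine hsplit s i p v hch h2 hv ?_ ?_
        · refine ih _ ?_ _ _ ?_ ?_ rfl
          · simp at hm ⊢; omega
          · simpa using hch
          · intro x hx
            rcases List.mem_append.1 hx with hx | hx
            · exact h2 x hx
            · simp at hx; subst hx; exact hmom p
        · refine ih _ ?_ _ _ h1 h2 rfl
          simp at hm ⊢; omega

namespace Ctx
variable (hc : Ctx φ a unit)
include hc

theorem singleton_aux (i : ℕ) (s w : List (ℕ × ℂ[X])) (h1 : (s.map Prod.fst).IsChain (· ≠ ·))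
    (h2 : ∀ x ∈ s, mom φ a unit x.2 = 0) :
    ((s ++ w).map Prod.fst).count i = 1 → (∀ x ∈ s ++ w, x.1 = i → mom φ a unit x.2 = 0) →
      φ (W a unit (s ++ w)) = 0 := by
  refine word_induction φ a unit (fun s w =>
    ((s ++ w).map Prod.fst).count i = 1 → (∀ x ∈ s ++ w, x.1 = i → mom φ a unit x.2 = 0) →
      φ (W a unit (s ++ w)) = 0) ?_ ?_ ?_ ?_ hc.mom_sub s w h1 h2
  · intro s h1 h2 h3 h4
    rw [List.append_nil]
    apply hc.free s _ h1 h2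
    rintro rfl
    simp at h3
  · intro s j p q v ih h3 h4
    rw [List.append_assoc, List.singleton_append, hc.merge]
    have hji : j ≠ i := by
      rintro rfl
      simp at h3
      omega
    apply ih
    · simpa [List.count_cons, hji] using h3
    · intro x hx hxi
      simp at hx
      rcases hx with hx | rfl | hx
      · exact h4 x (by simp [hx]) hxi
      · exact absurd hxi hji
      · exact h4 x (by simp [hx]) hxi
  · intro s j p q v ih h3 h4
    rw [hc.merge]
    have hji : j ≠ i := by
      rintro rfl
      simp at h3
      omega
    apply ih
    · simpa [List.count_cons, hji] using h3
    · intro x hx hxi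
      simp at hx
      rcases hx with hx | rfl | hx
      · exact h4 x (by simp [hx]) hxi
      · exact absurd hxi hji
      · exact h4 x (by simp [hx]) hxi
  · intro s j p v hch hcen hv ih1 ih2 h3 h4
    rw [hc.split s v j p hch hcen hv]
    have e1 : φ (W a unit (s ++ (j, p - C (mom φ a unit p)) :: v)) = 0 := by
      rw [List.append_cons]
      apply ih1
      · simpa using h3
      · intro x hx hxi
        simp at hx
        rcases hx with hx | rfl | hx
        · exact h4 x (by simp [hx]) hxi
        · exact hc.mom_sub p
        · exact h4 x (by simp [hx]) hxi
    rw [e1, zero_add]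
    by_cases hji : j = i
    · rw [h4 (j, p) (by simp) hji, zero_mul]
    · rw [ih2, ite_self, mul_zero]
      · simpa [List.count_cons, hji] using h3
      · intro x hx hxi
        refine h4 x ?_ hxi
        simp at hx ⊢
        tauto

theorem singleton (i : ℕ) (w : List (ℕ × ℂ[X])) (h1 : (w.map Prod.fst).count i = 1)
    (h2 : ∀ x ∈ w, x.1 = i → mom φ a unit x.2 = 0) : φ (W a unit w) = 0 :=
  hc.singleton_aux i [] w (by simp) (by simp) h1 h2

theorem invariance (σ : ℕ → ℕ) (hσ : StrictMono σ) (w : List (ℕ × ℂ[X])) :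
    φ (W a unit (w.map fun x => (σ x.1, x.2))) = φ (W a unit w) := by
  have hfst : ∀ s : List (ℕ × ℂ[X]), (s.map fun x => (σ x.1, x.2)).map Prod.fst =
      (s.map Prod.fst).map σ := by intro s; simp
  have hchain : ∀ l : List ℕ, l.IsChain (· ≠ ·) → (l.map σ).IsChain (· ≠ ·) := by
    intro l hl
    rw [List.isChain_map]
    exact hl.imp fun x y h e => h (hσ.injective e)
  have hcn : ∀ s : List (ℕ × ℂ[X]), (∀ x ∈ s, mom φ a unit x.2 = 0) →
      ∀ x ∈ s.map fun x => (σ x.1, x.2), mom φ a unit x.2 = 0 := by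
    intro s h x hx
    obtain ⟨y, hy, rfl⟩ := List.mem_map.1 hx
    exact h y hy
  refine word_induction φ a unit (fun s w =>
    φ (W a unit ((s ++ w).map fun x => (σ x.1, x.2))) = φ (W a unit (s ++ w)))
    ?_ ?_ ?_ ?_ hc.mom_sub [] w (by simp) (by simp)
  · intro s h1 h2
    rw [List.append_nil]
    rcases eq_or_ne s [] with rfl | hs
    · simp
    · rw [hc.free s hs h1 h2, hc.free _ (by simpa using hs) (by rw [hfst]; exact hchain _ h1)
        (hcn s h2)]
  · intro s j p q v ih
    rw [List.append_assoc, List.singleton_append, hc.merge, ← ih]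
    simp only [List.map_append, List.map_cons, hc.merge]
  · intro s j p q v ih
    rw [hc.merge, ← ih]
    simp only [List.map_append, List.map_cons, hc.merge]
  · intro s j p v hch hcen hv ih1 ih2
    rw [hc.split s v j p hch hcen hv]
    simp only [List.map_append, List.map_cons] at ih1 ih2 ⊢
    rw [hc.split _ _ (σ j) p ?_ (hcn s hcen) ?_, ih2]
    · have e : IsV ((s.map fun x => (σ x.1, x.2)).map Prod.fst ++ [σ j]) ↔
          IsV (s.map Prod.fst ++ [j]) := by
        rw [← isV_map hσ (l := s.map Prod.fst ++ [j]), hfst, List.map_append]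
        rfl
      have ih1' : φ (W a unit (s.map (fun x => (σ x.1, x.2)) ++ (σ j, p - C (mom φ a unit p)) ::
          v.map (fun x => (σ x.1, x.2)))) = φ (W a unit (s ++ (j, p - C (mom φ a unit p)) :: v)) := by
        simpa using ih1
      rw [ih1']
      by_cases h : IsV (s.map Prod.fst ++ [j])
      · rw [if_pos h, if_pos (e.2 h)]
      · rw [if_neg h, if_neg (fun h' => h (e.1 h'))]
    · have := hchain _ hch
      rw [List.map_append] at this
      rw [hfst]
      exact this
    · rw [hfst]
      intro h
      apply hv
      rcases v with _ | ⟨y, v⟩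
      · simp at h
      · simp at h ⊢
        exact hσ.injective h

end Ctx

open Classical in
theorem Ctx.phi_G (hc : Ctx φ a unit) (w : List ℕ) : ∀ s : List ℕ, s.IsChain (· ≠ ·) →
    (∀ i ∈ s ++ w, (s ++ w).count i = 2) →
    φ (W a unit ((s.reverse ++ w).map fun i => (i, X))) = if G s w then 1 else 0 := by
  induction w with
  | nil =>
    intro s hs hcount
    rcases eq_or_ne s [] with rfl | hne
    · simp [G, W, hc.hφ1]
    · rw [hc.free]
      · simp [G, hne]
      · simpa using hne
      · simp only [List.append_nil, List.map_map]
        have : (Prod.fst ∘ fun i : ℕ => (i, (X : ℂ[X]))) = id := rfl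
        rw [this, List.map_id, List.isChain_reverse]
        exact hs.imp fun _ _ => Ne.symm
      · intro x hx
        obtain ⟨y, hy, rfl⟩ := List.mem_map.1 hx
        exact hc.mom_X
  | cons i w ih =>
    intro s hs hcount
    have hid : (Prod.fst ∘ fun i : ℕ => (i, (X : ℂ[X]))) = id := rfl
    by_cases hh : s.head? = some i
    · rcases s with _ | ⟨j, s⟩
      · simp at hh
      simp at hh
      subst hh
      have hci := hcount j (by simp)
      have hcs : s.count j = 0 ∧ w.count j = 0 := by
        simp at hci; omega
      have hjs : j ∉ s := List.count_eq_zero.1 hcs.1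
      have hjw : j ∉ w := List.count_eq_zero.1 hcs.2
      have e : ((j :: s).reverse ++ j :: w).map (fun i => (i, (X : ℂ[X]))) =
          s.reverse.map (fun i => (i, X)) ++ (j, X) :: (j, X) :: w.map (fun i => (i, X)) := by
        simp
      rw [e, hc.merge, hc.split]
      · rw [hc.singleton j]
        · rw [hc.mom_XX, ← List.map_append, ih s hs.tail]
          · have : IsV ((s.reverse.map fun i => (i, (X : ℂ[X]))).map Prod.fst ++ [j]) ↔
                IsV (j :: s) := by
              rw [List.map_map, hid, List.map_id, ← isV_reverse (l := j :: s), List.reverse_cons]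
            simp only [this]
            by_cases h1 : IsV (j :: s) <;> by_cases h2 : G s w <;> simp [G, h1, h2]
          · intro x hx
            have hne : j ≠ x := by
              rintro rfl
              simp [hjs, hjw] at hx
            have := hcount x (by simp at hx ⊢; tauto)
            simpa [List.count_cons, hne] using this
        · simp [hid, hcs.1, hcs.2]
        · intro x hx hxj
          simp at hx
          rcases hx with ⟨y, hy, rfl⟩ | rfl | ⟨y, hy, rfl⟩
          · exact hc.mom_X
          · exact hc.mom_sub _
          · exact hc.mom_X
      · rw [List.map_map, hid, List.map_id, ← List.reverse_cons, List.isChain_reverse]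
        exact hs.imp fun _ _ => Ne.symm
      · intro x hx
        obtain ⟨y, hy, rfl⟩ := List.mem_map.1 hx
        exact hc.mom_X
      · rw [List.map_map, hid, List.map_id]
        intro h
        exact hjw (List.mem_of_head? h)
    · have e : s.reverse ++ i :: w = (i :: s).reverse ++ w := by simp
      rw [e, ih (i :: s)]
      · simp [G, hh]
      · rw [List.isChain_cons]
        refine ⟨fun y hy => ?_, hs⟩
        rintro rfl
        exact hh hy
      · intro x hx
        rw [← hcount x (by simp at hx ⊢; tauto)]
        exact List.Perm.count_eq (by simpa using List.perm_middle.symm) x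
end VM
namespace VM

theorem not_G_of_mem {i : ℕ} : ∀ (w s : List ℕ), i ∈ s → i ∉ w → ¬ G s w := by
  intro w
  induction w with
  | nil => intro s hs _ h; simp only [G] at h; subst h; simp at hs
  | cons j w ih =>
    intro s hs hw h
    simp only [List.mem_cons, not_or] at hw
    rcases h with ⟨h1, h2, h3⟩ | ⟨h1, h2⟩
    · refine ih _ ?_ hw.2 h3
      rcases s with _ | ⟨k, s⟩
      · simp at hs
      · simp at h1 hs ⊢
        subst h1
        exact hs.resolve_left hw.1
    · exact ih _ (by simp [hs]) hw.2 h2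

section core
variable {n : ℕ} {t : Fin n → ℕ} {τ : Fin n → Fin n}

/-- The list of openers which are open just before time `q`. -/
def opn (τ : Fin n → Fin n) (q : ℕ) : List (Fin n) :=
  (List.finRange n).filter (fun p => p.1 < q ∧ q ≤ (τ p).1)

theorem mem_opn {q : ℕ} {p : Fin n} : p ∈ opn τ q ↔ p.1 < q ∧ q ≤ (τ p).1 := by
  simp [opn]

theorem sorted_opn (q : ℕ) : (opn τ q).Pairwise (· < ·) :=
  (List.sortedLT_finRange n).pairwise.filter _

/-- `τ` is the partner map of the pairing given by the labels `t`. -/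
structure Pairing (t : Fin n → ℕ) (τ : Fin n → Fin n) : Prop where
  ne : ∀ p, τ p ≠ p
  iff : ∀ p q, t q = t p ↔ q = p ∨ q = τ p

theorem Pairing.lab (h : Pairing t τ) (p : Fin n) : t (τ p) = t p := (h.iff p (τ p)).2 (Or.inr rfl)

theorem Pairing.invol (h : Pairing t τ) (p : Fin n) : τ (τ p) = p := by
  have := (h.iff (τ p) p).1 (h.lab p).symm
  rcases this with e | e
  · exact absurd e.symm (h.ne p)
  · exact e.symm

theorem Pairing.G_iff (h : Pairing t τ) : ∀ d q : ℕ, q + d = n →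
    (G ((opn τ q).map t).reverse ((List.ofFn t).drop q) ↔
      ∀ c : Fin n, q ≤ c.1 → τ c < c →
        (∀ x : Fin n, x < c → c ≤ τ x → x ≤ τ c) ∧ IsV ((opn τ c.1).map t)) := by
  intro d
  induction d with
  | zero =>
    intro q hq
    have e : (List.ofFn t).drop q = [] := by rw [List.drop_eq_nil_iff]; simp; omega
    have e2 : opn τ q = [] := by
      rw [List.eq_nil_iff_forall_not_mem]
      intro p hp
      rw [mem_opn] at hp
      omega
    rw [e, e2]
    simp only [List.map_nil, List.reverse_nil, G, true_iff]
    intro c hc; omega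
  | succ d ih =>
    intro q hq
    have hqn : q < n := by omega
    obtain ⟨c, hc⟩ : ∃ c : Fin n, c.1 = q := ⟨⟨q, hqn⟩, rfl⟩
    have e : (List.ofFn t).drop q = t c :: (List.ofFn t).drop (q + 1) := by
      rw [List.drop_eq_getElem_cons (by simpa using hqn)]
      subst hc
      simp
    have ih' := ih (q + 1) (by omega)
    rw [e]
    rcases lt_or_gt_of_ne (h.ne c) with hcl | hop
    · -- closer
      have hrhs : (∀ c' : Fin n, q ≤ c'.1 → τ c' < c' →
          (∀ x : Fin n, x < c' → c' ≤ τ x → x ≤ τ c') ∧ IsV ((opn τ c'.1).map t)) ↔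
          ((∀ x : Fin n, x < c → c ≤ τ x → x ≤ τ c) ∧ IsV ((opn τ c.1).map t)) ∧
          (∀ c' : Fin n, q + 1 ≤ c'.1 → τ c' < c' →
          (∀ x : Fin n, x < c' → c' ≤ τ x → x ≤ τ c') ∧ IsV ((opn τ c'.1).map t)) := by
        constructor
        · intro H
          exact ⟨H c hc.ge hcl, fun c' h1 h2 => H c' (by omega) h2⟩
        · rintro ⟨H1, H2⟩ c' h1 h2
          rcases Nat.eq_or_lt_of_le h1 with e | e
          · have : c' = c := Fin.ext (by omega)
            subst this; exact H1
          · exact H2 c' e h2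
      rw [hrhs]
      have hmem : τ c ∈ opn τ q := by
        rw [mem_opn, h.invol]
        exact ⟨by rw [← hc]; exact hcl, hc.ge⟩
      by_cases htop : ∀ x : Fin n, x < c → c ≤ τ x → x ≤ τ c
      · have eO : opn τ q = opn τ (q + 1) ++ [τ c] := by
          apply List.Pairwise.eq_of_mem_iff (r := (· < ·)) (sorted_opn q)
          · rw [List.pairwise_append]
            refine ⟨sorted_opn _, by simp, ?_⟩
            intro x hx y hy
            simp at hy
            subst hy
            rw [mem_opn] at hx
            have hxc : x ≠ c := by
              rintro rfl
              have : (τ x).1 < x.1 := hcl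
              omega
            have hx1 : x.1 < c.1 := by
              have := Fin.val_ne_of_ne hxc
              omega
            have h1 := htop x hx1 (by rw [Fin.le_def]; omega)
            refine lt_of_le_of_ne h1 ?_
            rintro rfl
            rw [h.invol] at hx
            omega
          · intro x
            simp only [List.mem_append, List.mem_singleton, mem_opn]
            constructor
            · rintro ⟨h1, h2⟩
              rcases Nat.eq_or_lt_of_le h2 with e | e
              · right
                have : c = τ x := Fin.ext (by omega)
                rw [this, h.invol]
              · left; omega
            · rintro (⟨h1, h2⟩ | rfl)
              · refine ⟨?_, by omega⟩
                by_contra hx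
                have : x = c := Fin.ext (by omega)
                subst this
                have : (τ x).1 < x.1 := hcl
                omega
              · exact mem_opn.1 hmem
        have eS : ((opn τ q).map t).reverse = t c :: ((opn τ (q + 1)).map t).reverse := by
          rw [eO]; simp [h.lab]
        have : G ((opn τ q).map t).reverse (t c :: (List.ofFn t).drop (q + 1)) ↔
            IsV ((opn τ q).map t).reverse ∧
              G ((opn τ (q + 1)).map t).reverse ((List.ofFn t).drop (q + 1)) := by
          simp only [eS, G]
          simp
        rw [this, isV_reverse, ih', hc]
        tauto
      · have hne : ((opn τ q).map t).reverse.head? ≠ some (t c) := by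
          intro hh
          apply htop
          rw [List.head?_reverse] at hh
          rcases (opn τ q).eq_nil_or_concat with e0 | ⟨l, y, e0⟩
          · rw [e0] at hh; simp at hh
          · rw [List.concat_eq_append] at e0
            rw [e0] at hh
            simp at hh
            have hy : y ∈ opn τ q := by rw [e0]; simp
            have hyq := mem_opn.1 hy
            have hyc : y = τ c := by
              rcases (h.iff c y).1 hh with e1 | e1
              · subst e1; omega
              · exact e1
            intro x hx1 hx2
            have hx : x ∈ opn τ q := mem_opn.2 ⟨by rw [← hc]; exact hx1, by rw [← hc]; exact hx2⟩
            have hs := sorted_opn (τ := τ) q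
            rw [e0] at hs hx
            rw [List.pairwise_append] at hs
            simp at hx
            rcases hx with hx | hx
            · have := hs.2.2 x hx y (by simp)
              rw [← hyc]; exact this.le
            · rw [hx, hyc]
        have hG : ¬ G ((opn τ q).map t).reverse (t c :: (List.ofFn t).drop (q + 1)) := by
          rintro (⟨h1, -⟩ | ⟨-, h1⟩)
          · exact hne h1
          · refine not_G_of_mem (i := t c) _ _ (by simp) ?_ h1
            intro hm
            rw [List.mem_drop_iff_getElem] at hm
            obtain ⟨i, hi, he⟩ := hm
            simp at hi
            rw [List.getElem_ofFn, h.iff] at he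
            have h3 : (τ c).1 < c.1 := hcl
            rcases he with he | he
            · have := congrArg Fin.val he; simp at this; omega
            · have := congrArg Fin.val he; simp at this; omega
        tauto
    · -- opener
      have hop' : c.1 < (τ c).1 := hop
      have eO : opn τ (q + 1) = opn τ q ++ [c] := by
        apply List.Pairwise.eq_of_mem_iff (r := (· < ·)) (sorted_opn _)
        · rw [List.pairwise_append]
          refine ⟨sorted_opn _, by simp, ?_⟩
          intro x hx y hy
          simp at hy
          subst hy
          rw [mem_opn] at hx
          rw [Fin.lt_def]; omega
        · intro x
          simp only [List.mem_append, List.mem_singleton, mem_opn]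
          constructor
          · rintro ⟨h1, h2⟩
            rcases Nat.lt_or_ge x.1 q with e | e
            · left; omega
            · right; exact Fin.ext (by omega)
          · rintro (⟨h1, h2⟩ | rfl)
            · refine ⟨by omega, ?_⟩
              by_contra hx
              have : c = τ x := Fin.ext (by omega)
              rw [this, h.invol] at hop'
              omega
            · omega
      have hne : ((opn τ q).map t).reverse.head? ≠ some (t c) := by
        intro hh
        have := List.mem_of_head? hh
        simp only [List.mem_reverse, List.mem_map, mem_opn] at this
        obtain ⟨y, hy, e⟩ := this
        rcases (h.iff c y).1 e with e1 | e1
        · subst e1; omega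
        · subst e1; omega
      have : G ((opn τ q).map t).reverse (t c :: (List.ofFn t).drop (q + 1)) ↔
          G ((opn τ (q + 1)).map t).reverse ((List.ofFn t).drop (q + 1)) := by
        rw [eO]
        simp only [G]
        simp only [hne, false_and, false_or, ne_eq, not_false_eq_true, true_and]
        simp
      rw [this, ih']
      constructor
      · intro H c' h1 h2
        refine H c' ?_ h2
        by_contra h3
        have : c' = c := Fin.ext (by omega)
        subst this
        exact absurd h2 (not_lt.2 hop.le)
      · intro H c' h1 h2
        exact H c' (by omega) h2

/-- The set of blocks of the pairing. -/
def blk (τ : Fin n → Fin n) : Finset (Finset (Fin n)) := Finset.univ.image fun p => {p, τ p}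

theorem Pairing.noncrossing_iff (h : Pairing t τ) : NonCrossing (blk τ) ↔
    ∀ c : Fin n, τ c < c → ∀ x : Fin n, x < c → c ≤ τ x → x ≤ τ c := by
  have part : ∀ p x y : Fin n, x ∈ ({p, τ p} : Finset (Fin n)) → y ∈ ({p, τ p} : Finset (Fin n)) →
      x ≠ y → y = τ x := by
    intro p x y hx hy hxy
    simp at hx hy
    have := h.invol p
    rcases hx with rfl | rfl <;> rcases hy with rfl | rfl <;> simp_all
  constructor
  · intro H c hc x hx1 hx2
    by_contra hlt
    rw [not_le] at hlt
    have hne : x ≠ c := hx1.ne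
    refine H {c, τ c} (by simp [blk]) {x, τ x} (by simp [blk]) ?_
      ⟨τ c, by simp, c, by simp, x, by simp, τ x, by simp, hlt, hx1, lt_of_le_of_ne hx2 ?_⟩
    · intro e
      have : x ∈ ({c, τ c} : Finset (Fin n)) := by rw [e]; simp
      simp at this
      rcases this with e | e
      · exact hne e
      · exact hlt.ne' e
    · intro e
      rw [e, h.invol] at hlt
      exact lt_irrefl _ hlt
  · rintro H B hB B' hB' hne ⟨p₁, hp₁, p₂, hp₂, q₁, hq₁, q₂, hq₂, h1, h2, h3⟩
    simp only [blk, Finset.mem_image, Finset.mem_univ, true_and] at hB hB'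
    obtain ⟨p, rfl⟩ := hB
    obtain ⟨q, rfl⟩ := hB'
    have e1 := part p p₁ p₂ hp₁ hp₂ (h1.trans h2).ne
    have e2 := part q q₁ q₂ hq₁ hq₂ (h2.trans h3).ne
    subst e1 e2
    have := H (τ p₁) (by rw [h.invol]; exact h1.trans h2) q₁ h2 h3.le
    rw [h.invol] at this
    exact absurd h1 (not_lt.2 this)

theorem blockInner_pair {p q : Fin n} : BlockInner ({p, τ p} : Finset (Fin n)) {q, τ q} →
    min p (τ p) < min q (τ q) ∧ max q (τ q) < max p (τ p) := by
  rintro ⟨x, hx, y, hy, hxy, -, hk⟩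
  have h1 := hk q (by simp)
  have h2 := hk (τ q) (by simp)
  have e1 : min p (τ p) ≤ x := by
    simp at hx; rcases hx with rfl | rfl <;> simp
  have e2 : y ≤ max p (τ p) := by
    simp at hy; rcases hy with rfl | rfl <;> simp
  exact ⟨e1.trans_lt (lt_min h1.1 h2.1), (max_lt h1.2 h2.2).trans_le e2⟩

theorem blockInner_of {p q : Fin n} (h1 : p < q) (h2 : q < τ q) (h3 : τ q < τ p) :
    BlockInner ({p, τ p} : Finset (Fin n)) {q, τ q} := by
  refine ⟨p, by simp, τ p, by simp, h1.trans (h2.trans h3), ?_, ?_⟩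
  · intro z hz
    simp at hz
    rcases hz with rfl | rfl <;> simp
  · intro k hk
    simp at hk
    rcases hk with rfl | rfl
    · exact ⟨h1, h2.trans h3⟩
    · exact ⟨h1.trans h2, h3⟩

theorem Pairing.nodup_map (h : Pairing t τ) (q : ℕ) : ((opn τ q).map t).Nodup := by
  rw [List.Nodup, List.pairwise_map]
  refine (sorted_opn q).imp_of_mem ?_
  intro x y hx hy hxy e
  rw [mem_opn] at hx hy
  rcases (h.iff y x).1 e with e1 | e1
  · exact hxy.ne e1
  · subst e1
    rw [h.invol] at hx
    omega

theorem Pairing.vlabeled_iff (h : Pairing t τ) (ℓ : Finset (Fin n) → ℕ)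
    (hℓ : ∀ p, ℓ {p, τ p} = t p)
    (hnc : ∀ c : Fin n, τ c < c → ∀ x : Fin n, x < c → c ≤ τ x → x ≤ τ c) :
    VLabeled (blk τ) ℓ ↔ ∀ c : Fin n, τ c < c → IsV ((opn τ c.1).map t) := by
  have hopen : ∀ B ∈ blk τ, ∃ p : Fin n, p < τ p ∧ ({p, τ p} : Finset (Fin n)) = B := by
    intro B hB
    simp only [blk, Finset.mem_image, Finset.mem_univ, true_and] at hB
    obtain ⟨p, rfl⟩ := hB
    rcases lt_or_gt_of_ne (h.ne p) with e | e
    · exact ⟨τ p, by rwa [h.invol], by rw [h.invol, Finset.pair_comm]⟩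
    · exact ⟨p, e, rfl⟩
  constructor
  · intro H c hc
    have hmem : τ c ∈ opn τ c.1 := by
      rw [mem_opn, h.invol]; exact ⟨hc, le_rfl⟩
    have := H ((opn τ c.1).map fun p => {p, τ p}) ?_ ?_ ?_
    · rw [isVList_iff] at this
      have h2 := this.2
      rw [List.map_map] at h2
      have e : (ℓ ∘ fun p => ({p, τ p} : Finset (Fin n))) = t := funext hℓ
      rwa [e] at h2
    · intro B hB
      obtain ⟨p, -, rfl⟩ := List.mem_map.1 hB
      simp [blk]
    · show List.IsChain _ _
      rw [List.isChain_map, List.isChain_iff_getElem]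
      intro i hi
      have hs := sorted_opn (τ := τ) c.1
      have hs' : (opn τ c.1).SortedLT := hs.sortedLT
      have hp := mem_opn.1 (List.getElem_mem (l := opn τ c.1) (n := i) (by omega))
      have hq := mem_opn.1 (List.getElem_mem (l := opn τ c.1) (n := i + 1) hi)
      have hpq : (opn τ c.1)[i] < (opn τ c.1)[i + 1] :=
        hs'.getElem_lt_getElem_iff.2 (by omega)
      have hbet : ∀ r ∈ opn τ c.1, ¬ ((opn τ c.1)[i] < r ∧ r < (opn τ c.1)[i + 1]) := by
        intro r hr
        obtain ⟨j, hj, rfl⟩ := List.getElem_of_mem hr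
        rw [hs'.getElem_lt_getElem_iff, hs'.getElem_lt_getElem_iff]
        omega
      generalize (opn τ c.1)[i] = p at *
      generalize (opn τ c.1)[i + 1] = q at *
      have hqq : q < τ q := by rw [Fin.lt_def]; omega
      have hpp : p < τ p := by rw [Fin.lt_def]; omega
      have hnest : τ q < τ p := by
        by_contra hlt
        rw [not_lt] at hlt
        have := hnc (τ p) (by rw [h.invol]; exact hpp) q (by rw [Fin.lt_def]; omega) hlt
        rw [h.invol] at this
        exact absurd hpq (not_lt.2 this)
      refine ⟨by simp [blk], by simp [blk], blockInner_of hpq hqq hnest, ?_⟩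
      rintro ⟨B, hB, hB1, hB2⟩
      obtain ⟨r, hr, rfl⟩ := hopen B hB
      have g1 := blockInner_pair hB1
      have g2 := blockInner_pair hB2
      rw [min_eq_left hpp.le, max_eq_right hpp.le, min_eq_left hr.le, max_eq_right hr.le] at g1
      rw [min_eq_left hqq.le, max_eq_right hqq.le, min_eq_left hr.le, max_eq_right hr.le] at g2
      refine hbet r (mem_opn.2 ?_) ⟨g1.1, g2.1⟩
      have k1 : r.1 < q.1 := g2.1
      have k2 : (τ q).1 < (τ r).1 := g2.2
      omega
    · intro e
      simp at e
      rw [e] at hmem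
      simp at hmem
  · intro H c hcP hch hne
    rw [isVList_iff]
    refine ⟨by simpa using hne, ?_⟩
    have : ∃ d : List (Fin n), (∀ p ∈ d, p < τ p) ∧ c = d.map fun p => {p, τ p} := by
      clear hch hne
      induction c with
      | nil => exact ⟨[], by simp⟩
      | cons B c ih =>
        obtain ⟨d, hd1, hd2⟩ := ih (fun B' hB' => hcP B' (by simp [hB']))
        obtain ⟨p, hp, rfl⟩ := hopen B (hcP B (by simp))
        refine ⟨p :: d, ?_, by simp [hd2]⟩
        intro x hx
        rcases List.mem_cons.1 hx with rfl | hx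
        · exact hp
        · exact hd1 x hx
    obtain ⟨d, hd, rfl⟩ := this
    have hch' : d.IsChain (fun p q => min p (τ p) < min q (τ q) ∧ max q (τ q) < max p (τ p)) := by
      have hch2 : List.IsChain _ _ := hch
      rw [List.isChain_map] at hch2
      exact hch2.imp fun p q hpq => blockInner_pair hpq.2.2.1
    have hpw : d.Pairwise (fun p q => min p (τ p) < min q (τ q) ∧ max q (τ q) < max p (τ p)) := by
      have : IsTrans (Fin n)
          (fun p q => min p (τ p) < min q (τ q) ∧ max q (τ q) < max p (τ p)) :=
        ⟨fun x y z h1 h2 => ⟨h1.1.trans h2.1, h2.2.trans h1.2⟩⟩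
      exact hch'.pairwise
    have hpw2 : d.Pairwise (fun p q => p < q ∧ τ q < τ p) := by
      refine hpw.imp_of_mem ?_
      intro p q hp hq hh
      rwa [min_eq_left (hd p hp).le, max_eq_right (hd p hp).le, min_eq_left (hd q hq).le,
        max_eq_right (hd q hq).le] at hh
    rw [List.map_map]
    have e : (ℓ ∘ fun p => ({p, τ p} : Finset (Fin n))) = t := funext hℓ
    rw [e]
    rcases d.eq_nil_or_concat with e0 | ⟨d', z, e0⟩
    · simp [e0] at hne
    rw [List.concat_eq_append] at e0
    have hz : z < τ z := hd z (by simp [e0])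
    have hle : ∀ x ∈ d, x ≤ z ∧ τ z ≤ τ x := by
      intro x hx
      rw [e0] at hx hpw2
      rw [List.pairwise_append] at hpw2
      simp at hx
      rcases hx with hx | rfl
      · have := hpw2.2.2 x hx z (by simp)
        exact ⟨this.1.le, this.2.le⟩
      · simp
    have hsub : d.Sublist (opn τ (τ z).1) := by
      have hlt : d.Pairwise (· < ·) := hpw2.imp fun hh => hh.1
      refine List.sublist_of_subperm_of_pairwise (r := (· < ·)) ?_ hlt (sorted_opn _)
      refine List.Nodup.subperm (hlt.imp fun hh => hh.ne) ?_
      intro x hx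
      have := hle x hx
      exact mem_opn.2 ⟨lt_of_le_of_lt this.1 hz, this.2⟩
    exact (H (τ z) (by rw [h.invol]; exact hz)).sublist (hsub.map t) (h.nodup_map _)

theorem Pairing.core (h : Pairing t τ) (ℓ : Finset (Fin n) → ℕ)
    (hℓ : ∀ p, ℓ {p, τ p} = t p) :
    G [] (List.ofFn t) ↔ NonCrossing (blk τ) ∧ VLabeled (blk τ) ℓ := by
  have e0 : opn τ 0 = [] := by
    rw [List.eq_nil_iff_forall_not_mem]
    intro p hp
    rw [mem_opn] at hp
    omega
  have := h.G_iff n 0 (by simp)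
  rw [e0] at this
  simp only [List.map_nil, List.reverse_nil, List.drop_zero] at this
  rw [this, h.noncrossing_iff]
  constructor
  · intro H
    have hnc : ∀ c : Fin n, τ c < c → ∀ x : Fin n, x < c → c ≤ τ x → x ≤ τ c :=
      fun c hc => (H c (by omega) hc).1
    exact ⟨hnc, (h.vlabeled_iff ℓ hℓ hnc).2 fun c hc => (H c (by omega) hc).2⟩
  · rintro ⟨H1, H2⟩ c _ hc
    exact ⟨H1 c hc, (h.vlabeled_iff ℓ hℓ H1).1 H2 c hc⟩

end core
end VM
namespace VM

/-- Surjections contributing to the limit. -/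
def Good (k : ℕ) (t : Fin (2 * k) → Fin k) : Prop :=
  (∀ i, (Finset.univ.filter fun p => t p = i).card = 2) ∧
    G [] (List.ofFn fun p => (t p).1 + 1)

/-- The fiber of `t` through `p`. -/
def fib {n k : ℕ} (t : Fin n → Fin k) (p : Fin n) : Finset (Fin n) :=
  Finset.univ.filter fun q => t q = t p

theorem mem_fib {n k : ℕ} {t : Fin n → Fin k} {p q : Fin n} : q ∈ fib t p ↔ t q = t p := by
  simp [fib]

open Classical in
/-- The labeling of the fibers. -/
noncomputable def lab {n k : ℕ} (t : Fin n → Fin k) (B : Finset (Fin n)) : ℕ :=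
  if h : ∃ p, fib t p = B then (t h.choose).1 + 1 else 0

theorem lab_fib {n k : ℕ} (t : Fin n → Fin k) (p : Fin n) : lab t (fib t p) = (t p).1 + 1 := by
  have h : ∃ q, fib t q = fib t p := ⟨p, rfl⟩
  rw [lab, dif_pos h]
  have h1 : p ∈ fib t h.choose := by rw [h.choose_spec, mem_fib]
  rw [mem_fib.1 h1]

theorem exists_pairing {n k : ℕ} (t : Fin n → Fin k) (h : ∀ p, (fib t p).card = 2) :
    ∃ τ : Fin n → Fin n, Pairing (fun p => (t p).1 + 1) τ ∧ ∀ p, fib t p = {p, τ p} := by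
  have : ∀ p, ∃ q, q ≠ p ∧ fib t p = {p, q} := by
    intro p
    obtain ⟨x, y, hxy, e⟩ := Finset.card_eq_two.1 (h p)
    have hp : p ∈ fib t p := mem_fib.2 rfl
    rw [e] at hp
    simp at hp
    rcases hp with rfl | rfl
    · exact ⟨y, hxy.symm, e⟩
    · exact ⟨x, hxy, by rw [e, Finset.pair_comm]⟩
  choose τ h1 h2 using this
  refine ⟨τ, ⟨h1, ?_⟩, h2⟩
  intro p q
  have : q ∈ fib t p ↔ q = p ∨ q = τ p := by rw [h2]; simp
  rw [mem_fib] at this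
  rw [← this]
  simp [Fin.ext_iff]

theorem card_of_partition {n : ℕ} (P : Finset (Finset (Fin n))) (h1 : IsPartitionOn P)
    (h2 : ∀ B ∈ P, B.card = 2) : 2 * P.card = n := by
  have := Finset.sum_card (B := P) (n := 1) (fun p => by
    obtain ⟨B, hB, hu⟩ := h1.2 p
    rw [Finset.card_eq_one]
    refine ⟨B, ?_⟩
    ext B'
    simp only [Finset.mem_filter, Finset.mem_singleton]
    exact ⟨fun h => hu B' h, fun h => h ▸ hB⟩)
  rw [Finset.sum_congr rfl h2] at this
  simp at this
  omega

theorem isPartition_fib {n k : ℕ} (t : Fin n → Fin k) :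
    IsPartitionOn (Finset.univ.image (fib t)) := by
  refine ⟨fun B hB => ?_, fun p => ⟨fib t p, ⟨by simp, mem_fib.2 rfl⟩, ?_⟩⟩
  · simp at hB
    obtain ⟨p, rfl⟩ := hB
    exact ⟨p, mem_fib.2 rfl⟩
  · rintro B ⟨hB, hp⟩
    simp at hB
    obtain ⟨q, rfl⟩ := hB
    rw [mem_fib] at hp
    ext x
    simp [mem_fib, hp]

theorem good_iff {k : ℕ} (t : Fin (2 * k) → Fin k)
    (h : ∀ i, (Finset.univ.filter fun p => t p = i).card = 2) :
    G [] (List.ofFn fun p => (t p).1 + 1) ↔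
      NonCrossing (Finset.univ.image (fib t)) ∧
        VLabeled (Finset.univ.image (fib t)) (lab t) := by
  obtain ⟨τ, h1, h2⟩ := exists_pairing t (fun p => h (t p))
  have e : Finset.univ.image (fib t) = blk τ := by
    rw [blk, show fib t = _ from funext h2]
  rw [e]
  exact h1.core (lab t) (fun p => by rw [← h2, lab_fib])

theorem good_cond {k : ℕ} (t : Fin (2 * k) → Fin k) (h : Good k t) :
    OV2cond k (Finset.univ.image (fib t)) (lab t) := by
  have hc : ∀ B ∈ Finset.univ.image (fib t), B.card = 2 := by
    intro B hB
    simp at hB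
    obtain ⟨p, rfl⟩ := hB
    exact h.1 (t p)
  have hk : (Finset.univ.image (fib t)).card = k := by
    have := card_of_partition _ (isPartition_fib t) hc
    omega
  have hg := (good_iff t h.1).1 h.2
  refine ⟨isPartition_fib t, hc, hg.1, ?_, hg.2, ?_⟩
  · rw [hk]
    refine ⟨?_, ?_, ?_⟩
    · intro B hB
      simp at hB
      obtain ⟨p, rfl⟩ := hB
      rw [lab_fib]
      have := (t p).2
      exact ⟨by omega, by omega⟩
    · intro B hB B' hB' e
      simp at hB hB'
      obtain ⟨p, rfl⟩ := hB
      obtain ⟨q, rfl⟩ := hB'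
      rw [lab_fib, lab_fib] at e
      have : t p = t q := Fin.ext (by omega)
      ext x
      simp [mem_fib, this]
    · rintro i ⟨hi1, hi2⟩
      have hpos : 0 < (Finset.univ.filter fun p => t p = (⟨i - 1, by omega⟩ : Fin k)).card := by
        rw [h.1]; norm_num
      obtain ⟨p, hp⟩ := Finset.card_pos.1 hpos
      simp at hp
      refine ⟨fib t p, by simp, ?_⟩
      rw [lab_fib, hp]
      simp
      omega
  · intro B hB
    rw [lab, dif_neg]
    rintro ⟨p, rfl⟩
    exact hB (by simp)

theorem card_good (k : ℕ) : Nat.card {t : Fin (2 * k) → Fin k // Good k t} = cardOV2 k := by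
  unfold cardOV2
  refine Nat.card_congr (Equiv.ofBijective
    (fun t => ⟨(Finset.univ.image (fib t.1), lab t.1), good_cond t.1 t.2⟩) ⟨?_, ?_⟩)
  · rintro ⟨t, ht⟩ ⟨t', ht'⟩ e
    simp only [Subtype.mk.injEq, Prod.mk.injEq] at e
    obtain ⟨e1, e2⟩ := e
    ext p
    simp only
    have hb : fib t p = fib t' p := by
      obtain ⟨B, hB, hu⟩ := (isPartition_fib t).2 p
      rw [hu (fib t p) ⟨by simp, mem_fib.2 rfl⟩, hu (fib t' p) ⟨by rw [e1]; simp, mem_fib.2 rfl⟩]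
    have h1 := lab_fib t p
    rw [e2, hb, lab_fib] at h1
    omega
  · rintro ⟨⟨P, ℓ⟩, h⟩
    obtain ⟨h1, h2, h3, h4, h5, h6⟩ := id h
    simp only at h1 h2 h3 h4 h5 h6
    have hk : P.card = k := by
      have := card_of_partition P h1 h2
      omega
    rw [hk] at h4
    have hex : ∀ p, ∃ B, B ∈ P ∧ p ∈ B := fun p => (h1.2 p).exists
    choose b hb1 hb2 using hex
    have hbu : ∀ p B, B ∈ P → p ∈ B → B = b p := fun p B hB hp =>
      (h1.2 p).unique ⟨hB, hp⟩ ⟨hb1 p, hb2 p⟩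
    have hr : ∀ p, 1 ≤ ℓ (b p) ∧ ℓ (b p) ≤ k := fun p => h4.mapsTo (hb1 p)
    let t : Fin (2 * k) → Fin k := fun p => ⟨ℓ (b p) - 1, by have := hr p; omega⟩
    have ht : ∀ p, (t p).1 + 1 = ℓ (b p) := by
      intro p; have := hr p; simp only [t]; omega
    have hfib : ∀ p, fib t p = b p := by
      intro p
      ext q
      rw [mem_fib]
      constructor
      · intro e
        have : ℓ (b q) = ℓ (b p) := by rw [← ht, ← ht, e]
        have := h4.injOn (hb1 q) (hb1 p) this
        rw [← this]; exact hb2 q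
      · intro hq
        have := hbu q (b p) (hb1 p) hq
        apply Fin.ext
        have e1 := ht p
        have e2 := ht q
        rw [this] at e1
        omega
    have hP : Finset.univ.image (fib t) = P := by
      ext B
      simp only [Finset.mem_image, Finset.mem_univ, true_and]
      constructor
      · rintro ⟨p, rfl⟩; rw [hfib]; exact hb1 p
      · intro hB
        obtain ⟨p, hp⟩ := h1.1 B hB
        exact ⟨p, by rw [hfib, hbu p B hB hp]⟩
    have hlab : lab t = ℓ := by
      ext B
      by_cases hB : B ∈ P
      · obtain ⟨p, hp⟩ := h1.1 B hB
        rw [hbu p B hB hp, ← hfib, lab_fib, hfib, ht]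
      · rw [h6 B hB, lab, dif_neg]
        rintro ⟨p, rfl⟩
        exact hB (by rw [hfib]; exact hb1 p)
    have hcard : ∀ i, (Finset.univ.filter fun p => t p = i).card = 2 := by
      intro i
      obtain ⟨B, hB, e⟩ := h4.surjOn (show i.1 + 1 ∈ Set.Icc 1 k from ⟨by omega, i.2⟩)
      obtain ⟨p, hp⟩ := h1.1 B hB
      have e1 := ht p
      rw [← hbu p B hB hp, e] at e1
      have e2 : t p = i := Fin.ext (by omega)
      have e3 : (Finset.univ.filter fun p => t p = i) = fib t p := by rw [fib, e2]
      rw [e3, hfib, ← hbu p B hB hp]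
      exact h2 B hB
    refine ⟨⟨t, hcard, (good_iff t hcard).2 ?_⟩, ?_⟩
    · rw [hP, hlab]; exact ⟨h3, h5⟩
    · simp only [Subtype.mk.injEq, Prod.mk.injEq]
      exact ⟨hP, hlab⟩
end VM
namespace VM
open Polynomial

variable {A : Type*} [Ring A] [Algebra ℂ A] {φ : A →ₗ[ℂ] ℂ} {a unit : ℕ → A}

/-- Mixed moments. -/
noncomputable def fm (φ : A →ₗ[ℂ] ℂ) (a : ℕ → A) {n : ℕ} (t : Fin n → ℕ) : ℂ :=
  φ (List.ofFn fun p => a (t p)).prod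

open Classical in
/-- The coefficient of `N.choose m`. -/
noncomputable def cf (φ : A →ₗ[ℂ] ℂ) (a : ℕ → A) (n m : ℕ) : ℂ :=
  ∑ t ∈ (Finset.univ : Finset (Fin n → Fin m)).filter Function.Surjective, fm φ a fun p => (t p).1

theorem sum_pow_eq (n N : ℕ) : φ ((∑ i ∈ Finset.range N, a i) ^ n) =
    ∑ t : Fin n → Fin N, fm φ a fun p => (t p).1 := by
  have h := MultilinearMap.map_sum (MultilinearMap.mkPiAlgebraFin ℂ n A)
    (fun (_ : Fin n) (j : Fin N) => a j.1)
  simp only [MultilinearMap.mkPiAlgebraFin_apply] at h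
  rw [← Fin.sum_univ_eq_sum_range, ← List.prod_replicate, ← List.ofFn_const, h, map_sum]
  rfl

namespace Ctx
variable (hc : Ctx φ a unit)
include hc

theorem fm_eq {n : ℕ} (t : Fin n → ℕ) :
    fm φ a t = φ (W a unit ((List.ofFn t).map fun i => (i, X))) := by
  unfold fm W
  congr 2
  rw [List.map_map, List.map_ofFn]
  congr 1
  ext p
  simp [hc.ev_X]

theorem fm_inv {n : ℕ} (t : Fin n → ℕ) (σ : ℕ → ℕ) (hσ : StrictMono σ) :
    fm φ a (fun p => σ (t p)) = fm φ a t := by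
  rw [hc.fm_eq, hc.fm_eq, ← hc.invariance σ hσ ((List.ofFn t).map fun i => (i, X))]
  congr 2
  rw [List.map_map, List.map_ofFn, List.map_ofFn]
  rfl

theorem fm_emb {n m N : ℕ} (t : Fin n → Fin m) (e : Fin m ↪o Fin N) :
    fm φ a (fun p => (e (t p)).1) = fm φ a (fun p => (t p).1) := by
  rw [← hc.fm_inv (fun p => (t p).1) (fun x => if h : x < m then (e ⟨x, h⟩).1 else N + x)]
  · simp
  · intro x y hxy
    simp only
    split_ifs with h1 h2 h2
    · have : e ⟨x, h1⟩ < e ⟨y, h2⟩ := e.strictMono hxy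
      exact this
    · have := (e ⟨x, h1⟩).2; omega
    · omega
    · omega

theorem fm_sum (n N : ℕ) : ∑ t : Fin n → Fin N, fm φ a (fun p => (t p).1) =
    ∑ m ∈ Finset.range (N + 1), (N.choose m : ℂ) * cf φ a n m := by
  classical
  have h := Finset.sum_powerset_apply_card (cf φ a n) (x := (Finset.univ : Finset (Fin N)))
  simp only [Finset.card_univ, Fintype.card_fin, nsmul_eq_mul] at h
  rw [← h, ← Finset.sum_fiberwise_of_maps_to (s := Finset.univ)
    (t := (Finset.univ : Finset (Fin N)).powerset) (g := fun t : Fin n → Fin N => Finset.univ.image t)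
    (fun t _ => by simp)]
  refine Finset.sum_congr rfl fun T _ => ?_
  unfold cf
  symm
  refine Finset.sum_bij (fun s _ => fun p => T.orderEmbOfFin rfl (s p)) ?_ ?_ ?_ ?_
  · intro s hs
    simp only [Finset.mem_filter, Finset.mem_univ, true_and] at hs ⊢
    ext x
    simp only [Finset.mem_image, Finset.mem_univ, true_and]
    constructor
    · rintro ⟨p, rfl⟩; exact T.orderEmbOfFin_mem rfl _
    · intro hx
      have : x ∈ Set.range (T.orderEmbOfFin rfl) := by
        rw [Finset.range_orderEmbOfFin]; exact hx
      obtain ⟨y, rfl⟩ := this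
      obtain ⟨p, rfl⟩ := hs y
      exact ⟨p, rfl⟩
  · intro s _ s' _ e
    ext p
    have := congrFun e p
    simpa [Fin.ext_iff] using (T.orderEmbOfFin rfl).injective this
  · intro t ht
    simp only [Finset.mem_filter, Finset.mem_univ, true_and] at ht
    have : ∀ p, ∃ y, T.orderEmbOfFin rfl y = t p := by
      intro p
      have : t p ∈ Set.range (T.orderEmbOfFin rfl) := by
        rw [Finset.range_orderEmbOfFin, ← ht]; simp
      exact this
    choose s hs using this
    refine ⟨s, ?_, funext hs⟩
    simp only [Finset.mem_filter, Finset.mem_univ, true_and]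
    intro y
    have : T.orderEmbOfFin rfl y ∈ Finset.univ.image t := by
      rw [ht]; exact T.orderEmbOfFin_mem rfl _
    simp only [Finset.mem_image, Finset.mem_univ, true_and] at this
    obtain ⟨p, hp⟩ := this
    rw [← hs p] at hp
    exact ⟨p, (T.orderEmbOfFin rfl).injective hp⟩
  · intro s _
    rw [hc.fm_emb]

omit hc in
theorem count_ofFn {n m : ℕ} (t : Fin n → Fin m) (i : Fin m) (f : Fin m → ℕ)
    (hf : Function.Injective f) :
    (List.ofFn fun p => f (t p)).count (f i) = (Finset.univ.filter fun p => t p = i).card := by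
  rw [List.ofFn_eq_map, show (fun p => f (t p)) = f ∘ t from rfl, ← List.map_map,
    List.count_map_of_injective _ f hf, List.count, List.countP_map, List.countP_eq_length_filter,
    ← List.toFinset_card_of_nodup ((List.nodup_finRange n).filter _)]
  congr 1
  ext p
  simp

theorem fm_single {n m : ℕ} (t : Fin n → Fin m) (i : Fin m)
    (h : (Finset.univ.filter fun p => t p = i).card = 1) : fm φ a (fun p => (t p).1) = 0 := by
  rw [hc.fm_eq]
  apply hc.singleton i.1
  · rw [List.map_map, show (Prod.fst ∘ fun i : ℕ => (i, (X : ℂ[X]))) = id from rfl, List.map_id,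
      count_ofFn t i (fun i => i.1) Fin.val_injective, h]
  · intro x hx _
    obtain ⟨y, hy, rfl⟩ := List.mem_map.1 hx
    exact hc.mom_X

omit hc in
theorem fib_cases {n m : ℕ} (t : Fin n → Fin m) (ht : Function.Surjective t)
    (h : ∀ i, (Finset.univ.filter fun p => t p = i).card ≠ 1) :
    2 * m ≤ n ∧ (n = 2 * m → ∀ i, (Finset.univ.filter fun p => t p = i).card = 2) := by
  have h2 : ∀ i, 2 ≤ (Finset.univ.filter fun p => t p = i).card := by
    intro i
    obtain ⟨p, hp⟩ := ht i
    have : 0 < (Finset.univ.filter fun p => t p = i).card := Finset.card_pos.2 ⟨p, by simp [hp]⟩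
    have := h i
    omega
  have hs : ∑ i : Fin m, (Finset.univ.filter fun p => t p = i).card = n := by
    have := Finset.card_eq_sum_card_fiberwise (s := (Finset.univ : Finset (Fin n)))
      (t := (Finset.univ : Finset (Fin m))) (f := t) (fun _ _ => by simp)
    simp at this
    exact this.symm
  have hs2 : ∑ i : Fin m, 2 = 2 * m := by simp [mul_comm]
  refine ⟨?_, fun hn i => ?_⟩
  · rw [← hs, ← hs2]; exact Finset.sum_le_sum fun i _ => h2 i
  · have := (Finset.sum_eq_sum_iff_of_le (s := Finset.univ) (f := fun _ : Fin m => 2)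
      (g := fun i => (Finset.univ.filter fun p => t p = i).card) fun i _ => h2 i).1
      (by rw [hs2, hs, hn])
    exact (this i (Finset.mem_univ i)).symm

theorem cf_zero {n m : ℕ} (h : n < 2 * m) : cf φ a n m = 0 := by
  apply Finset.sum_eq_zero
  intro t ht
  simp only [Finset.mem_filter, Finset.mem_univ, true_and] at ht
  by_cases hx : ∃ i, (Finset.univ.filter fun p => t p = i).card = 1
  · obtain ⟨i, hi⟩ := hx
    exact hc.fm_single t i hi
  · push Not at hx
    have := (fib_cases t ht hx).1
    omega

open Classical in
theorem fm_pair {k : ℕ} (t : Fin (2 * k) → Fin k)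
    (h : ∀ i, (Finset.univ.filter fun p => t p = i).card = 2) :
    fm φ a (fun p => (t p).1) = if Good k t then 1 else 0 := by
  rw [← hc.fm_inv _ (fun x => x + 1) (fun x y h => by simpa using h), hc.fm_eq]
  have := hc.phi_G (List.ofFn fun p => (t p).1 + 1) [] (by simp) ?_
  · simp only [List.reverse_nil, List.nil_append] at this
    rw [this]
    have : Good k t ↔ G [] (List.ofFn fun p => (t p).1 + 1) := ⟨fun h => h.2, fun h' => ⟨h, h'⟩⟩
    simp only [this]
  · intro i hi
    simp only [List.nil_append, List.mem_ofFn] at hi ⊢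
    obtain ⟨p, rfl⟩ := hi
    rw [count_ofFn t (t p) (fun i => i.1 + 1) (fun x y h => Fin.ext (by simpa using h))]
    exact h _

theorem cf_mid (k : ℕ) : cf φ a (2 * k) k = cardOV2 k := by
  classical
  rw [← card_good, Nat.card_eq_fintype_card, Fintype.card_subtype, Finset.card_filter]
  push_cast
  unfold cf
  rw [Finset.sum_filter]
  refine Finset.sum_congr rfl fun t _ => ?_
  by_cases hall : ∀ i, (Finset.univ.filter fun p => t p = i).card = 2
  · have hs : Function.Surjective t := by
      intro i
      obtain ⟨p, hp⟩ := Finset.card_pos.1 (by rw [hall i]; norm_num : 0 < _)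
      exact ⟨p, by simpa using hp⟩
    rw [if_pos hs, hc.fm_pair t hall]
  · have hg : ¬ Good k t := fun h => hall h.1
    rw [if_neg hg]
    split_ifs with hs
    · by_cases hx : ∃ i, (Finset.univ.filter fun p => t p = i).card = 1
      · obtain ⟨i, hi⟩ := hx
        exact hc.fm_single t i hi
      · push Not at hx
        exact absurd ((fib_cases t hs hx).2 rfl) hall
    · rfl

theorem moment_eq (n N : ℕ) : φ ((∑ i ∈ Finset.range N, a i) ^ n) =
    ∑ m ∈ Finset.range (n + 1), (N.choose m : ℂ) * cf φ a n m := by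
  rw [sum_pow_eq, hc.fm_sum]
  have h1 : ∀ M, N ≤ M → ∑ m ∈ Finset.range (N + 1), (N.choose m : ℂ) * cf φ a n m =
      ∑ m ∈ Finset.range (M + 1), (N.choose m : ℂ) * cf φ a n m := by
    intro M hM
    refine Finset.sum_subset (by intro x; simp; omega) ?_
    intro x _ hx
    simp at hx
    rw [Nat.choose_eq_zero_of_lt (by omega)]; simp
  have h2 : ∀ M, n ≤ M → ∑ m ∈ Finset.range (n + 1), (N.choose m : ℂ) * cf φ a n m =
      ∑ m ∈ Finset.range (M + 1), (N.choose m : ℂ) * cf φ a n m := by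
    intro M hM
    refine Finset.sum_subset (by intro x; simp; omega) ?_
    intro x _ hx
    simp at hx
    rw [hc.cf_zero (by omega)]; simp
  rw [h1 (max n N) (le_max_right _ _), h2 (max n N) (le_max_left _ _)]

end Ctx

open Filter Topology

theorem tendsto_mid (k : ℕ) : Tendsto (fun N : ℕ => (1 / (Real.sqrt N : ℂ)) ^ (2 * k) *
    (N.choose k : ℂ)) atTop (𝓝 (1 / (Nat.factorial k : ℂ))) := by
  have h : Tendsto (fun N : ℕ => (N.choose k : ℝ) / (N ^ k / (Nat.factorial k : ℝ))) atTop (𝓝 1) := by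
    refine (Asymptotics.isEquivalent_iff_tendsto_one ?_).1 (isEquivalent_choose k)
    filter_upwards [eventually_gt_atTop 0] with N hN
    positivity
  have h2 := (h.mul_const (1 / (Nat.factorial k : ℝ)))
  have h3 := (Complex.continuous_ofReal.tendsto _).comp h2
  have e : ((1 * (1 / (Nat.factorial k : ℝ)) : ℝ) : ℂ) = 1 / (Nat.factorial k : ℂ) := by
    push_cast; ring
  rw [e] at h3
  refine h3.congr' ?_
  filter_upwards [eventually_gt_atTop 0] with N hN
  have hs : ((Real.sqrt N : ℂ)) ^ (2 * k) = (N : ℂ) ^ k := by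
    rw [pow_mul, ← Complex.ofReal_pow, Real.sq_sqrt (Nat.cast_nonneg N)]
    simp
  have hN0 : (N : ℂ) ≠ 0 := by exact_mod_cast hN.ne'
  have hf : (Nat.factorial k : ℂ) ≠ 0 := by exact_mod_cast (Nat.factorial_pos k).ne'
  simp only [Function.comp]
  rw [show (1 / (Real.sqrt N : ℂ)) ^ (2 * k) = ((N : ℂ) ^ k)⁻¹ from by rw [one_div, inv_pow, hs]]
  push_cast
  field_simp

theorem tendsto_low {n m : ℕ} (h : 2 * m < n) : Tendsto (fun N : ℕ => (1 / (Real.sqrt N : ℂ)) ^ n *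
    (N.choose m : ℂ)) atTop (𝓝 0) := by
  have h1 := tendsto_mid m
  have h2 : Tendsto (fun N : ℕ => (1 / (Real.sqrt N : ℂ)) ^ (n - 2 * m)) atTop (𝓝 0) := by
    have h3 : Tendsto (fun N : ℕ => (Real.sqrt N)⁻¹) atTop (𝓝 0) :=
      tendsto_inv_atTop_zero.comp (Real.tendsto_sqrt_atTop.comp tendsto_natCast_atTop_atTop)
    have h4 := ((Complex.continuous_ofReal.tendsto _).comp h3).pow (n - 2 * m)
    simp only [Complex.ofReal_zero] at h4
    rw [zero_pow (by omega)] at h4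
    refine h4.congr fun N => ?_
    simp
  have h3 := h2.mul h1
  rw [zero_mul] at h3
  refine h3.congr fun N => ?_
  rw [← mul_assoc, ← pow_add]
  congr 3
  omega

theorem Ctx.tendsto_moment (hc : Ctx φ a unit) (n : ℕ) :
    Tendsto (fun N : ℕ => (1 / (Real.sqrt N : ℂ)) ^ n * φ ((∑ i ∈ Finset.range N, a i) ^ n)) atTop
      (𝓝 (∑ m ∈ Finset.range (n + 1),
        if n = 2 * m then (1 / (Nat.factorial m : ℂ)) * cf φ a n m else 0)) := by
  simp only [hc.moment_eq, Finset.mul_sum, ← mul_assoc]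
  refine tendsto_finsetSum _ fun m _ => ?_
  rcases lt_trichotomy n (2 * m) with h | h | h
  · simp [hc.cf_zero h, h.ne]
  · rw [if_pos h]
    subst h
    exact (tendsto_mid m).mul_const _
  · rw [if_neg h.ne']
    simpa using (tendsto_low h).mul_const (cf φ a n m)

end VM
open scoped ComplexOrder in
/-- Theorem 1 (V-monotone central limit theorem): if `(aᵢ)` is a V-monotonically
independent, identically distributed family in a C*-probability space `(A, φ)` with mean `0`
and variance `1`, and `S_N = N^{-1/2}(a₁ + … + a_N)`, then the moments of `S_N` converge:
odd moments to `0`, and the `2k`-th moment to `|OV²(2k)|/k!`. -/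
theorem vMonotone_central_limit_theorem
    {A : Type*} [NormedRing A] [StarRing A] [CStarRing A] [NormedAlgebra ℂ A]
    [CompleteSpace A]
    (φ : A →ₗ[ℂ] ℂ) (hφ1 : φ 1 = 1) (hφpos : ∀ x : A, 0 ≤ φ (star x * x))
    (a : ℕ → A) (unit : ℕ → A)
    (hu1 : ∀ i, unit i * a i = a i) (hu2 : ∀ i, a i * unit i = a i)
    (hu3 : ∀ i, unit i * unit i = unit i)
    (hind : VMonotoneIndep (fun i : ℕ => NonUnitalAlgebra.adjoin ℂ {a i, unit i}) unit φ)
    (hid : ∀ i : ℕ, ∀ m : ℕ, 1 ≤ m → φ (a i ^ m) = φ (a 0 ^ m))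
    (hmean : ∀ i, φ (a i) = 0) (hvar : ∀ i, φ (a i ^ 2) = 1)
    (S : ℕ → A)
    (hS : ∀ N : ℕ, S N = (1 / (Real.sqrt N : ℂ)) • ∑ i ∈ Finset.range N, a i) :
    ∀ n : ℕ,
      (∀ k : ℕ, n = 2 * k →
        Filter.Tendsto (fun N : ℕ => φ (S N ^ n)) Filter.atTop
          (nhds ((cardOV2 k : ℂ) / (Nat.factorial k : ℂ)))) ∧
      (Odd n →
        Filter.Tendsto (fun N : ℕ => φ (S N ^ n)) Filter.atTop (nhds 0)) := by
  have hc : VM.Ctx φ a unit := ⟨hφ1, hu1, hu2, hu3, hind, hid, hmean, hvar⟩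
  intro n
  have hfun : (fun N : ℕ => φ (S N ^ n)) =
      fun N : ℕ => (1 / (Real.sqrt N : ℂ)) ^ n * φ ((∑ i ∈ Finset.range N, a i) ^ n) := by
    funext N
    rw [hS, smul_pow, map_smul, smul_eq_mul]
  have ht := hc.tendsto_moment n
  rw [hfun]
  refine ⟨fun k hk => ?_, fun hodd => ?_⟩
  · subst hk
    rw [Finset.sum_eq_single k] at ht
    · rw [if_pos rfl, hc.cf_mid] at ht
      convert ht using 2
      ring
    · intro m _ hm
      rw [if_neg (by omega)]
    · intro h
      exact absurd (Finset.mem_range.2 (by omega)) h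
  · rw [Finset.sum_eq_zero] at ht
    · exact ht
    · intro m _
      rw [if_neg]
      intro h
      obtain ⟨j, hj⟩ := hodd
      omega
end

section
/- For every n ≥ 0 and every k ∈ {1, …, n+2}: N_{n+1,k} = Σ_{m=0}^{n} Σ_{l=L₁(k,m)}^{L₂(k,m)} C(k−1, l) · C(n+2−k, m+1−l) · [δ_{l,0}·N_{m,1} + Σ_{r=1}^{l} N_{m,r}] · N_{n−m, k−l}, where L₁(k,m) = max(0, m+k−n−1), L₂(k,m) = min(k−1, m+1), C(·,·) denotes binomial coefficients and δ_{l,0} is the Kronecker delta. -/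
/-- The extra condition defining `N_{n,k}` inside `OV²(2n)`: for every chain of blocks
`B₁, …, B_r` with `B₁` an outer block (no block is outer with respect to it) and `B_j` the
nearest outer block of `B_{j+1}`, the rational sequence `(k − 1/2, ℓ(B₁), …, ℓ(B_r))` is
V-shaped. Equivalently, the labeled partition remains V-monotonically labeled after
adjoining an outer block `{0, 2n+1}` labeled `k − 1/2`. -/
def NextraCond (nn k : ℕ) (P : Finset (Finset (Fin (2 * nn))))
    (ℓ : Finset (Fin (2 * nn)) → ℕ) : Prop :=
  ∀ (B₁ : Finset (Fin (2 * nn))) (rest : List (Finset (Fin (2 * nn)))),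
    (∀ B ∈ B₁ :: rest, B ∈ P) →
    (¬ ∃ B' ∈ P, BlockInner B' B₁) →
    (B₁ :: rest).Chain' (NearestOuter P) →
    IsVList (((k : ℚ) - 1 / 2) :: (B₁ :: rest).map (fun B => (ℓ B : ℚ)))

/-- `N_{n,k}`: the number of elements of `OV²(2n)` which remain V-monotonically labeled
after adjoining an outer block `{0, 2n+1}` labeled `k − 1/2` (with `N_{0,k} = 1`). -/
noncomputable def Ncount (nn k : ℕ) : ℕ :=
  Nat.card {x : Finset (Finset (Fin (2 * nn))) × (Finset (Fin (2 * nn)) → ℕ) //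
    OV2cond nn x.1 x.2 ∧ NextraCond nn k x.1 x.2}


/-- labelled plane forests -/
inductive VT where
  | leaf : VT
  | node : ℕ → VT → VT → VT

namespace VT

def size : VT → ℕ
  | leaf => 0
  | node _ i o => size i + size o + 1

def lab : VT → Finset ℕ
  | leaf => ∅
  | node x i o => insert x (lab i ∪ lab o)

def OK : VT → ℕ → Prop
  | leaf, _ => True
  | node x i o, a => x ∉ lab i ∧ x ∉ lab o ∧ (∀ y ∈ lab i, y ∉ lab o) ∧ OK i x ∧ OK o a ∧
      (x < a ∨ ∀ y ∈ lab i, x < y)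

def mem : VT → ℕ → ℕ → ℕ → ℕ → Prop
  | leaf, _, _, _, _ => False
  | node y i o, s, a, b, x => (a = s ∧ b = s + 2 * size i + 1 ∧ x = y) ∨ mem i (s + 1) a b x ∨
      mem o (s + 2 * size i + 2) a b x

structure Struct (D : ℕ → ℕ → ℕ → Prop) (s e : ℕ) : Prop where
  rng : ∀ a b x, D a b x → s ≤ a ∧ a < b ∧ b < e
  cov : ∀ p, s ≤ p → p < e → ∃ a b x, D a b x ∧ (p = a ∨ p = b)
  dis : ∀ a b x a' b' x', D a b x → D a' b' x' → (a = a' ∨ a = b' ∨ b = a' ∨ b = b') →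
    a = a' ∧ b = b' ∧ x = x'
  nc : ∀ a b x a' b' x', D a b x → D a' b' x' → ¬ (a < a' ∧ a' < b ∧ b < b')

structure Lab (D : ℕ → ℕ → ℕ → Prop) (k : ℕ) : Prop where
  inj : ∀ a b x a' b', D a b x → D a' b' x → a = a' ∧ b = b'
  pk2 : ∀ a b x a' b' x', D a b x → D a' b' x' → a < a' → b' < b → ¬ (k ≤ x ∧ x' < x)
  pk3 : ∀ a b x a' b' x' a'' b'' x'', D a b x → D a' b' x' → D a'' b'' x'' →
    a < a' → b' < b → a' < a'' → b'' < b' → ¬ (x < x' ∧ x'' < x')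

theorem mem_rng (t : VT) : ∀ (s a b x : ℕ), mem t s a b x → s ≤ a ∧ a < b ∧ b < s + 2 * size t := by
  induction t with
  | leaf => intro s a b x h; exact h.elim
  | node y i o hi ho =>
    intro s a b x h
    simp only [mem, size] at *
    rcases h with h | h | h
    · omega
    · have := hi _ _ _ _ h; omega
    · have := ho _ _ _ _ h; omega

theorem mem_lab (t : VT) : ∀ (s x : ℕ), (∃ a b, mem t s a b x) ↔ x ∈ lab t := by
  induction t with
  | leaf => intro s x; simp [mem, lab]
  | node y i o hi ho =>
    intro s x
    simp only [mem, lab, Finset.mem_insert, Finset.mem_union, ← hi (s+1), ← ho (s + 2 * size i + 2)]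
    constructor
    · rintro ⟨a, b, h | h | h⟩
      · exact Or.inl h.2.2
      · exact Or.inr (Or.inl ⟨a, b, h⟩)
      · exact Or.inr (Or.inr ⟨a, b, h⟩)
    · rintro (h | ⟨a, b, h⟩ | ⟨a, b, h⟩)
      · exact ⟨_, _, Or.inl ⟨rfl, rfl, h⟩⟩
      · exact ⟨a, b, Or.inr (Or.inl h)⟩
      · exact ⟨a, b, Or.inr (Or.inr h)⟩

theorem mem_struct (t : VT) : ∀ s, Struct (mem t s) s (s + 2 * size t) := by
  induction t with
  | leaf =>
    intro s
    refine ⟨fun a b x h => h.elim, fun p h1 h2 => ?_, fun a b x _ _ _ h => h.elim, fun a b x _ _ _ h => h.elim⟩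
    simp only [size] at h2; omega
  | node y i o hi ho =>
    intro s
    have hi := hi (s+1)
    have ho := ho (s + 2 * size i + 2)
    refine ⟨fun a b x h => mem_rng _ _ _ _ _ h, ?_, ?_, ?_⟩
    · intro p h1 h2
      simp only [size] at h2
      simp only [mem]
      by_cases c1 : p = s ∨ p = s + 2 * size i + 1
      · exact ⟨_, _, _, Or.inl ⟨rfl, rfl, rfl⟩, c1⟩
      by_cases c2 : p < s + 2 * size i + 1
      · obtain ⟨a, b, x, h, h'⟩ := hi.cov p (by omega) (by omega)
        exact ⟨a, b, x, Or.inr (Or.inl h), h'⟩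
      · obtain ⟨a, b, x, h, h'⟩ := ho.cov p (by omega) (by omega)
        exact ⟨a, b, x, Or.inr (Or.inr h), h'⟩
    · intro a b x a' b' x' h h' hh
      simp only [mem] at h h'
      rcases h with h | h | h <;> rcases h' with h' | h' | h'
      · omega
      · have := hi.rng _ _ _ h'; omega
      · have := ho.rng _ _ _ h'; omega
      · have := hi.rng _ _ _ h; omega
      · exact hi.dis _ _ _ _ _ _ h h' hh
      · have := hi.rng _ _ _ h; have := ho.rng _ _ _ h'; omega
      · have := ho.rng _ _ _ h; omega
      · have := ho.rng _ _ _ h; have := hi.rng _ _ _ h'; omega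
      · exact ho.dis _ _ _ _ _ _ h h' hh
    · intro a b x a' b' x' h h'
      simp only [mem] at h h'
      rcases h with h | h | h <;> rcases h' with h' | h' | h'
      · omega
      · have := hi.rng _ _ _ h'; omega
      · have := ho.rng _ _ _ h'; omega
      · have := hi.rng _ _ _ h; omega
      · exact hi.nc _ _ _ _ _ _ h h'
      · have := hi.rng _ _ _ h; have := ho.rng _ _ _ h'; omega
      · have := ho.rng _ _ _ h; omega
      · have := ho.rng _ _ _ h; have := hi.rng _ _ _ h'; omega
      · exact ho.nc _ _ _ _ _ _ h h'

theorem mem_inj (t : VT) : ∀ (s : ℕ) (t' : VT), (∀ a b x, mem t s a b x ↔ mem t' s a b x) → t = t' := by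
  induction t with
  | leaf =>
    intro s t' h
    cases t' with
    | leaf => rfl
    | node y i o => exact ((h _ _ _).2 (Or.inl ⟨rfl, rfl, rfl⟩)).elim
  | node y i o hi ho =>
    intro s t' h
    cases t' with
    | leaf => exact ((h _ _ _).1 (Or.inl ⟨rfl, rfl, rfl⟩)).elim
    | node y' i' o' =>
      have key := (h _ _ _).1 (Or.inl ⟨rfl, rfl, rfl⟩)
      have e : size i = size i' ∧ y = y' := by
        rcases key with h | h | h
        · omega
        · have := mem_rng _ _ _ _ _ h; omega
        · have := mem_rng _ _ _ _ _ h; omega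
      obtain ⟨e1, rfl⟩ := e
      have h1 : i = i' := by
        refine hi (s+1) i' fun a b x => ⟨fun g => ?_, fun g => ?_⟩
        · have r := mem_rng _ _ _ _ _ g
          rcases (h _ _ _).1 (Or.inr (Or.inl g)) with h | h | h
          · omega
          · exact h
          · have := mem_rng _ _ _ _ _ h; omega
        · have r := mem_rng _ _ _ _ _ g
          rcases (h _ _ _).2 (Or.inr (Or.inl g)) with h | h | h
          · omega
          · exact h
          · have := mem_rng _ _ _ _ _ h; omega
      have h2 : o = o' := by
        refine ho (s + 2 * size i + 2) o' fun a b x => ⟨fun g => ?_, fun g => ?_⟩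
        · have r := mem_rng _ _ _ _ _ g
          rcases (h _ _ _).1 (Or.inr (Or.inr g)) with h | h | h
          · omega
          · have := mem_rng _ _ _ _ _ h; omega
          · rw [e1]; exact h
        · have r := mem_rng _ _ _ _ _ g
          rw [e1] at g
          rcases (h _ _ _).2 (Or.inr (Or.inr g)) with h | h | h
          · omega
          · have := mem_rng _ _ _ _ _ h; omega
          · exact h
      rw [h1, h2]

theorem struct_exists (L : ℕ) : ∀ (s e : ℕ) (D : ℕ → ℕ → ℕ → Prop), s ≤ e → e - s ≤ L → Struct D s e →
    ∃ t, (∀ a b x, mem t s a b x ↔ D a b x) ∧ e = s + 2 * size t := by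
  induction L with
  | zero =>
    intro s e D h1 h2 h
    refine ⟨leaf, fun a b x => ⟨fun h => h.elim, fun g => ?_⟩, by simp only [size]; omega⟩
    have := h.rng _ _ _ g; omega
  | succ L ih =>
    intro s e D h1 h2 h
    by_cases hs : s = e
    · refine ⟨leaf, fun a b x => ⟨fun h => h.elim, fun g => ?_⟩, by simp only [size]; omega⟩
      have := h.rng _ _ _ g; omega
    obtain ⟨a0, b0, x0, g0, g1⟩ := h.cov s le_rfl (by omega)
    have r0 := h.rng _ _ _ g0
    have : a0 = s := by omega
    subst this
    have hcls : ∀ a b x, D a b x → (a = a0 ∧ b = b0 ∧ x = x0) ∨ (a0 + 1 ≤ a ∧ b < b0) ∨ (b0 + 1 ≤ a) := by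
      intro a b x g
      have r := h.rng _ _ _ g
      have h3 := h.dis _ _ _ _ _ _ g g0
      have h4 := h.nc _ _ _ _ _ _ g0 g
      omega
    obtain ⟨i, hi, ei⟩ := ih (a0+1) b0 (fun a b x => D a b x ∧ a0 + 1 ≤ a ∧ b < b0) (by omega) (by omega)
      ⟨fun a b x g => by have := h.rng _ _ _ g.1; omega, fun p p1 p2 => by
        obtain ⟨a, b, x, g, g'⟩ := h.cov p (by omega) (by omega)
        have := h.rng _ _ _ g
        refine ⟨a, b, x, ⟨g, ?_⟩, g'⟩
        have := hcls _ _ _ g; omega,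
       fun a b x a' b' x' g g' => h.dis _ _ _ _ _ _ g.1 g'.1,
       fun a b x a' b' x' g g' => h.nc _ _ _ _ _ _ g.1 g'.1⟩
    obtain ⟨o, ho, eo⟩ := ih (b0+1) e (fun a b x => D a b x ∧ b0 + 1 ≤ a) (by omega) (by omega)
      ⟨fun a b x g => by have := h.rng _ _ _ g.1; omega, fun p p1 p2 => by
        obtain ⟨a, b, x, g, g'⟩ := h.cov p (by omega) (by omega)
        have := h.rng _ _ _ g
        refine ⟨a, b, x, ⟨g, ?_⟩, g'⟩
        have := hcls _ _ _ g; omega,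
       fun a b x a' b' x' g g' => h.dis _ _ _ _ _ _ g.1 g'.1,
       fun a b x a' b' x' g g' => h.nc _ _ _ _ _ _ g.1 g'.1⟩
    refine ⟨node x0 i o, fun a b x => ?_, by simp only [size]; omega⟩
    have e2 : a0 + 2 * size i + 2 = b0 + 1 := by omega
    simp only [mem, hi, e2, ho]
    constructor
    · rintro (⟨rfl, hb, rfl⟩ | g | g)
      · have : b = b0 := by omega
        rw [this]; exact g0
      · exact g.1
      · exact g.1
    · intro g
      rcases hcls _ _ _ g with c | c | c
      · left; omega
      · exact Or.inr (Or.inl ⟨g, c⟩)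
      · exact Or.inr (Or.inr ⟨g, c⟩)

theorem ok_iff (t : VT) : ∀ (s k : ℕ), OK t k ↔ Lab (mem t s) k := by
  induction t with
  | leaf =>
    intro s k
    exact ⟨fun _ => ⟨fun a b x _ _ h => h.elim, fun a b x _ _ _ h => h.elim,
      fun a b x _ _ _ _ _ _ h => h.elim⟩, fun _ => trivial⟩
  | node y i o hi ho =>
    intro s k
    have ri := mem_rng i (s+1)
    have ro := mem_rng o (s + 2 * size i + 2)
    have li := mem_lab i (s+1)
    have lo := mem_lab o (s + 2 * size i + 2)
    simp only [OK, hi (s+1), ho (s + 2 * size i + 2), ← li, ← lo]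
    constructor
    · rintro ⟨h1, h2, h3, h4, h5, h6⟩
      refine ⟨?_, ?_, ?_⟩
      · intro a b x a' b' g g'
        rcases g with g | g | g <;> rcases g' with g' | g' | g'
        · omega
        · exact (h1 ⟨a', b', by rw [← g.2.2]; exact g'⟩).elim
        · exact (h2 ⟨a', b', by rw [← g.2.2]; exact g'⟩).elim
        · exact (h1 ⟨a, b, by rw [← g'.2.2]; exact g⟩).elim
        · exact h4.inj _ _ _ _ _ g g'
        · exact (h3 _ ⟨_, _, g⟩ ⟨_, _, g'⟩).elim
        · exact (h2 ⟨a, b, by rw [← g'.2.2]; exact g⟩).elim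
        · exact (h3 _ ⟨_, _, g'⟩ ⟨_, _, g⟩).elim
        · exact h5.inj _ _ _ _ _ g g'
      · intro a b x a' b' x' g g' q1 q2 
        rcases g with g | g | g <;> rcases g' with g' | g' | g'
        · omega
        · have := h6.imp_right (fun h => h _ ⟨_, _, g'⟩); omega
        · have := ro _ _ _ g'; omega
        · have := ri _ _ _ g; omega
        · have := h4.pk2 _ _ _ _ _ _ g g' q1 q2
          have := h6.imp_right (fun h => h _ ⟨_, _, g⟩); omega
        · have := ri _ _ _ g; have := ro _ _ _ g'; omega
        · have := ro _ _ _ g; omega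
        · have := ri _ _ _ g'; have := ro _ _ _ g; omega
        · exact h5.pk2 _ _ _ _ _ _ g g' q1 q2
      · intro a b x a' b' x' a'' b'' x'' g g' g'' q1 q2 q3 q4
        have hnest : ∀ a b x a' b' x', mem (node y i o) s a b x → mem (node y i o) s a' b' x' → a < a' → b' < b → 
            (mem i (s+1) a' b' x' ∧ ((a = s ∧ x = y) ∨ mem i (s+1) a b x)) ∨ 
            (mem o (s + 2 * size i + 2) a b x ∧ mem o (s + 2 * size i + 2) a' b' x') := by
          intro a b x a' b' x' g g' q1 q2
          rcases g with g | g | g <;> rcases g' with g' | g' | g'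
          · omega
          · exact Or.inl ⟨g', Or.inl ⟨g.1, g.2.2⟩⟩
          · have := ro _ _ _ g'; omega
          · have := ri _ _ _ g; omega
          · exact Or.inl ⟨g', Or.inr g⟩
          · have := ri _ _ _ g; have := ro _ _ _ g'; omega
          · have := ro _ _ _ g; omega
          · have := ri _ _ _ g'; have := ro _ _ _ g; omega
          · exact Or.inr ⟨g, g'⟩
        rcases hnest _ _ _ _ _ _ g g' q1 q2 with ⟨m1, m2⟩ | ⟨m1, m2⟩ <;>
        rcases hnest _ _ _ _ _ _ g' g'' q3 q4 with ⟨m3, m4⟩ | ⟨m3, m4⟩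
        · rcases m2 with ⟨m2, rfl⟩ | m2
          · have := h4.pk2 _ _ _ _ _ _ m1 m3 q3 q4
            omega
          · exact h4.pk3 _ _ _ _ _ _ _ _ _ m2 m1 m3 q1 q2 q3 q4
        · have := ri _ _ _ m1; have := ro _ _ _ m3; omega
        · have := ri _ _ _ m3; have := ro _ _ _ m2; omega
        · exact h5.pk3 _ _ _ _ _ _ _ _ _ m1 m2 m4 q1 q2 q3 q4
    · intro h
      have root : mem (node y i o) s s (s + 2 * size i + 1) y := Or.inl ⟨rfl, rfl, rfl⟩
      have hii : ∀ a b x, mem i (s+1) a b x → mem (node y i o) s a b x := fun a b x g => Or.inr (Or.inl g)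
      have hoo : ∀ a b x, mem o (s + 2 * size i + 2) a b x → mem (node y i o) s a b x :=
        fun a b x g => Or.inr (Or.inr g)
      have n1 : ¬∃ a b, mem i (s + 1) a b y := by
        rintro ⟨a, b, g⟩
        have := h.inj _ _ _ _ _ root (hii _ _ _ g)
        have := ri _ _ _ g; omega
      refine ⟨n1, ?_, ?_, ?_, ?_, ?_⟩
      · rintro ⟨a, b, g⟩
        have := h.inj _ _ _ _ _ root (hoo _ _ _ g)
        have := ro _ _ _ g; omega
      · rintro z ⟨a, b, g⟩ ⟨a', b', g'⟩
        have := h.inj _ _ _ _ _ (hii _ _ _ g) (hoo _ _ _ g')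
        have := ri _ _ _ g; have := ro _ _ _ g'; omega
      · refine ⟨fun a b x a' b' g g' => h.inj _ _ _ _ _ (hii _ _ _ g) (hii _ _ _ g'),
          fun a b x a' b' x' g g' q1 q2 => ?_, fun a b x a' b' x' a'' b'' x'' g g' g'' =>
          h.pk3 _ _ _ _ _ _ _ _ _ (hii _ _ _ g) (hii _ _ _ g') (hii _ _ _ g'')⟩
        have r := ri _ _ _ g
        have := h.pk3 _ _ _ _ _ _ _ _ _ root (hii _ _ _ g) (hii _ _ _ g') (by omega) (by omega) q1 q2
        have : x ≠ y := by rintro rfl; exact n1 ⟨_, _, g⟩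
        omega
      · exact ⟨fun a b x a' b' g g' => h.inj _ _ _ _ _ (hoo _ _ _ g) (hoo _ _ _ g'),
          fun a b x a' b' x' g g' => h.pk2 _ _ _ _ _ _ (hoo _ _ _ g) (hoo _ _ _ g'), 
          fun a b x a' b' x' a'' b'' x'' g g' g'' =>
          h.pk3 _ _ _ _ _ _ _ _ _ (hoo _ _ _ g) (hoo _ _ _ g') (hoo _ _ _ g'')⟩
      · by_cases c : y < k
        · exact Or.inl c
        · right
          rintro z ⟨a, b, g⟩
          have r := ri _ _ _ g
          have := h.pk2 _ _ _ _ _ _ root (hii _ _ _ g) (by omega) (by omega)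
          have : z ≠ y := by rintro rfl; exact n1 ⟨_, _, g⟩
          omega

theorem ok_size (t : VT) : ∀ k, OK t k → (lab t).card = size t := by
  induction t with
  | leaf => intro k h; rfl
  | node y i o hi ho =>
    rintro k ⟨h1, h2, h3, h4, h5, h6⟩
    simp only [lab, size]
    rw [Finset.card_insert_of_notMem (by simp [h1, h2]), Finset.card_union_of_disjoint, hi _ h4, ho _ h5]
    exact Finset.disjoint_left.2 h3

end VT

namespace VT

/-- number of labelled forests with label set `S` compatible with an outer label `a` -/
noncomputable def G (S : Finset ℕ) (a : ℕ) : ℕ := Nat.card {t : VT // lab t = S ∧ OK t a}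

def rootOK (A : Finset ℕ) (a : ℕ) : Finset ℕ := A.filter (fun x => x < a ∨ ∀ y ∈ A.erase x, x < y)

def idx (S : Finset ℕ) (a : ℕ) : Finset (Σ _ : Finset ℕ, ℕ) := S.powerset.sigma (fun A => rootOK A a)

def glue (S : Finset ℕ) (a : ℕ) (q : Σ p : idx S a, {i : VT // lab i = p.1.1.erase p.1.2 ∧ OK i p.1.2} ×
    {o : VT // lab o = S \ p.1.1 ∧ OK o a}) : {t : VT // lab t = S ∧ OK t a} :=
  ⟨node q.1.1.2 q.2.1.1 q.2.2.1, by
    obtain ⟨⟨⟨A, x⟩, hp⟩, ⟨i, hi1, hi2⟩, ⟨o, ho1, ho2⟩⟩ := q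
    simp only [idx, rootOK, Finset.mem_sigma, Finset.mem_powerset, Finset.mem_filter] at hp
    obtain ⟨hA, hx, hr⟩ := hp
    dsimp only at *
    refine ⟨?_, ?_, ?_, ?_, hi2, ho2, ?_⟩
    · simp only [lab, hi1, ho1]
      ext z
      have := @hA z
      simp only [Finset.mem_insert, Finset.mem_union, Finset.mem_erase, Finset.mem_sdiff]
      by_cases hz : z = x
      · subst hz; simp [hA hx]
      · simp only [hz]; tauto
    · simp [hi1]
    · simp [ho1, hx]
    · simp only [hi1, ho1, Finset.mem_erase, Finset.mem_sdiff]; tauto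
    · simpa only [hi1] using hr⟩

theorem glue_bij (S : Finset ℕ) (hS : S.Nonempty) (a : ℕ) : Function.Bijective (glue S a) := by
  constructor
  · rintro ⟨⟨⟨A, x⟩, hp⟩, ⟨i, hi1, hi2⟩, ⟨o, ho1, ho2⟩⟩ ⟨⟨⟨A', x'⟩, hp'⟩, ⟨i', hi1', hi2'⟩, ⟨o', ho1', ho2'⟩⟩ h
    simp only [glue, Subtype.mk.injEq, node.injEq] at h
    obtain ⟨rfl, rfl, rfl⟩ := h
    simp only [idx, rootOK, Finset.mem_sigma, Finset.mem_powerset, Finset.mem_filter] at hp hp'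
    dsimp only at *
    have : A = A' := by
      rw [← Finset.insert_erase hp.2.1, ← Finset.insert_erase hp'.2.1, ← hi1, ← hi1']
    subst this
    rfl
  · rintro ⟨t, h1, h2⟩
    cases t with
    | leaf => simp [lab] at h1; subst h1; simp at hS
    | node x i o =>
      obtain ⟨k1, k2, k3, k4, k5, k6⟩ := h2
      simp only [lab] at h1
      refine ⟨⟨⟨⟨insert x (lab i), x⟩, ?_⟩, ⟨i, ?_, k4⟩, ⟨o, ?_, k5⟩⟩, rfl⟩
      · simp only [idx, rootOK, Finset.mem_sigma, Finset.mem_powerset, Finset.mem_filter,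
          Finset.erase_insert k1]
        refine ⟨?_, Finset.mem_insert_self _ _, k6⟩
        rw [← h1]; intro z; simp only [Finset.mem_insert, Finset.mem_union]; tauto
      · simp only [Finset.erase_insert k1]
      · simp only
        rw [← h1]; ext z
        have := k3 z
        simp only [Finset.mem_insert, Finset.mem_union, Finset.mem_sdiff]
        by_cases hz : z = x
        · subst hz; simp [k2]
        · simp only [hz]; tauto

theorem lab_empty (t : VT) (h : lab t = ∅) : t = leaf := by
  cases t with
  | leaf => rfl
  | node x i o => exact (Finset.insert_ne_empty _ _ h).elim

theorem G_finite (n : ℕ) : ∀ (S : Finset ℕ) (a : ℕ), S.card ≤ n → Finite {t : VT // lab t = S ∧ OK t a} := by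
  induction n with
  | zero =>
    intro S a h
    have : S = ∅ := by simpa using h
    subst this
    have : Subsingleton {t : VT // lab t = ∅ ∧ OK t a} := by
      constructor
      rintro ⟨t, h1, _⟩ ⟨t', h2, _⟩
      rw [Subtype.mk.injEq, lab_empty t h1, lab_empty t' h2]
    infer_instance
  | succ n ih =>
    intro S a h
    by_cases hS : S.Nonempty
    · have : ∀ p : idx S a, Finite ({i : VT // lab i = p.1.1.erase p.1.2 ∧ OK i p.1.2} ×
          {o : VT // lab o = S \ p.1.1 ∧ OK o a}) := by
        rintro ⟨⟨A, x⟩, hp⟩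
        simp only [idx, rootOK, Finset.mem_sigma, Finset.mem_powerset, Finset.mem_filter] at hp
        have h1 : (A.erase x).card ≤ n := by
          rw [Finset.card_erase_of_mem hp.2.1]
          have := Finset.card_le_card hp.1; omega
        have h2 : (S \ A).card ≤ n := by
          rw [Finset.card_sdiff_of_subset hp.1]
          have : 0 < A.card := Finset.card_pos.2 ⟨x, hp.2.1⟩
          omega
        have := ih _ x h1
        have := ih _ a h2
        infer_instance
      exact Finite.of_surjective _ (glue_bij S hS a).2
    · exact ih S a (by simp [Finset.not_nonempty_iff_eq_empty.1 hS])

theorem G_empty (a : ℕ) : G ∅ a = 1 := by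
  unfold G
  rw [Nat.card_eq_one_iff_unique]
  refine ⟨⟨?_⟩, ⟨⟨leaf, rfl, trivial⟩⟩⟩
  rintro ⟨t, h1, _⟩ ⟨t', h2, _⟩
  rw [Subtype.mk.injEq, lab_empty t h1, lab_empty t' h2]

theorem G_rec (S : Finset ℕ) (hS : S.Nonempty) (a : ℕ) :
    G S a = ∑ A ∈ S.powerset, (∑ x ∈ rootOK A a, G (A.erase x) x) * G (S \ A) a := by
  have fin : ∀ (S : Finset ℕ) (a : ℕ), Finite {t : VT // lab t = S ∧ OK t a} :=
    fun S a => G_finite S.card S a le_rfl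
  have h := Nat.card_eq_of_bijective _ (glue_bij S hS a)
  unfold G
  rw [← h, Nat.card_sigma]
  simp only [Nat.card_prod, Finset.sum_mul]
  rw [Finset.sum_sigma' S.powerset (fun A => rootOK A a)
    (fun A x => Nat.card {i : VT // lab i = A.erase x ∧ OK i x} * Nat.card {o : VT // lab o = S \ A ∧ OK o a})] 
  exact Finset.sum_coe_sort (idx S a) (fun p => Nat.card {i : VT // lab i = p.1.erase p.2 ∧ OK i p.2} * Nat.card {o : VT // lab o = S \ p.1 ∧ OK o a})

theorem sum_rank (B : Finset ℕ) (f : ℕ → ℕ) :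
    ∑ x ∈ B, f (B.filter (· < x)).card = ∑ r ∈ Finset.range B.card, f r := by
  induction B using Finset.induction_on_max with
  | empty => simp
  | insert a s h ih =>
    have ha : a ∉ s := fun h' => lt_irrefl _ (h a h')
    rw [Finset.sum_insert ha, Finset.card_insert_of_notMem ha, Finset.sum_range_succ, ← ih, add_comm]
    congr 1
    · refine Finset.sum_congr rfl fun x hx => ?_
      rw [Finset.filter_insert, if_neg (by have := h x hx; omega)]
    · rw [Finset.filter_insert, if_neg (lt_irrefl _), Finset.filter_true_of_mem h]

/-- standardized count -/
noncomputable def M (n j : ℕ) : ℕ := G (Finset.Icc 1 n) (j + 1)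

theorem root_sum (A : Finset ℕ) (hA : A.Nonempty) (a m : ℕ) (hm : A.card = m + 1)
    (ih : ∀ x ∈ A, G (A.erase x) x = M m ((A.erase x).filter (· < x)).card) :
    ∑ x ∈ rootOK A a, G (A.erase x) x = (if (A.filter (· < a)).card = 0 then M m 0 else 0) +
      ∑ r ∈ Finset.range (A.filter (· < a)).card, M m r := by
  have e1 : ∑ x ∈ rootOK A a, G (A.erase x) x = ∑ x ∈ rootOK A a, M m (A.filter (· < x)).card := by
    refine Finset.sum_congr rfl fun x hx => ?_
    have hx' : x ∈ A := (Finset.mem_filter.1 hx).1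
    rw [ih x hx']
    congr 2
    ext z; simp only [Finset.mem_filter, Finset.mem_erase]
    constructor
    · tauto
    · intro h; exact ⟨⟨by omega, h.1⟩, h.2⟩
  rw [e1]
  by_cases hl : (A.filter (· < a)).card = 0
  · rw [if_pos hl, hl, Finset.range_zero, Finset.sum_empty, add_zero]
    have hl' : ∀ y ∈ A, ¬ y < a := by
      rw [Finset.card_eq_zero, Finset.filter_eq_empty_iff] at hl
      exact fun y hy => hl hy
    have : rootOK A a = {A.min' hA} := by
      ext x
      simp only [rootOK, Finset.mem_filter, Finset.mem_singleton]
      constructor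
      · rintro ⟨h1, h2 | h2⟩
        · exact (hl' x h1 h2).elim
        · by_contra hne
          have := h2 _ (Finset.mem_erase.2 ⟨Ne.symm hne, A.min'_mem hA⟩)
          have := A.min'_le x h1
          omega
      · rintro rfl
        refine ⟨A.min'_mem hA, Or.inr fun y hy => ?_⟩
        rw [Finset.mem_erase] at hy
        exact lt_of_le_of_ne (A.min'_le y hy.2) (Ne.symm hy.1)
    rw [this, Finset.sum_singleton]
    congr 1
    rw [Finset.card_eq_zero, Finset.filter_eq_empty_iff]
    intro y hy
    have := A.min'_le y hy
    omega
  · rw [if_neg hl, zero_add, ← sum_rank]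
    obtain ⟨w, hw⟩ := Finset.card_pos.1 (Nat.pos_of_ne_zero hl)
    rw [Finset.mem_filter] at hw
    have : rootOK A a = A.filter (· < a) := by
      refine Finset.filter_congr fun x hx => ⟨?_, Or.inl⟩
      rintro (h | h)
      · exact h
      · by_contra hc
        have := h w (Finset.mem_erase.2 ⟨by omega, hw.1⟩)
        omega
    rw [this]
    refine Finset.sum_congr rfl fun x hx => ?_
    rw [Finset.mem_filter] at hx
    congr 2
    ext z; simp only [Finset.mem_filter]
    constructor
    · rintro ⟨h1, h2⟩; exact ⟨⟨h1, by omega⟩, h2⟩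
    · tauto

theorem sum_powerset_split (S : Finset ℕ) (a : ℕ) (f : ℕ → ℕ → ℕ) :
    ∑ A ∈ S.powerset, f (A.filter (· < a)).card (A.filter (¬ · < a)).card =
      ∑ l ∈ Finset.range ((S.filter (· < a)).card + 1), ∑ q ∈ Finset.range ((S.filter (¬ · < a)).card + 1),
        (S.filter (· < a)).card.choose l * (S.filter (¬ · < a)).card.choose q * f l q := by
  have h1 : ∑ A ∈ S.powerset, f (A.filter (· < a)).card (A.filter (¬ · < a)).card =
      ∑ p ∈ (S.filter (· < a)).powerset ×ˢ (S.filter (¬ · < a)).powerset, f p.1.card p.2.card := by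
    refine Finset.sum_bij' (fun A _ => (A.filter (· < a), A.filter (¬ · < a))) (fun p _ => p.1 ∪ p.2) ?_ ?_ ?_ ?_ ?_
    · intro A hA
      rw [Finset.mem_powerset] at hA
      simp only [Finset.mem_product, Finset.mem_powerset]
      exact ⟨Finset.filter_subset_filter _ hA, Finset.filter_subset_filter _ hA⟩
    · rintro ⟨p, q⟩ h
      simp only [Finset.mem_product, Finset.mem_powerset] at h ⊢
      exact Finset.union_subset (h.1.trans (Finset.filter_subset _ _)) (h.2.trans (Finset.filter_subset _ _))
    · intro A hA
      exact Finset.filter_union_filter_not_eq _ _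
    · rintro ⟨p, q⟩ h
      simp only [Finset.mem_product, Finset.mem_powerset] at h
      have h1 : ∀ z ∈ p, z < a := fun z hz => (Finset.mem_filter.1 (h.1 hz)).2
      have h2 : ∀ z ∈ q, ¬ z < a := fun z hz => (Finset.mem_filter.1 (h.2 hz)).2
      ext z <;> simp only [Finset.mem_filter, Finset.mem_union] <;> have := h1 z <;> have := h2 z <;> tauto
    · intro A hA; rfl
  rw [h1, Finset.sum_product]
  have h2 : ∀ c : ℕ, ∑ y ∈ (S.filter (¬ · < a)).powerset, f c y.card =
      ∑ q ∈ Finset.range ((S.filter (¬ · < a)).card + 1), (S.filter (¬ · < a)).card.choose q • f c q :=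
    fun c => Finset.sum_powerset_apply_card (f c)
  simp only [h2]
  rw [Finset.sum_powerset_apply_card (fun c => ∑ q ∈ Finset.range ((S.filter (¬ · < a)).card + 1), (S.filter (¬ · < a)).card.choose q • f c q)]
  simp only [smul_eq_mul, Finset.mul_sum, mul_assoc]

/-- reindexing by `m + 1 = l + q` -/
theorem reindex (n p q : ℕ) (hpq : p + q = n + 1) (F : ℕ → ℕ → ℕ) (h0 : F 0 0 = 0) :
    ∑ l ∈ Finset.range (p + 1), ∑ r ∈ Finset.range (q + 1), F l r =
    ∑ m ∈ Finset.range (n + 1), ∑ l ∈ Finset.Icc (m + (p + 1) - (n + 1)) (min p (m + 1)), F l (m + 1 - l) := by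
  rw [Finset.sum_sigma', Finset.sum_sigma']
  rw [← Finset.sum_filter_ne_zero]
  symm
  rw [← Finset.sum_filter_ne_zero]
  refine Finset.sum_bij' (fun x _ => ⟨x.2, x.1 + 1 - x.2⟩) (fun x _ => ⟨x.1 + x.2 - 1, x.1⟩) ?_ ?_ ?_ ?_ ?_
  · rintro ⟨m, l⟩ h
    simp only [Finset.mem_filter, Finset.mem_sigma, Finset.mem_range, Finset.mem_Icc] at h ⊢
    refine ⟨by omega, h.2⟩
  · rintro ⟨l, r⟩ h
    simp only [Finset.mem_filter, Finset.mem_sigma, Finset.mem_range, Finset.mem_Icc] at h ⊢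
    have hne : ¬ (l = 0 ∧ r = 0) := by rintro ⟨rfl, rfl⟩; exact h.2 h0
    have : l + r - 1 + 1 - l = r := by omega
    rw [this]
    refine ⟨by omega, h.2⟩
  · rintro ⟨m, l⟩ h
    simp only [Finset.mem_filter, Finset.mem_sigma, Finset.mem_range, Finset.mem_Icc] at h ⊢
    have : l + (m + 1 - l) - 1 = m := by omega
    rw [this]
  · rintro ⟨l, r⟩ h
    simp only [Finset.mem_filter, Finset.mem_sigma, Finset.mem_range, Finset.mem_Icc] at h ⊢
    have hne : ¬ (l = 0 ∧ r = 0) := by rintro ⟨rfl, rfl⟩; exact h.2 h0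
    have : l + r - 1 + 1 - l = r := by omega
    rw [this]
  · rintro ⟨m, l⟩ h; rfl

noncomputable def RHS (n p : ℕ) : ℕ :=
  ∑ m ∈ Finset.range (n + 1), ∑ l ∈ Finset.Icc (m + (p + 1) - (n + 1)) (min p (m + 1)),
    p.choose l * (n + 1 - p).choose (m + 1 - l) *
      (((if l = 0 then M m 0 else 0) + ∑ r ∈ Finset.range l, M m r) * M (n - m) (p - l))

theorem filter_add (A : Finset ℕ) (a : ℕ) : (A.filter (· < a)).card + (A.filter (¬ · < a)).card = A.card :=
  Finset.card_filter_add_card_filter_not _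

theorem G_step (n : ℕ) (ih : ∀ (S : Finset ℕ) (a : ℕ), S.card ≤ n → G S a = M S.card (S.filter (· < a)).card)
    (S : Finset ℕ) (hS : S.card = n + 1) (a : ℕ) : G S a = RHS n (S.filter (· < a)).card := by
  rw [G_rec S (Finset.card_pos.1 (by omega)) a]
  have hsum := filter_add S a
  set p := (S.filter (· < a)).card with hp
  let f : ℕ → ℕ → ℕ := fun l q => if l + q = 0 then 0 else
    ((if l = 0 then M (l + q - 1) 0 else 0) + ∑ r ∈ Finset.range l, M (l + q - 1) r) * M (n - (l + q - 1)) (p - l)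
  have h1 : ∀ A ∈ S.powerset, (∑ x ∈ rootOK A a, G (A.erase x) x) * G (S \ A) a =
      f (A.filter (· < a)).card (A.filter (¬ · < a)).card := by
    intro A hA
    rw [Finset.mem_powerset] at hA
    simp only [f, filter_add]
    by_cases h0 : A.card = 0
    · rw [if_pos h0]
      rw [Finset.card_eq_zero] at h0
      subst h0
      simp [rootOK]
    · have hAS := Finset.card_le_card hA
      rw [if_neg h0, root_sum A (Finset.card_pos.1 (by omega)) a (A.card - 1) (by omega)]
      · rw [ih (S \ A) a (by rw [Finset.card_sdiff_of_subset hA]; omega), Finset.card_sdiff_of_subset hA]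
        congr 2
        · omega
        · have : (S \ A).filter (· < a) = S.filter (· < a) \ A.filter (· < a) := by
            ext z; simp only [Finset.mem_filter, Finset.mem_sdiff]; tauto
          rw [this, Finset.card_sdiff_of_subset (Finset.filter_subset_filter _ hA)]
      · intro x hx
        have hc := Finset.card_erase_of_mem hx
        rw [ih _ x (by omega), hc]
  rw [Finset.sum_congr rfl h1, sum_powerset_split, reindex n]
  · unfold RHS
    refine Finset.sum_congr rfl fun m hm => Finset.sum_congr rfl fun l hl => ?_
    rw [Finset.mem_Icc] at hl
    have e1 : l + (m + 1 - l) = m + 1 := by omega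
    have e2 : (S.filter (¬ · < a)).card = n + 1 - p := by omega
    simp only [f, e1, e2, ← hp]
    simp
  · omega
  · simp [f]

theorem Icc_filter (n p : ℕ) (h : p ≤ n) : ((Finset.Icc 1 n).filter (· < p + 1)).card = p := by
  have : (Finset.Icc 1 n).filter (· < p + 1) = Finset.Icc 1 p := by
    ext z; simp only [Finset.mem_filter, Finset.mem_Icc]; omega
  rw [this]; simp

theorem G_eq_M (n : ℕ) : ∀ (S : Finset ℕ) (a : ℕ), S.card ≤ n → G S a = M S.card (S.filter (· < a)).card := by
  induction n with
  | zero =>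
    intro S a h
    have : S = ∅ := by simpa using h
    subst this
    simp [M, G_empty]
  | succ n ih =>
    intro S a h
    by_cases hc : S.card ≤ n
    · exact ih S a hc
    have hc : S.card = n + 1 := by omega
    have hf := filter_add S a
    rw [G_step n ih S hc a, M, G_step n ih _ (by simp [hc]), Icc_filter _ _ (by omega)]

theorem M_rec (n p : ℕ) (h : p ≤ n + 1) : M (n + 1) p = RHS n p := by
  rw [M, G_step n (G_eq_M n) _ (by simp), Icc_filter _ _ h]

theorem final (N : ℕ → ℕ → ℕ) (hN : ∀ n k, 1 ≤ k → N n k = M n (k - 1)) 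
    (n k : ℕ) (hk1 : 1 ≤ k) (hk2 : k ≤ n + 2) :
    N (n + 1) k =
      ∑ m ∈ Finset.range (n + 1),
        ∑ l ∈ Finset.Icc (m + k - (n + 1)) (min (k - 1) (m + 1)),
          Nat.choose (k - 1) l * Nat.choose (n + 2 - k) (m + 1 - l) *
            ((if l = 0 then N m 1 else 0) + ∑ r ∈ Finset.Icc 1 l, N m r) *
            N (n - m) (k - l) := by
  obtain ⟨p, rfl⟩ : ∃ p, k = p + 1 := ⟨k - 1, by omega⟩
  rw [hN _ _ hk1, Nat.add_sub_cancel, M_rec _ _ (by omega), RHS]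
  refine Finset.sum_congr rfl fun m hm => Finset.sum_congr rfl fun l hl => ?_
  rw [Finset.mem_Icc] at hl
  rw [hN m 1 le_rfl, hN (n - m) (p + 1 - l) (by omega)]
  have e1 : n + 2 - (p + 1) = n + 1 - p := by omega
  have e2 : p + 1 - l - 1 = p - l := by omega
  have e3 : ∑ r ∈ Finset.Icc 1 l, N m r = ∑ r ∈ Finset.range l, M m r := by
    rw [← Finset.Ico_add_one_right_eq_Icc, Finset.sum_Ico_eq_sum_range, Nat.add_sub_cancel]
    refine Finset.sum_congr rfl fun r hr => ?_
    rw [hN _ _ (by omega), Nat.add_sub_cancel_left]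
  rw [e1, e2, e3]
  simp only [mul_assoc, Nat.sub_self]

end VT

namespace VT

theorem V_noPeak {I : Type*} [LinearOrder I] (l : List I) (h : IsVList l) (i j k : ℕ) (hij : i < j)
    (hjk : j < k) (hk : k < l.length) : ¬ (l[i] < l[j] ∧ l[k] < l[j]) := by
  obtain ⟨⟨m, hm⟩, h1, h2⟩ := h
  simp only [List.get_eq_getElem] at h1 h2
  rintro ⟨g1, g2⟩
  have dec : ∀ d, ∀ h : i + d ≤ m, l[i + d]'(by omega) ≤ l[i] := by
    intro d
    induction d with
    | zero => intro h; exact le_rfl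
    | succ d ih => intro h; exact (h1 (i + d) h).le.trans (ih (by omega))
  have inc : m ≤ j → ∀ d, ∀ h : j + d < l.length, l[j] ≤ l[j + d] := by
    intro hmj d
    induction d with
    | zero => intro h; exact le_rfl
    | succ d ih => intro h; exact (ih (by omega)).trans (h2 (j + d) (by omega) h).le
  rcases le_total j m with hj | hj
  · have := dec (j - i) (by omega)
    simp only [show i + (j - i) = j by omega] at this
    exact absurd g1 (not_lt.2 this)
  · have := inc hj (k - j) (by omega)
    simp only [show j + (k - j) = k by omega] at this
    exact absurd g2 (not_lt.2 this)

theorem V_noPeak' {I : Type*} [LinearOrder I] (l1 l2 l3 l4 : List I) (x y z : I)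
    (h : IsVList (l1 ++ x :: (l2 ++ y :: (l3 ++ z :: l4)))) : ¬ (x < y ∧ z < y) := by
  have := V_noPeak _ h l1.length (l1.length + 1 + l2.length) (l1.length + 1 + l2.length + 1 + l3.length)
    (by omega) (by omega) (by simp; omega)
  convert this using 3 <;> grind

theorem V_of_noPeak {I : Type*} [LinearOrder I] (l : List I) (hne : l ≠ []) (hd : l.Nodup)
    (hp : ∀ i j k, ∀ hij : i < j, ∀ hjk : j < k, ∀ hk : k < l.length, ¬ (l[i] < l[j] ∧ l[k] < l[j])) : IsVList l := by
  have : Nonempty (Fin l.length) := ⟨⟨0, List.length_pos_iff.2 hne⟩⟩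
  obtain ⟨⟨m, hm⟩, hmin⟩ := Finite.exists_min (fun i : Fin l.length => l.get i)
  simp only [List.get_eq_getElem] at hmin
  have hmin' : ∀ j, ∀ h : j < l.length, l[m] ≤ l[j] := fun j h => hmin ⟨j, h⟩
  have hd' : ∀ i j, ∀ hi : i < l.length, ∀ hj : j < l.length, i ≠ j → l[i] ≠ l[j] := by
    intro i j hi hj hij h
    exact hij ((List.Nodup.getElem_inj_iff hd).1 h)
  refine ⟨⟨m, hm⟩, ?_, ?_⟩
  · intro j h
    simp only [List.get_eq_getElem]
    dsimp only at h
    by_contra hc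
    have h1 := lt_of_le_of_ne (not_lt.1 hc) (hd' _ _ _ _ (by omega))
    have h2 := lt_of_le_of_lt (hmin' j (by omega)) h1
    have : j + 1 ≠ m := by rintro rfl; exact lt_irrefl _ h2
    exact hp j (j+1) m (by omega) (by omega) hm ⟨h1, h2⟩
  · intro j hj h
    simp only [List.get_eq_getElem]
    dsimp only at hj
    by_contra hc
    have h1 := lt_of_le_of_ne (not_lt.1 hc) (hd' _ _ _ _ (by omega))
    have h2 := lt_of_le_of_lt (hmin' (j+1) h) h1
    have : j ≠ m := by rintro rfl; exact lt_irrefl _ h2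
    exact hp m j (j+1) (by omega) (by omega) h ⟨h2, h1⟩

theorem inner_trans {n : ℕ} {A B C : Finset (Fin n)} (h1 : BlockInner A B) (h2 : BlockInner B C) :
    BlockInner A C := by
  obtain ⟨x, hx, y, hy, hxy, hc, hB⟩ := h1
  obtain ⟨u, hu, v, hv, huv, hc', hC⟩ := h2
  exact ⟨x, hx, y, hy, hxy, hc, fun k hk => ⟨(hB u hu).1.trans (hC k hk).1, (hC k hk).2.trans (hB v hv).2⟩⟩

theorem inner_irrefl {n : ℕ} (A : Finset (Fin n)) : ¬ BlockInner A A := by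
  rintro ⟨x, hx, y, hy, hxy, hc, hB⟩
  exact lt_irrefl _ (hB x hx).1

open Classical in
theorem exists_chain {n : ℕ} (P : Finset (Finset (Fin n))) (L : ℕ) : ∀ A C, A ∈ P → C ∈ P → BlockInner A C →
    (P.filter (fun B => BlockInner A B ∧ BlockInner B C)).card ≤ L →
    ∃ c : List (Finset (Fin n)), (∀ B ∈ c, B ∈ P) ∧ (A :: (c ++ [C])).IsChain (NearestOuter P) := by
  induction L with
  | zero =>
    intro A C hA hC hAC h
    refine ⟨[], by simp, ?_⟩
    simp only [List.nil_append, List.isChain_cons_cons, List.isChain_singleton, and_true]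
    refine ⟨hA, hC, hAC, ?_⟩
    rintro ⟨B, hB, hB'⟩
    have : B ∈ (P.filter (fun B => BlockInner A B ∧ BlockInner B C)) := Finset.mem_filter.2 ⟨hB, hB'⟩
    have := Finset.card_pos.2 ⟨B, this⟩
    omega
  | succ L ih =>
    intro A C hA hC hAC h
    by_cases hex : ∃ B ∈ P, BlockInner A B ∧ BlockInner B C
    · obtain ⟨B, hB, h1, h2⟩ := hex
      have hlt : ∀ X Y, (X = A ∨ BlockInner A X) → (Y = C ∨ BlockInner Y C) → (X = B ∨ Y = B) →
          (P.filter (fun B => BlockInner X B ∧ BlockInner B Y)).card ≤ L := by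
        intro X Y hX hY hXY
        have : (P.filter (fun B => BlockInner X B ∧ BlockInner B Y)).card <
            (P.filter (fun B => BlockInner A B ∧ BlockInner B C)).card := by
          refine Finset.card_lt_card ⟨?_, ?_⟩
          · intro Z hZ
            rw [Finset.mem_filter] at hZ ⊢
            refine ⟨hZ.1, ?_, ?_⟩
            · rcases hX with rfl | hX
              · exact hZ.2.1
              · exact inner_trans hX hZ.2.1
            · rcases hY with rfl | hY
              · exact hZ.2.2
              · exact inner_trans hZ.2.2 hY
          · intro hsub
            have := hsub (Finset.mem_filter.2 ⟨hB, h1, h2⟩)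
            rw [Finset.mem_filter] at this
            rcases hXY with rfl | rfl
            · exact inner_irrefl _ this.2.1
            · exact inner_irrefl _ this.2.2
        omega
      obtain ⟨c1, k1, k2⟩ := ih A B hA hB h1 (hlt _ _ (Or.inl rfl) (Or.inr h2) (Or.inr rfl))
      obtain ⟨c2, k3, k4⟩ := ih B C hB hC h2 (hlt _ _ (Or.inr h1) (Or.inl rfl) (Or.inl rfl))
      refine ⟨c1 ++ B :: c2, ?_, ?_⟩
      · intro Z hZ
        simp only [List.mem_append, List.mem_cons] at hZ
        rcases hZ with hZ | rfl | hZ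
        · exact k1 _ hZ
        · exact hB
        · exact k3 _ hZ
      · have := (List.isChain_split (R := NearestOuter P) (l₁ := A :: c1) (c := B) (l₂ := c2 ++ [C])).2
          ⟨by simpa using k2, k4⟩
        simpa using this
    · refine ⟨[], by simp, ?_⟩
      simp only [List.nil_append, List.isChain_cons_cons, List.isChain_singleton, and_true]
      exact ⟨hA, hC, hAC, hex⟩

theorem exists_chain3 {n : ℕ} (P : Finset (Finset (Fin n))) (A B C) (hA : A ∈ P) (hB : B ∈ P) (hC : C ∈ P)
    (h1 : BlockInner A B) (h2 : BlockInner B C) : 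
    ∃ c1 c2 : List (Finset (Fin n)), (∀ X ∈ (A :: (c1 ++ B :: (c2 ++ [C]))), X ∈ P) ∧
      (A :: (c1 ++ B :: (c2 ++ [C]))).IsChain (NearestOuter P) := by
  obtain ⟨c1, k1, k2⟩ := exists_chain P _ A B hA hB h1 le_rfl
  obtain ⟨c2, k3, k4⟩ := exists_chain P _ B C hB hC h2 le_rfl
  refine ⟨c1, c2, ?_, ?_⟩
  · intro Z hZ
    simp only [List.mem_append, List.mem_cons, List.mem_nil_iff, or_false] at hZ
    rcases hZ with rfl | hZ | rfl | hZ | rfl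
    · exact hA
    · exact k1 _ hZ
    · exact hB
    · exact k3 _ hZ
    · exact hC
  · have := (List.isChain_split (R := NearestOuter P) (l₁ := A :: c1) (c := B) (l₂ := c2 ++ [C])).2
      ⟨by simpa using k2, k4⟩
    simpa using this

open Classical in
theorem exists_outer {n : ℕ} (P : Finset (Finset (Fin n))) (L : ℕ) : ∀ A, A ∈ P →
    (P.filter (fun B => BlockInner B A)).card ≤ L →
    ∃ B ∈ P, (B = A ∨ BlockInner B A) ∧ ¬ ∃ B' ∈ P, BlockInner B' B := by
  induction L with
  | zero =>
    intro A hA h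
    refine ⟨A, hA, Or.inl rfl, ?_⟩
    rintro ⟨B, hB, hB'⟩
    have : B ∈ (P.filter (fun B => BlockInner B A)) := Finset.mem_filter.2 ⟨hB, hB'⟩
    have := Finset.card_pos.2 ⟨B, this⟩
    omega
  | succ L ih =>
    intro A hA h
    by_cases hex : ∃ B ∈ P, BlockInner B A
    · obtain ⟨B, hB, hB'⟩ := hex
      have : (P.filter (fun X => BlockInner X B)).card < (P.filter (fun X => BlockInner X A)).card := by
        refine Finset.card_lt_card ⟨?_, ?_⟩
        · intro Z hZ
          rw [Finset.mem_filter] at hZ ⊢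
          exact ⟨hZ.1, inner_trans hZ.2 hB'⟩
        · intro hsub
          have := hsub (Finset.mem_filter.2 ⟨hB, hB'⟩)
          rw [Finset.mem_filter] at this
          exact inner_irrefl _ this.2
      obtain ⟨C, hC, h1, h2⟩ := ih B hB (by omega)
      refine ⟨C, hC, Or.inr ?_, h2⟩
      rcases h1 with rfl | h1
      · exact hB'
      · exact inner_trans h1 hB'
    · exact ⟨A, hA, Or.inl rfl, hex⟩

theorem chain_pairwise {n : ℕ} (P : Finset (Finset (Fin n))) (c : List (Finset (Fin n)))
    (h : c.IsChain (NearestOuter P)) : c.Pairwise BlockInner := by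
  have : IsTrans (Finset (Fin n)) BlockInner := ⟨fun _ _ _ => inner_trans⟩
  exact List.isChain_iff_pairwise.1 (h.imp fun a b hab => hab.2.2.1)

theorem half_lt (k x : ℕ) : ((k : ℚ) - 1 / 2 < x) ↔ k ≤ x := by
  constructor
  · intro h
    by_contra hc
    have : x + 1 ≤ k := by omega
    have : (x : ℚ) + 1 ≤ k := by exact_mod_cast this
    linarith
  · intro h
    have : (k : ℚ) ≤ x := by exact_mod_cast h
    linarith

theorem half_ne (k x : ℕ) : ((k : ℚ) - 1 / 2 ≠ x) := by
  intro h
  have h1 : (2 * k : ℚ) = 2 * x + 1 := by linarith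
  have h2 : 2 * k = 2 * x + 1 := by exact_mod_cast h1
  omega

theorem vcond_iff (n k : ℕ) (P : Finset (Finset (Fin (2 * n)))) (ℓ : Finset (Fin (2 * n)) → ℕ)
    (hinj : Set.InjOn ℓ ↑P) : (VLabeled P ℓ ∧ NextraCond n k P ℓ) ↔
    (∀ A ∈ P, ∀ B ∈ P, BlockInner A B → ¬ (k ≤ ℓ A ∧ ℓ B < ℓ A)) ∧
    (∀ A ∈ P, ∀ B ∈ P, ∀ C ∈ P, BlockInner A B → BlockInner B C → ¬ (ℓ A < ℓ B ∧ ℓ C < ℓ B)) := by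
  constructor
  · rintro ⟨hV, hN⟩
    constructor
    · intro A hA B hB hAB
      obtain ⟨R, hR, h1, h2⟩ := exists_outer P _ A hA le_rfl
      rcases h1 with rfl | h1
      · obtain ⟨c, k1, k2⟩ := exists_chain P _ R B hA hB hAB le_rfl
        have := hN R (c ++ [B]) (by
          intro Z hZ
          simp only [List.mem_append, List.mem_cons, List.mem_nil_iff, or_false] at hZ
          rcases hZ with rfl | hZ | rfl
          · exact hR
          · exact k1 _ hZ
          · exact hB) h2 k2
        have := V_noPeak' [] [] (c.map (fun B => (ℓ B : ℚ))) [] ((k : ℚ) - 1 / 2) (ℓ R) (ℓ B) (by simpa using this)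
        rw [half_lt, Nat.cast_lt] at this
        exact this
      · obtain ⟨c1, c2, k1, k2⟩ := exists_chain3 P R A B hR hA hB h1 hAB
        have := hN R _ k1 h2 k2
        have := V_noPeak' [] ((R :: c1).map (fun B => (ℓ B : ℚ))) (c2.map (fun B => (ℓ B : ℚ))) []
          ((k : ℚ) - 1 / 2) (ℓ A) (ℓ B) (by simpa using this)
        rw [half_lt, Nat.cast_lt] at this
        exact this
    · intro A hA B hB C hC h1 h2
      obtain ⟨c1, c2, k1, k2⟩ := exists_chain3 P A B C hA hB hC h1 h2
      have := hV _ k1 k2 (by simp)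
      exact V_noPeak' [] (c1.map ℓ) (c2.map ℓ) [] _ _ _ (by simpa using this)
  · rintro ⟨h2, h3⟩
    have nd : ∀ c : List (Finset (Fin (2 * n))), (∀ B ∈ c, B ∈ P) → c.IsChain (NearestOuter P) →
        (c.map ℓ).Nodup := by
      intro c hc hch
      refine List.Nodup.map_on (fun x hx y hy h => hinj (hc x hx) (hc y hy) h) ?_
      exact (chain_pairwise P c hch).imp (fun {a b} hab he => by subst he; exact inner_irrefl _ hab)
    constructor
    · intro c hc hch hne
      have pw := List.pairwise_iff_getElem.1 (chain_pairwise P c hch)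
      refine V_of_noPeak _ (by simpa using hne) (nd c hc hch) ?_
      intro i j l hij hjl hl
      rw [List.length_map] at hl
      simp only [List.getElem_map]
      exact h3 _ (hc _ (List.getElem_mem _)) _ (hc _ (List.getElem_mem _)) _ (hc _ (List.getElem_mem _))
        (pw _ _ _ _ hij) (pw _ _ _ _ hjl)
    · intro R c hc hR hch
      have pw := List.pairwise_iff_getElem.1 (chain_pairwise P _ hch)
      have nd' := nd _ hc hch
      generalize R :: c = d at *
      refine V_of_noPeak _ (by simp) ?_ ?_
      · rw [List.nodup_cons]
        constructor
        · intro hm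
          obtain ⟨B, _, hB⟩ := List.mem_map.1 hm
          exact half_ne k (ℓ B) hB.symm
        · have := nd'.map (f := (Nat.cast : ℕ → ℚ)) Nat.cast_injective
          rw [List.map_map] at this
          exact this
      · intro i j l hij hjl hl
        simp only [List.length_cons, List.length_map] at hl
        obtain ⟨j, rfl⟩ : ∃ j', j = j' + 1 := ⟨j - 1, by omega⟩
        obtain ⟨l, rfl⟩ : ∃ l', l = l' + 1 := ⟨l - 1, by omega⟩
        cases i with
        | zero =>
          simp only [List.getElem_cons_succ, List.getElem_map, List.getElem_cons_zero, Nat.cast_lt, half_lt]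
          exact h2 _ (hc _ (List.getElem_mem _)) _ (hc _ (List.getElem_mem _)) (pw _ _ _ _ (by omega))
        | succ i =>
          simp only [List.getElem_cons_succ, List.getElem_map, Nat.cast_lt]
          exact h3 _ (hc _ (List.getElem_mem _)) _ (hc _ (List.getElem_mem _)) _ (hc _ (List.getElem_mem _))
            (pw _ _ _ _ (by omega)) (pw _ _ _ _ (by omega))

def blk (N a b : ℕ) : Finset (Fin N) := Finset.univ.filter (fun x => x.val = a ∨ x.val = b)

theorem mem_blk {N a b : ℕ} (x : Fin N) : x ∈ blk N a b ↔ (x.val = a ∨ x.val = b) := by simp [blk]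

theorem exists_blk {N : ℕ} (B : Finset (Fin N)) (h : B.card = 2) : ∃ a b, a < b ∧ b < N ∧ B = blk N a b := by
  obtain ⟨x, y, hxy, rfl⟩ := Finset.card_eq_two.1 h
  rcases lt_or_gt_of_ne hxy with h | h
  · refine ⟨x, y, h, y.2, ?_⟩
    ext z; simp [mem_blk, Fin.ext_iff]
  · refine ⟨y, x, h, x.2, ?_⟩
    ext z; simp [mem_blk, Fin.ext_iff, or_comm]

theorem card_blk {N a b : ℕ} (h1 : a < b) (h2 : b < N) : (blk N a b).card = 2 := by
  have : blk N a b = {⟨a, by omega⟩, ⟨b, h2⟩} := by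
    ext z; simp [mem_blk, Fin.ext_iff]
  rw [this, Finset.card_pair]
  simp; omega

theorem blk_inj {N a b a' b' : ℕ} (h1 : a < b) (h2 : b < N) (h1' : a' < b') (h2' : b' < N)
    (h : blk N a b = blk N a' b') : a = a' ∧ b = b' := by
  have g : ∀ x, x < N → ((x = a ∨ x = b) ↔ (x = a' ∨ x = b')) := by
    intro x hx
    have := mem_blk (a := a) (b := b) ⟨x, hx⟩
    rw [h, mem_blk] at this
    exact this.symm
  have := g a (by omega)
  have := g b (by omega)
  have := g a' (by omega)
  have := g b' (by omega)
  omega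

theorem inner_blk {N a b a' b' : ℕ} (h1 : a < b) (h2 : b < N) (h1' : a' < b') (h2' : b' < N) :
    BlockInner (blk N a b) (blk N a' b') ↔ a < a' ∧ b' < b := by
  constructor
  · rintro ⟨x, hx, y, hy, hxy, hc, hB⟩
    have g1 := hB ⟨a', by omega⟩ ((mem_blk _).2 (Or.inl rfl))
    have g2 := hB ⟨b', by omega⟩ ((mem_blk _).2 (Or.inr rfl))
    rw [mem_blk] at hx hy
    simp only [Fin.lt_def] at *
    omega
  · rintro ⟨g1, g2⟩
    refine ⟨⟨a, by omega⟩, (mem_blk _).2 (Or.inl rfl), ⟨b, by omega⟩, (mem_blk _).2 (Or.inr rfl), h1, ?_, ?_⟩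
    · intro z hz
      rw [mem_blk] at hz
      simp only [Fin.lt_def]; omega
    · intro z hz
      rw [mem_blk] at hz
      simp only [Fin.lt_def]; omega

def Drel (N : ℕ) (P : Finset (Finset (Fin N))) (ℓ : Finset (Fin N) → ℕ) (a b x : ℕ) : Prop :=
  a < b ∧ b < N ∧ blk N a b ∈ P ∧ ℓ (blk N a b) = x

theorem struct_iff (N : ℕ) (P : Finset (Finset (Fin N))) (ℓ : Finset (Fin N) → ℕ) (h2 : ∀ B ∈ P, B.card = 2) :
    (IsPartitionOn P ∧ NonCrossing P) ↔ Struct (Drel N P ℓ) 0 N := by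
  constructor
  · rintro ⟨⟨hne, hp⟩, hnc⟩
    refine ⟨fun a b x g => ⟨by omega, g.1, g.2.1⟩, ?_, ?_, ?_⟩
    · intro p _ hpN
      obtain ⟨B, ⟨hB, hpB⟩, _⟩ := hp ⟨p, hpN⟩
      obtain ⟨a, b, hab, hb, rfl⟩ := exists_blk B (h2 B hB)
      exact ⟨a, b, _, ⟨hab, hb, hB, rfl⟩, (mem_blk _).1 hpB⟩
    · rintro a b x a' b' x' ⟨h1, h2, h3, h4⟩ ⟨h1', h2', h3', h4'⟩ hh
      have key : ∃ p : Fin N, p ∈ blk N a b ∧ p ∈ blk N a' b' := by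
        rcases hh with h | h | h | h
        · exact ⟨⟨a, by omega⟩, (mem_blk _).2 (Or.inl rfl), (mem_blk _).2 (Or.inl h)⟩
        · exact ⟨⟨a, by omega⟩, (mem_blk _).2 (Or.inl rfl), (mem_blk _).2 (Or.inr h)⟩
        · exact ⟨⟨b, by omega⟩, (mem_blk _).2 (Or.inr rfl), (mem_blk _).2 (Or.inl h)⟩
        · exact ⟨⟨b, by omega⟩, (mem_blk _).2 (Or.inr rfl), (mem_blk _).2 (Or.inr h)⟩
      obtain ⟨p, p1, p2⟩ := key
      have e := (hp p).unique ⟨h3, p1⟩ ⟨h3', p2⟩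
      obtain ⟨rfl, rfl⟩ := blk_inj h1 h2 h1' h2' e
      exact ⟨rfl, rfl, h4.symm.trans h4'⟩
    · rintro a b x a' b' x' ⟨h1, h2, h3, h4⟩ ⟨h1', h2', h3', h4'⟩ hh
      refine hnc _ h3 _ h3' (fun e => ?_) ⟨⟨a, by omega⟩, (mem_blk _).2 (Or.inl rfl), ⟨b, by omega⟩,
        (mem_blk _).2 (Or.inr rfl), ⟨a', by omega⟩, (mem_blk _).2 (Or.inl rfl), ⟨b', by omega⟩,
        (mem_blk _).2 (Or.inr rfl), hh⟩
      have := blk_inj h1 h2 h1' h2' e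
      omega
  · intro h
    refine ⟨⟨fun B hB => Finset.card_pos.1 (by rw [h2 B hB]; omega), ?_⟩, ?_⟩
    · rintro ⟨p, hp⟩
      obtain ⟨a, b, x, g, g'⟩ := h.cov p (by omega) hp
      refine ⟨blk N a b, ⟨g.2.2.1, (mem_blk _).2 g'⟩, ?_⟩
      rintro B ⟨hB, hpB⟩
      obtain ⟨a', b', hab, hb, rfl⟩ := exists_blk B (h2 B hB)
      rw [mem_blk] at hpB
      dsimp only at hpB
      obtain ⟨rfl, rfl, _⟩ := h.dis _ _ _ _ _ _ g ⟨hab, hb, hB, rfl⟩ (by omega)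
      rfl
    · rintro B hB B' hB' hne ⟨p1, m1, p2, m2, q1, m3, q2, m4, l1, l2, l3⟩
      obtain ⟨a, b, hab, hb, rfl⟩ := exists_blk B (h2 B hB)
      obtain ⟨a', b', hab', hb', rfl⟩ := exists_blk B' (h2 B' hB')
      have := h.nc _ _ _ _ _ _ ⟨hab, hb, hB, rfl⟩ ⟨hab', hb', hB', rfl⟩
      rw [mem_blk] at m1 m2 m3 m4
      simp only [Fin.lt_def] at *
      omega

theorem card_P (n : ℕ) (P : Finset (Finset (Fin (2 * n)))) (h : IsPartitionOn P) (h2 : ∀ B ∈ P, B.card = 2) :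
    P.card = n := by
  have h1 : (P.biUnion id).card = ∑ B ∈ P, B.card := by
    refine Finset.card_biUnion fun A hA B hB hne => ?_
    refine Finset.disjoint_left.2 fun p p1 p2 => hne ?_
    exact (h.2 p).unique ⟨hA, p1⟩ ⟨hB, p2⟩
  have h3 : P.biUnion id = Finset.univ := by
    ext p
    obtain ⟨B, hB, _⟩ := h.2 p
    simp only [Finset.mem_biUnion, Finset.mem_univ, iff_true]
    exact ⟨B, hB⟩
  rw [h3, Finset.sum_congr rfl h2] at h1
  simp at h1
  omega

theorem corr (n k : ℕ) (P : Finset (Finset (Fin (2 * n)))) (ℓ : Finset (Fin (2 * n)) → ℕ) :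
    (OV2cond n P ℓ ∧ NextraCond n k P ℓ) ↔ ((∀ B ∈ P, B.card = 2) ∧ (∀ B ∉ P, ℓ B = 0) ∧
      Struct (Drel (2 * n) P ℓ) 0 (2 * n) ∧ Lab (Drel (2 * n) P ℓ) k ∧
      ∀ x, (∃ a b, Drel (2 * n) P ℓ a b x) ↔ x ∈ Finset.Icc 1 n) := by
  constructor
  · rintro ⟨⟨hP, h2, hnc, hbij, hV, h0⟩, hN⟩
    obtain ⟨v2, v3⟩ := (vcond_iff n k P ℓ hbij.injOn).1 ⟨hV, hN⟩
    rw [card_P n P hP h2] at hbij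
    refine ⟨h2, h0, (struct_iff _ P ℓ h2).1 ⟨hP, hnc⟩, ⟨?_, ?_, ?_⟩, ?_⟩
    · rintro a b x a' b' ⟨h1, h2, h3, h4⟩ ⟨h1', h2', h3', h4'⟩
      exact blk_inj h1 h2 h1' h2' (hbij.injOn h3 h3' (h4.trans h4'.symm))
    · rintro a b x a' b' x' ⟨h1, h2, h3, rfl⟩ ⟨h1', h2', h3', rfl⟩ q1 q2
      exact v2 _ h3 _ h3' ((inner_blk h1 h2 h1' h2').2 ⟨q1, q2⟩)
    · rintro a b x a' b' x' a'' b'' x'' ⟨h1, h2, h3, rfl⟩ ⟨h1', h2', h3', rfl⟩ ⟨h1'', h2'', h3'', rfl⟩ q1 q2 q3 q4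
      exact v3 _ h3 _ h3' _ h3'' ((inner_blk h1 h2 h1' h2').2 ⟨q1, q2⟩) ((inner_blk h1' h2' h1'' h2'').2 ⟨q3, q4⟩)
    · intro x
      rw [← Finset.mem_coe, Finset.coe_Icc]
      constructor
      · rintro ⟨a, b, h1, h2, h3, rfl⟩
        exact hbij.mapsTo h3
      · intro hx
        obtain ⟨B, hB, rfl⟩ := hbij.surjOn hx
        obtain ⟨a, b, hab, hb, rfl⟩ := exists_blk B (h2 B hB)
        exact ⟨a, b, hab, hb, hB, rfl⟩
  · rintro ⟨h2, h0, hS, hL, hx⟩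
    obtain ⟨hP, hnc⟩ := (struct_iff _ P ℓ h2).2 hS
    have hinj : Set.InjOn ℓ ↑P := by
      intro A hA B hB hAB
      obtain ⟨a, b, hab, hb, rfl⟩ := exists_blk A (h2 A hA)
      obtain ⟨a', b', hab', hb', rfl⟩ := exists_blk B (h2 B hB)
      obtain ⟨rfl, rfl⟩ := hL.inj _ _ _ _ _ ⟨hab, hb, hA, rfl⟩ ⟨hab', hb', hB, hAB.symm⟩
      rfl
    have hbij : Set.BijOn ℓ ↑P (Set.Icc 1 P.card) := by
      rw [card_P n P hP h2]
      refine ⟨?_, hinj, ?_⟩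
      · intro A hA
        obtain ⟨a, b, hab, hb, rfl⟩ := exists_blk A (h2 A hA)
        rw [← Finset.coe_Icc, Finset.mem_coe, ← hx]
        exact ⟨a, b, hab, hb, hA, rfl⟩
      · intro x hx'
        rw [← Finset.coe_Icc, Finset.mem_coe, ← hx] at hx'
        obtain ⟨a, b, hab, hb, hA, rfl⟩ := hx'
        exact ⟨_, hA, rfl⟩
    obtain ⟨hV, hN⟩ := (vcond_iff n k P ℓ hinj).2 (by
      constructor
      · intro A hA B hB hAB
        obtain ⟨a, b, hab, hb, rfl⟩ := exists_blk A (h2 A hA)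
        obtain ⟨a', b', hab', hb', rfl⟩ := exists_blk B (h2 B hB)
        rw [inner_blk hab hb hab' hb'] at hAB
        exact hL.pk2 _ _ _ _ _ _ ⟨hab, hb, hA, rfl⟩ ⟨hab', hb', hB, rfl⟩ hAB.1 hAB.2
      · intro A hA B hB C hC hAB hBC
        obtain ⟨a, b, hab, hb, rfl⟩ := exists_blk A (h2 A hA)
        obtain ⟨a', b', hab', hb', rfl⟩ := exists_blk B (h2 B hB)
        obtain ⟨a'', b'', hab'', hb'', rfl⟩ := exists_blk C (h2 C hC)
        rw [inner_blk hab hb hab' hb'] at hAB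
        rw [inner_blk hab' hb' hab'' hb''] at hBC
        exact hL.pk3 _ _ _ _ _ _ _ _ _ ⟨hab, hb, hA, rfl⟩ ⟨hab', hb', hB, rfl⟩ ⟨hab'', hb'', hC, rfl⟩
          hAB.1 hAB.2 hBC.1 hBC.2)
    exact ⟨⟨hP, h2, hnc, hbij, hV, h0⟩, hN⟩

theorem Drel_inj (N : ℕ) (P P' : Finset (Finset (Fin N))) (ℓ ℓ' : Finset (Fin N) → ℕ)
    (h2 : ∀ B ∈ P, B.card = 2) (h2' : ∀ B ∈ P', B.card = 2) (h0 : ∀ B ∉ P, ℓ B = 0) (h0' : ∀ B ∉ P', ℓ' B = 0)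
    (h : ∀ a b x, Drel N P ℓ a b x ↔ Drel N P' ℓ' a b x) : P = P' ∧ ℓ = ℓ' := by
  have hP : P = P' := by
    ext B
    constructor
    · intro hB
      obtain ⟨a, b, hab, hb, rfl⟩ := exists_blk B (h2 B hB)
      exact ((h _ _ _).1 ⟨hab, hb, hB, rfl⟩).2.2.1
    · intro hB
      obtain ⟨a, b, hab, hb, rfl⟩ := exists_blk B (h2' B hB)
      exact ((h _ _ _).2 ⟨hab, hb, hB, rfl⟩).2.2.1
  refine ⟨hP, funext fun B => ?_⟩
  by_cases hB : B ∈ P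
  · obtain ⟨a, b, hab, hb, rfl⟩ := exists_blk B (h2 B hB)
    exact ((h _ _ _).1 ⟨hab, hb, hB, rfl⟩).2.2.2.symm
  · rw [h0 B hB, h0' B (hP ▸ hB)]

open Classical in
theorem Drel_surj (N : ℕ) (t : VT) (hN : N = 2 * size t) : ∃ (P : Finset (Finset (Fin N))) (ℓ : Finset (Fin N) → ℕ),
    (∀ B ∈ P, B.card = 2) ∧ (∀ B ∉ P, ℓ B = 0) ∧ ∀ a b x, mem t 0 a b x ↔ Drel N P ℓ a b x := by
  have hs := mem_struct t 0
  rw [zero_add, ← hN] at hs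
  let Q : Finset (Fin N) → ℕ → Prop := fun B x => ∃ a b, mem t 0 a b x ∧ B = blk N a b
  have hQ : ∀ a b x, a < b → b < N → Q (blk N a b) x → mem t 0 a b x := by
    rintro a b x h1 h2 ⟨a', b', hm, he⟩
    have r := hs.rng _ _ _ hm
    obtain ⟨rfl, rfl⟩ := blk_inj h1 h2 r.2.1 r.2.2 he
    exact hm
  refine ⟨Finset.univ.filter (fun B => ∃ x, Q B x), fun B => if h : ∃ x, Q B x then h.choose else 0, ?_, ?_, ?_⟩
  · intro B hB
    obtain ⟨_, x, a, b, hm, rfl⟩ := Finset.mem_filter.1 hB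
    have r := hs.rng _ _ _ hm
    exact card_blk r.2.1 r.2.2
  · intro B hB
    have : ¬ ∃ x, Q B x := by simpa using hB
    exact dif_neg this
  · intro a b x
    constructor
    · intro hm
      have r := hs.rng _ _ _ hm
      have hex : ∃ x, Q (blk N a b) x := ⟨x, a, b, hm, rfl⟩
      refine ⟨r.2.1, r.2.2, Finset.mem_filter.2 ⟨Finset.mem_univ _, hex⟩, ?_⟩
      beta_reduce
      rw [dif_pos hex]
      exact (hs.dis _ _ _ _ _ _ (hQ _ _ _ r.2.1 r.2.2 hex.choose_spec) hm (Or.inl rfl)).2.2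
    · rintro ⟨h1, h2, h3, h4⟩
      have hex : ∃ x, Q (blk N a b) x := (Finset.mem_filter.1 h3).2
      beta_reduce at h4
      rw [dif_pos hex] at h4
      rw [← h4]
      exact hQ _ _ _ h1 h2 hex.choose_spec

theorem Ncount_eq (n k : ℕ) (hk : 1 ≤ k) : Ncount n k = M n (k - 1) := by
  unfold M G Ncount
  rw [Nat.sub_add_cancel hk]
  have key : ∀ x : {x : Finset (Finset (Fin (2 * n))) × (Finset (Fin (2 * n)) → ℕ) //
      OV2cond n x.1 x.2 ∧ NextraCond n k x.1 x.2}, ∃ t : {t : VT // lab t = Finset.Icc 1 n ∧ OK t k},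
      ∀ a b y, mem t.1 0 a b y ↔ Drel (2 * n) x.1.1 x.1.2 a b y := by
    rintro ⟨⟨P, ℓ⟩, h⟩
    rw [corr] at h
    obtain ⟨h2, h0, hS, hL, hx⟩ := h
    obtain ⟨t, ht, _⟩ := struct_exists _ _ _ _ (by omega) le_rfl hS
    have e : mem t 0 = Drel (2 * n) P ℓ := by
      funext a b y; exact propext (ht a b y)
    refine ⟨⟨t, ?_, ?_⟩, ht⟩
    · ext y
      rw [← mem_lab t 0, ← hx, e]
    · rw [ok_iff t 0, e]; exact hL
  choose f hf using key
  refine Nat.card_eq_of_bijective f ⟨?_, ?_⟩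
  · intro x x' hxx
    have c := (corr n k _ _).1 x.2
    have c' := (corr n k _ _).1 x'.2
    have := Drel_inj _ _ _ _ _ c.1 c'.1 c.2.1 c'.2.1 (fun a b y => by rw [← hf x, ← hf x', hxx])
    exact Subtype.ext (Prod.ext this.1 this.2)
  · rintro ⟨t, h1, h2⟩
    have hsz : size t = n := by rw [← ok_size t k h2, h1]; simp
    obtain ⟨P, ℓ, c2, c0, hD⟩ := Drel_surj (2 * n) t (by rw [hsz])
    have e : mem t 0 = Drel (2 * n) P ℓ := by
      funext a b y; exact propext (hD a b y)
    have hc := (corr n k P ℓ).2 ⟨c2, c0, by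
      have := mem_struct t 0
      rwa [e, zero_add, hsz] at this, by rw [← e, ← ok_iff]; exact h2, fun x => by
      rw [← h1, ← mem_lab t 0, e]⟩
    refine ⟨⟨(P, ℓ), hc⟩, Subtype.ext (mem_inj _ 0 _ fun a b y => ?_)⟩
    rw [hf, hD]

end VT

/-- Lemma 3: the recurrence
`N_{n+1,k} = Σ_{m=0}^{n} Σ_{l=L₁(k,m)}^{L₂(k,m)} C(k−1,l)·C(n+2−k, m+1−l)·
  [δ_{l,0}·N_{m,1} + Σ_{r=1}^{l} N_{m,r}]·N_{n−m,k−l}`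
with `L₁(k,m) = max(0, m+k−n−1)` and `L₂(k,m) = min(k−1, m+1)`. -/
theorem Ncount_recurrence (n k : ℕ) (hk1 : 1 ≤ k) (hk2 : k ≤ n + 2) :
    Ncount (n + 1) k =
      ∑ m ∈ Finset.range (n + 1),
        ∑ l ∈ Finset.Icc (m + k - (n + 1)) (min (k - 1) (m + 1)),
          Nat.choose (k - 1) l * Nat.choose (n + 2 - k) (m + 1 - l) *
            ((if l = 0 then Ncount m 1 else 0) + ∑ r ∈ Finset.Icc 1 l, Ncount m r) *
            Ncount (n - m) (k - l) := by
  exact VT.final Ncount VT.Ncount_eq n k hk1 hk2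
end

section
/- The sequence q_n = 2^{−n}·C(2n, n) of even moments of the standard arcsine distribution satisfies q_0 = 1 and, for every n ≥ 0, q_{n+1} = Σ_{m=0}^{n} q_m · q_{n−m} / (m+1). -/
/-- The even moments `qₙ = 2^{-n}·C(2n, n)` of the standard arcsine distribution. -/
noncomputable def arcsineMoment (n : ℕ) : ℚ := (Nat.choose (2 * n) n : ℚ) / 2 ^ n

theorem arcsineMoment_eq_catalan (n : ℕ) :
    arcsineMoment n = (n + 1) * (catalan n : ℚ) / 2 ^ n := by
  unfold arcsineMoment
  rw [← Nat.centralBinom_eq_two_mul_choose, ← succ_mul_catalan_eq_centralBinom]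
  push_cast
  ring

/-- The sequence `qₙ = 2^{-n}·C(2n,n)` satisfies `q₀ = 1` and
`q_{n+1} = Σ_{m=0}^{n} qₘ·q_{n−m}/(m+1)`. -/
theorem arcsineMoment_recurrence :
    arcsineMoment 0 = 1 ∧
      ∀ n : ℕ, arcsineMoment (n + 1) =
        ∑ m ∈ Finset.range (n + 1), arcsineMoment m * arcsineMoment (n - m) / (m + 1) := by
  refine ⟨by simp [arcsineMoment], fun n => ?_⟩
  have hcat : (catalan (n + 1) : ℚ) =
      ∑ m ∈ Finset.range (n + 1), (catalan m : ℚ) * catalan (n - m) := by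
    rw [catalan_succ, ← Fin.sum_univ_eq_sum_range (fun m => (catalan m : ℚ) * catalan (n - m))]
    push_cast
    rfl
  have hterm : ∀ m ∈ Finset.range (n + 1),
      arcsineMoment m * arcsineMoment (n - m) / (m + 1) =
        ((n : ℚ) - m + 1) * (catalan m * catalan (n - m)) / 2 ^ n := by
    intro m hm
    have hmn : m ≤ n := by
      have := Finset.mem_range.1 hm
      omega
    have hpow : (2 : ℚ) ^ n = 2 ^ m * 2 ^ (n - m) := by
      rw [← pow_add, Nat.add_sub_cancel' hmn]
    have hm1 : (m : ℚ) + 1 ≠ 0 := by positivity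
    rw [arcsineMoment_eq_catalan, arcsineMoment_eq_catalan, hpow, Nat.cast_sub hmn]
    field_simp
  rw [Finset.sum_congr rfl hterm, ← Finset.sum_div, arcsineMoment_eq_catalan, hcat]
  -- Symmetrize the weighted convolution under `m ↦ n - m`.
  have hrefl := Finset.sum_range_reflect
    (fun m => ((n : ℚ) - m + 1) * ((catalan m : ℚ) * catalan (n - m))) (n + 1)
  have hrefl2 : ∑ m ∈ Finset.range (n + 1), ((m : ℚ) + 1) * ((catalan m : ℚ) * catalan (n - m)) =
      ∑ m ∈ Finset.range (n + 1), ((n : ℚ) - m + 1) * ((catalan m : ℚ) * catalan (n - m)) := by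
    rw [← hrefl]
    refine Finset.sum_congr rfl fun m hm => ?_
    have hmn : m ≤ n := by
      have := Finset.mem_range.1 hm
      omega
    have h1 : n + 1 - 1 - m = n - m := by omega
    have h2 : n - (n - m) = m := by omega
    simp only [h1, h2]
    rw [Nat.cast_sub hmn]
    ring
  have hsum : ((n : ℚ) + 2) * ∑ m ∈ Finset.range (n + 1), (catalan m : ℚ) * catalan (n - m) =
      2 * ∑ m ∈ Finset.range (n + 1), ((n : ℚ) - m + 1) * ((catalan m : ℚ) * catalan (n - m)) := by
    rw [two_mul]
    nth_rewrite 1 [← hrefl2]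
    rw [← Finset.sum_add_distrib, Finset.mul_sum]
    refine Finset.sum_congr rfl fun m _ => ?_
    ring
  have hc : (((n + 1 : ℕ) : ℚ) + 1) = n + 2 := by
    push_cast
    ring
  rw [hc, hsum, pow_succ]
  field_simp
end

section
/- For every plane binary tree t and every x ∈ [0, 1], Q_t(x) = q_t · (1−x)^{|t|}. -/
/-- Plane binary trees, encoding non-crossing pair partitions via the recursive
decomposition `π = (first block, inner part π′, right part π″)`. -/
inductive PBTree where
  | leaf : PBTree
  | node : PBTree → PBTree → PBTree

/-- The number of `node` constructors of a plane binary tree (the number of blocks of the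
encoded pair partition). -/
def PBTree.size : PBTree → ℕ
  | .leaf => 0
  | .node t₁ t₂ => t₁.size + t₂.size + 1

/-- The function `Q_t` on `[0,1]` associated with a plane binary tree:
`Q_leaf = 1` and `Q_{node(t′,t″)}(x) = (∫_x^1 Q_{t′}(s) ds)·Q_{t″}(x)`. -/
noncomputable def PBTree.Qt : PBTree → ℝ → ℝ
  | .leaf, _ => 1
  | .node t₁ t₂, x => (∫ s in x..1, PBTree.Qt t₁ s) * PBTree.Qt t₂ x

/-- The rational `q_t` associated with a plane binary tree:
`q_leaf = 1` and `q_{node(t′,t″)} = q_{t′}·q_{t″}/(|t′| + 1)`. -/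
def PBTree.qt : PBTree → ℚ
  | .leaf => 1
  | .node t₁ t₂ => t₁.qt * t₂.qt / (t₁.size + 1)

theorem Qt_aux (t : PBTree) : ∀ x : ℝ, t.Qt x = (t.qt : ℝ) * (1 - x) ^ t.size := by
  induction t with
  | leaf => intro x; simp [PBTree.Qt, PBTree.qt, PBTree.size]
  | node a b iha ihb =>
    intro x
    have hI : (∫ s in x..1, PBTree.Qt a s)
        = (a.qt : ℝ) * ((1 - x) ^ (a.size + 1) / ((a.size : ℝ) + 1)) := by
      simp_rw [iha]
      rw [intervalIntegral.integral_const_mul,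
        intervalIntegral.integral_comp_sub_left (fun y : ℝ => y ^ a.size) 1, integral_pow]
      simp
    have hne : ((a.size : ℝ) + 1) ≠ 0 := by positivity
    simp only [PBTree.Qt, PBTree.qt, PBTree.size]
    rw [hI, ihb]
    push_cast
    field_simp
    ring

/-- Remark 3: `Q_t(x) = q_t·(1−x)^{|t|}` for every plane binary tree `t` and `x ∈ [0,1]`. -/
theorem Qt_eq_qt_mul_pow (t : PBTree) (x : ℝ) (hx : x ∈ Set.Icc (0:ℝ) 1) :
    t.Qt x = (t.qt : ℝ) * (1 - x) ^ t.size := by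
  exact Qt_aux t x
end

section
/- Fix z ∈ (0, 1/4) and define u(ξ) = ξ · S(ξ/√(1−2z)) for ξ ∈ [√(1−2z), 1]; note that ξ/√(1−2z) ∈ [1, 1/√(1−2z)] ⊆ (0, exp(√3·π/9)], so S is defined there. Then u is differentiable on [√(1−2z), 1], u(√(1−2z)) = √(1−2z), and u(ξ)·u′(ξ) − u(ξ) = −ξ for every ξ ∈ [√(1−2z), 1]. -/
/-- `T(t) = ∫_t^1 s/(s² − s + 1) ds`; the integrand is continuous on all of `ℝ` since
`s² − s + 1 > 0` for every real `s`, and `T(0) = √3·π/9`. -/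
noncomputable def Tfun (t : ℝ) : ℝ := ∫ s in t..1, s / (s ^ 2 - s + 1)

lemma aux_pos (s : ℝ) : 0 < s ^ 2 - s + 1 := by nlinarith [sq_nonneg (s - 1 / 2)]

lemma aux_cont : Continuous (fun s : ℝ => s / (s ^ 2 - s + 1)) :=
  continuous_id.div (by fun_prop) (fun s => (aux_pos s).ne')

lemma aux_deriv (t : ℝ) : HasStrictDerivAt Tfun (-(t / (t ^ 2 - t + 1))) t := by
  have := intervalIntegral.integral_hasStrictDerivAt_left
    (aux_cont.intervalIntegrable t 1) (aux_cont.stronglyMeasurableAtFilter _ _)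
    aux_cont.continuousAt
  exact this

lemma aux_T1 : Tfun 1 = 0 := by simp [Tfun]

lemma aux_T0 : 1 / 2 ≤ Tfun 0 := by
  have h : ∫ s in (0:ℝ)..1, s ≤ Tfun 0 := by
    apply intervalIntegral.integral_mono_on (by norm_num)
      (continuous_id.intervalIntegrable _ _) (aux_cont.intervalIntegrable _ _)
    intro x hx
    rw [le_div_iff₀ (aux_pos x)]
    simp only [id]
    nlinarith [hx.1, hx.2, mul_nonneg hx.1 (mul_nonneg hx.1 (sub_nonneg.2 hx.2))]
  rw [integral_id] at h
  linarith

lemma aux_exists (y : ℝ) (h1 : 1 ≤ y) (h2 : y < 3 / 2) :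
    ∃ t : ℝ, 0 < t ∧ Real.exp (Tfun t) = y := by
  have hc : Continuous (fun t => Real.exp (Tfun t)) :=
    Real.continuous_exp.comp
      (continuous_iff_continuousAt.2 fun t => (aux_deriv t).hasDerivAt.continuousAt)
  have h0 : 3 / 2 ≤ Real.exp (Tfun 0) := by
    have := Real.add_one_le_exp (Tfun 0)
    linarith [aux_T0]
  obtain ⟨t, ht, hty⟩ := intermediate_value_Icc' (zero_le_one (α := ℝ)) hc.continuousOn
    (show y ∈ Set.Icc (Real.exp (Tfun 1)) (Real.exp (Tfun 0)) from
      ⟨by simpa [aux_T1] using h1, by linarith⟩)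
  refine ⟨t, lt_of_le_of_ne ht.1 ?_, hty⟩
  rintro rfl
  simp only at hty
  linarith

lemma aux_main (S : ℝ → ℝ) (hS : ∀ t : ℝ, 0 ≤ t → S (Real.exp (Tfun t)) = t)
    (r : ℝ) (hr : 0 < r) (ξ : ℝ) (h1 : 1 ≤ ξ / r) (h2 : ξ / r < 3 / 2) :
    ∃ t : ℝ, 0 < t ∧ S (ξ / r) = t ∧
      HasDerivAt (fun ξ : ℝ => ξ * S (ξ / r)) ((t - 1) / t) ξ := by
  obtain ⟨t, ht, hty⟩ := aux_exists _ h1 h2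
  have hp := aux_pos t
  have hSt : S (ξ / r) = t := by rw [← hty]; exact hS t ht.le
  refine ⟨t, ht, hSt, ?_⟩
  have hne : Real.exp (Tfun t) * (-(t / (t ^ 2 - t + 1))) ≠ 0 :=
    mul_ne_zero (Real.exp_pos _).ne' (neg_ne_zero.2 (div_pos ht hp).ne')
  have hd := ((aux_deriv t).exp.to_local_left_inverse hne
    (g := S) (by filter_upwards [lt_mem_nhds ht] with x hx using hS x hx.le)).hasDerivAt
  rw [hty] at hd
  have hd2 := (hasDerivAt_id ξ).mul
    (HasDerivAt.comp ξ hd ((hasDerivAt_id ξ).div_const r))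
  have hξ : ξ ≠ 0 := by
    rintro rfl
    norm_num at h1
  have he : 1 * (S ∘ fun x => id x / r) ξ +
      id ξ * ((ξ / r * -(t / (t ^ 2 - t + 1)))⁻¹ * (1 / r)) = (t - 1) / t := by
    simp only [id, Function.comp, hSt]
    have hp' := hp.ne'
    field_simp
    ring
  rw [he] at hd2
  exact hd2

/-- Part of Lemma 6: for `z ∈ (0, 1/4)` and `S` the inverse function of `t ↦ exp(T(t))`
on `[0, ∞)`, the function `u(ξ) = ξ·S(ξ/√(1−2z))` is differentiable on `[√(1−2z), 1]`,
satisfies `u(√(1−2z)) = √(1−2z)`, and solves the Abel equation `u·u′ − u = −ξ` there. -/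
theorem abel_solution (z : ℝ) (hz0 : 0 < z) (hz : z < 1 / 4)
    (S : ℝ → ℝ) (hS : ∀ t : ℝ, 0 ≤ t → S (Real.exp (Tfun t)) = t) :
    (fun ξ : ℝ => ξ * S (ξ / Real.sqrt (1 - 2 * z))) (Real.sqrt (1 - 2 * z)) =
        Real.sqrt (1 - 2 * z) ∧
      DifferentiableOn ℝ (fun ξ : ℝ => ξ * S (ξ / Real.sqrt (1 - 2 * z)))
        (Set.Icc (Real.sqrt (1 - 2 * z)) 1) ∧
      ∀ ξ ∈ Set.Icc (Real.sqrt (1 - 2 * z)) 1,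
        (fun ξ : ℝ => ξ * S (ξ / Real.sqrt (1 - 2 * z))) ξ *
            derivWithin (fun ξ : ℝ => ξ * S (ξ / Real.sqrt (1 - 2 * z)))
              (Set.Icc (Real.sqrt (1 - 2 * z)) 1) ξ -
          (fun ξ : ℝ => ξ * S (ξ / Real.sqrt (1 - 2 * z))) ξ = -ξ := by
  have hr : 0 < Real.sqrt (1 - 2 * z) := Real.sqrt_pos.2 (by linarith)
  have hr2 : 2 / 3 < Real.sqrt (1 - 2 * z) := by
    apply Real.lt_sqrt_of_sq_lt
    linarith
  have key := fun (ξ : ℝ) (hξ : ξ ∈ Set.Icc (Real.sqrt (1 - 2 * z)) 1) =>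
    aux_main S hS _ hr ξ ((one_le_div hr).2 hξ.1)
      (by rw [div_lt_iff₀ hr]; linarith [hξ.2])
  have hlt : Real.sqrt (1 - 2 * z) < 1 := by
    rw [Real.sqrt_lt' one_pos]
    linarith
  refine ⟨?_, ?_, ?_⟩
  · have := hS 1 zero_le_one
    rw [aux_T1, Real.exp_zero] at this
    simp only [div_self hr.ne', this, mul_one]
  · intro ξ hξ
    obtain ⟨t, _, _, hd⟩ := key ξ hξ
    exact hd.differentiableAt.differentiableWithinAt
  · intro ξ hξ
    obtain ⟨t, ht, hSt, hd⟩ := key ξ hξ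
    rw [hd.hasDerivWithinAt.derivWithin (uniqueDiffOn_Icc hlt ξ hξ)]
    simp only [hSt]
    field_simp
    ring
end
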